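/- Let a<b be real and let ψ : ℝ → ]0,+∞[ be a bounded Borel function with ∫_{−∞}^{+∞} ψ(t) dt < +∞ and inf_K ψ > 0 for every compact K ⊂ ℝ. Define the relaxed functional F̄₁(u) := inf{ liminf_{k→∞} F₁(u_k) : u_k → u in L¹(]a,b[) }. Then F̄₁(u) = |u'|(]a,b[) + |v'|(]a,b[ \ S_u) + Σ_{x ∈ S_u} Φ(ν_u(x), (u')^a₋(x), (u')^a₊(x)) if u ∈ X¹_ψ(]a,b[), and F̄₁(u) = +∞ otherwise, where v := Ψ₁∘(u')^a, ν_u := sign(u₊ − u₋), Φ(1,t₁,t₂) := ∫_{t₁}^{+∞} ψ(t) dt + ∫_{t₂}^{+∞} ψ(t) dt, and Φ(−1,t₁,t₂) := ∫_{−∞}^{t₁} ψ(t) dt + ∫_{−∞}^{t₂} ψ(t) dt. -/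

import Mathlib

open MeasureTheory Filter Set Topology
open scoped ENNReal NNReal

noncomputable section

/-- `Ψ₁(t) = ∫_{-∞}^t ψ(s) ds`. -/
def Psi1 (ψ : ℝ → ℝ) (t : ℝ) : ℝ := ∫ s in Set.Iic t, ψ s

/-- `Ψ_p(t) = ∫_{-∞}^t ψ(s)^{1/p} ds`. -/
def Psip (ψ : ℝ → ℝ) (p t : ℝ) : ℝ := ∫ s in Set.Iic t, ψ s ^ (1 / p)

/-- The natural extension of `Ψ₁` to the extended reals:
`Ψ₁(-∞) = 0`, `Ψ₁(+∞) = ∫_ℝ ψ`. -/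
def Psi1E (ψ : ℝ → ℝ) (t : EReal) : ℝ :=
  if t = ⊤ then ∫ s, ψ s else if t = ⊥ then 0 else Psi1 ψ t.toReal

/-- Standing assumptions on `ψ` in the case `p = 1`: a bounded, everywhere positive
Borel function, integrable on `ℝ`, whose infimum on every compact set is positive. -/
structure PsiHyp (ψ : ℝ → ℝ) : Prop where
  measurable : Measurable ψ
  pos : ∀ t, 0 < ψ t
  bounded : ∃ C, ∀ t, ψ t ≤ C
  integrable : MeasureTheory.Integrable ψ
  inf_pos : ∀ K : Set ℝ, IsCompact K → ∃ δ > 0, ∀ t ∈ K, δ ≤ ψ t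

/-- Standing assumptions on `ψ` in the case `p > 1`: as in `PsiHyp` but with
`ψ^{1/p}` integrable on `ℝ`. -/
structure PsiHypP (ψ : ℝ → ℝ) (p : ℝ) : Prop where
  measurable : Measurable ψ
  pos : ∀ t, 0 < ψ t
  bounded : ∃ C, ∀ t, ψ t ≤ C
  integrable : MeasureTheory.Integrable fun t => ψ t ^ (1 / p)
  inf_pos : ∀ K : Set ℝ, IsCompact K → ∃ δ > 0, ∀ t ∈ K, δ ≤ ψ t

/-- `(μp, μn)` is the Jordan decomposition of the distributional derivative of
`u ∈ L¹(]a,b[)`; the existence of such a pair encodes `u ∈ BV(]a,b[)`,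
and `μp + μn` is the total variation measure `|u'|`. -/
def IsDerivMeasures (a b : ℝ) (u : ℝ → ℝ) (μp μn : Measure ℝ) : Prop :=
  MeasureTheory.IntegrableOn u (Set.Ioo a b) ∧
  IsFiniteMeasure μp ∧ IsFiniteMeasure μn ∧ μp ⟂ₘ μn ∧
  μp (Set.Ioo a b)ᶜ = 0 ∧ μn (Set.Ioo a b)ᶜ = 0 ∧
  ∀ φ : ℝ → ℝ, ContDiff ℝ 1 φ → tsupport φ ⊆ Set.Ioo a b →
    ∫ x in Set.Ioo a b, u x * deriv φ x = (∫ x, φ x ∂μn) - ∫ x, φ x ∂μp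

/-- The density `(u')^a` of the absolutely continuous part of the derivative whose
Jordan decomposition is `(μp, μn)`. -/
def uaD (μp μn : Measure ℝ) (x : ℝ) : ℝ :=
  (μp.rnDeriv MeasureTheory.volume x).toReal - (μn.rnDeriv MeasureTheory.volume x).toReal

/-- Left approximate limit `u₋(y) = lim_{ε→0⁺} ε⁻¹ ∫_{y-ε}^y u`. -/
def leftApproxLim (u : ℝ → ℝ) (y : ℝ) : ℝ :=
  limUnder (𝓝[>] (0 : ℝ)) fun ε => (∫ x in Set.Ioo (y - ε) y, u x) / ε

/-- Right approximate limit `u₊(y) = lim_{ε→0⁺} ε⁻¹ ∫_y^{y+ε} u`. -/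
def rightApproxLim (u : ℝ → ℝ) (y : ℝ) : ℝ :=
  limUnder (𝓝[>] (0 : ℝ)) fun ε => (∫ x in Set.Ioo y (y + ε), u x) / ε

/-- Left approximate limit computed in the extended reals (may be `±∞`). -/
def leftApproxLimE (u : ℝ → ℝ) (y : ℝ) : EReal :=
  limUnder (𝓝[>] (0 : ℝ)) fun ε => (((∫ x in Set.Ioo (y - ε) y, u x) / ε : ℝ) : EReal)

/-- Right approximate limit computed in the extended reals (may be `±∞`). -/
def rightApproxLimE (u : ℝ → ℝ) (y : ℝ) : EReal :=
  limUnder (𝓝[>] (0 : ℝ)) fun ε => (((∫ x in Set.Ioo y (y + ε), u x) / ε : ℝ) : EReal)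

/-- The jump set `S_u` of `u` in `]a,b[`. -/
def jumpSet (a b : ℝ) (u : ℝ → ℝ) : Set ℝ :=
  {y | y ∈ Set.Ioo a b ∧ leftApproxLim u y ≠ rightApproxLim u y}

/-- `ν_u = sign(u₊ - u₋)`. -/
def jumpSign (u : ℝ → ℝ) (y : ℝ) : ℝ :=
  Real.sign (rightApproxLim u y - leftApproxLim u y)

/-- `Z⁺[w] = {x ∈ ]a,b[ : lim_{ε→0⁺} (2ε)⁻¹∫_{x-ε}^{x+ε} w = +∞}`. -/
def ZPlus (a b : ℝ) (w : ℝ → ℝ) : Set ℝ :=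
  {x | x ∈ Set.Ioo a b ∧
    Tendsto (fun ε => (∫ t in Set.Ioo (x - ε) (x + ε), w t) / (2 * ε)) (𝓝[>] (0 : ℝ)) atTop}

/-- `Z⁻[w] = {x ∈ ]a,b[ : lim_{ε→0⁺} (2ε)⁻¹∫_{x-ε}^{x+ε} w = -∞}`. -/
def ZMinus (a b : ℝ) (w : ℝ → ℝ) : Set ℝ :=
  {x | x ∈ Set.Ioo a b ∧
    Tendsto (fun ε => (∫ t in Set.Ioo (x - ε) (x + ε), w t) / (2 * ε)) (𝓝[>] (0 : ℝ)) atBot}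

/-- The positive part `((u')^c)⁺` of the Cantor part of the derivative of `u`:
the singular part of `μp` with the atoms on the jump set removed. -/
def cantorPos (a b : ℝ) (u : ℝ → ℝ) (μp : Measure ℝ) : Measure ℝ :=
  (μp.singularPart MeasureTheory.volume).restrict (jumpSet a b u)ᶜ

/-- The negative part `((u')^c)⁻` of the Cantor part of the derivative of `u`. -/
def cantorNeg (a b : ℝ) (u : ℝ → ℝ) (μn : Measure ℝ) : Measure ℝ :=
  (μn.singularPart MeasureTheory.volume).restrict (jumpSet a b u)ᶜ

/-- `u ∈ X¹_ψ(]a,b[)`, with derivative data `(μp, μn)`:  `u ∈ BV(]a,b[)`,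
`Ψ₁∘(u')^a ∈ BV(]a,b[)`, and `((u')^c)^±` is concentrated on `Z^±[(u')^a]`. -/
def MemX1 (ψ : ℝ → ℝ) (a b : ℝ) (u : ℝ → ℝ) (μp μn : Measure ℝ) : Prop :=
  IsDerivMeasures a b u μp μn ∧
  (∃ νp νn : Measure ℝ, IsDerivMeasures a b (fun x => Psi1 ψ (uaD μp μn x)) νp νn) ∧
  cantorPos a b u μp (ZPlus a b (uaD μp μn))ᶜ = 0 ∧
  cantorNeg a b u μn (ZMinus a b (uaD μp μn))ᶜ = 0

/-- `f ∈ W^{1,p}(]a,b[)`: `f` has an absolutely continuous representative whose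
pointwise a.e. derivative lies in `L^p(]a,b[)`. -/
def MemW1pOn (p a b : ℝ) (f : ℝ → ℝ) : Prop :=
  ∃ g w : ℝ → ℝ,
    (∀ᵐ x ∂(MeasureTheory.volume.restrict (Set.Ioo a b)), g x = f x) ∧
    MeasureTheory.IntegrableOn w (Set.Ioo a b) ∧
    MeasureTheory.IntegrableOn (fun x => |w x| ^ p) (Set.Ioo a b) ∧
    ∀ x ∈ Set.Ioo a b, ∀ y ∈ Set.Ioo a b, g y - g x = ∫ t in x..y, w t

/-- `u ∈ X^p_ψ(]a,b[)`, with derivative data `(μp, μn)`:  `u ∈ BV(]a,b[)`,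
`Ψ_p∘(u')^a ∈ W^{1,p}(]a,b[)`, and `((u')^s)^±` is concentrated on `Z^±[(u')^a]`. -/
def MemXp (ψ : ℝ → ℝ) (p a b : ℝ) (u : ℝ → ℝ) (μp μn : Measure ℝ) : Prop :=
  IsDerivMeasures a b u μp μn ∧
  MemW1pOn p a b (fun x => Psip ψ p (uaD μp μn x)) ∧
  (μp.singularPart MeasureTheory.volume) (ZPlus a b (uaD μp μn))ᶜ = 0 ∧
  (μn.singularPart MeasureTheory.volume) (ZMinus a b (uaD μp μn))ᶜ = 0

/-- `u ∈ W^{2,p}(]a,b[)` with first derivative `v` and second derivative `w`. -/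
def W2pRep (p a b : ℝ) (u v w : ℝ → ℝ) : Prop :=
  (∀ x ∈ Set.Ioo a b, HasDerivAt u (v x) x) ∧
  (∀ x ∈ Set.Ioo a b, ∀ y ∈ Set.Ioo a b, v y - v x = ∫ t in x..y, w t) ∧
  MeasureTheory.IntegrableOn u (Set.Ioo a b) ∧
  MeasureTheory.IntegrableOn v (Set.Ioo a b) ∧
  MeasureTheory.IntegrableOn w (Set.Ioo a b) ∧
  MeasureTheory.IntegrableOn (fun x => |w x| ^ p) (Set.Ioo a b)

/-- The functional `F_p(u) = ∫_a^b |u'| + ∫_a^b ψ(u')|u''|^p` if `u ∈ W^{2,p}(]a,b[)`,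
`+∞` otherwise (as an infimum over Sobolev representations). -/
def Fp (ψ : ℝ → ℝ) (p a b : ℝ) (u : ℝ → ℝ) : ℝ≥0∞ :=
  ⨅ (v : ℝ → ℝ) (w : ℝ → ℝ) (_ : W2pRep p a b u v w),
    ENNReal.ofReal ((∫ x in Set.Ioo a b, |v x|) + ∫ x in Set.Ioo a b, ψ (v x) * |w x| ^ p)

/-- Strong `L¹(]a,b[)` convergence of a sequence. -/
def TendstoL1 (a b : ℝ) (U : ℕ → ℝ → ℝ) (u : ℝ → ℝ) : Prop :=
  (∀ k, MeasureTheory.IntegrableOn (U k) (Set.Ioo a b)) ∧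
  MeasureTheory.IntegrableOn u (Set.Ioo a b) ∧
  Tendsto (fun k => ∫ x in Set.Ioo a b, |U k x - u x|) atTop (𝓝 0)

/-- The relaxed functional
`F̄_p(u) = inf { liminf_k F_p(u_k) : u_k → u in L¹(]a,b[) }`. -/
def FpRel (ψ : ℝ → ℝ) (p a b : ℝ) (u : ℝ → ℝ) : ℝ≥0∞ :=
  ⨅ (U : ℕ → ℝ → ℝ) (_ : TendstoL1 a b U u),
    liminf (fun k => Fp ψ p a b (U k)) atTop

/-- `Φ(s, t₁, t₂)` of the relaxation formula (`s` being the sign of the jump). -/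
def Phi (ψ : ℝ → ℝ) (s : ℝ) (t₁ t₂ : EReal) : ℝ :=
  if 0 < s then ((∫ t, ψ t) - Psi1E ψ t₁) + ((∫ t, ψ t) - Psi1E ψ t₂)
  else Psi1E ψ t₁ + Psi1E ψ t₂

/-- `Φ̂(s, t₁, t₂)` of Remark 2.5. -/
def PhiHat (ψ : ℝ → ℝ) (s : ℝ) (t₁ t₂ : EReal) : ℝ :=
  if 0 < s then (∫ t, ψ t) - Psi1E ψ (max t₁ t₂)
  else Psi1E ψ (min t₁ t₂)

/-- `ubar` is a `C¹([a,b])` representative of `u`. -/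
def C1Rep (a b : ℝ) (u ubar : ℝ → ℝ) : Prop :=
  (∀ᵐ x ∂(MeasureTheory.volume.restrict (Set.Ioo a b)), ubar x = u x) ∧
  ContDiffOn ℝ 1 ubar (Set.Icc a b)

/-- `u` solves `min { F̄₁(w) + λ ∫_a^b (w - G)² : w ∈ X¹_ψ(]a,b[) }`. -/
def IsSolution1 (ψ : ℝ → ℝ) (a b lam : ℝ) (G u : ℝ → ℝ) : Prop :=
  (∃ μp μn : Measure ℝ, MemX1 ψ a b u μp μn) ∧
  ∀ w : ℝ → ℝ, (∃ ηp ηn : Measure ℝ, MemX1 ψ a b w ηp ηn) →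
    FpRel ψ 1 a b u + ENNReal.ofReal (lam * ∫ x in Set.Ioo a b, (u x - G x) ^ 2) ≤
    FpRel ψ 1 a b w + ENNReal.ofReal (lam * ∫ x in Set.Ioo a b, (w x - G x) ^ 2)

/-- `u` solves `min { F̄_p(w) + λ ∫_a^b |w - G|² : w ∈ X^p_ψ(]a,b[) }`. -/
def IsSolutionP (ψ : ℝ → ℝ) (p a b lam : ℝ) (G u : ℝ → ℝ) : Prop :=
  (∃ μp μn : Measure ℝ, MemXp ψ p a b u μp μn) ∧
  ∀ w : ℝ → ℝ, (∃ ηp ηn : Measure ℝ, MemXp ψ p a b w ηp ηn) →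
    FpRel ψ p a b u + ENNReal.ofReal (lam * ∫ x in Set.Ioo a b, (u x - G x) ^ 2) ≤
    FpRel ψ p a b w + ENNReal.ofReal (lam * ∫ x in Set.Ioo a b, (w x - G x) ^ 2)

/-- The Rudin–Osher–Fatemi energy `|w'|(]a,b[) + λ∫_a^b (w-g)²`, where `(ηp, ηn)`
is the Jordan decomposition of the derivative of `w`. -/
def ROFenergy (a b lam : ℝ) (g w : ℝ → ℝ) (ηp ηn : Measure ℝ) : ℝ≥0∞ :=
  (ηp + ηn) (Set.Ioo a b) + ENNReal.ofReal (lam * ∫ x in Set.Ioo a b, (w x - g x) ^ 2)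

/-- The left-continuous generalized inverse `g^{-1}(c) = inf {x ∈ [a,b] : g(x) ≥ c}`. -/
def gInv (a b : ℝ) (g : ℝ → ℝ) (c : ℝ) : ℝ :=
  sInf {x | x ∈ Set.Icc a b ∧ c ≤ g x}

end

noncomputable section
open MeasureTheory Filter Set Topology
open scoped ENNReal NNReal

lemma Psi1_sub_Psi1 {ψ : ℝ → ℝ} (hψ : PsiHyp ψ) (s t : ℝ) :
    Psi1 ψ t - Psi1 ψ s = ∫ x in s..t, ψ x :=
  intervalIntegral.integral_Iic_sub_Iic hψ.integrable.integrableOn hψ.integrable.integrableOn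

lemma Psi1_strictMono {ψ : ℝ → ℝ} (hψ : PsiHyp ψ) : StrictMono (Psi1 ψ) := by
  intro s t hst
  have h := Psi1_sub_Psi1 hψ s t
  have : 0 < ∫ x in s..t, ψ x :=
    intervalIntegral.intervalIntegral_pos_of_pos hψ.integrable.intervalIntegrable hψ.pos hst
  linarith

lemma Psi1_continuous {ψ : ℝ → ℝ} (hψ : PsiHyp ψ) : Continuous (Psi1 ψ) := by
  have h : Psi1 ψ = fun t => Psi1 ψ 0 + ∫ x in (0 : ℝ)..t, ψ x := by
    funext t
    have := Psi1_sub_Psi1 hψ 0 t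
    linarith
  rw [h]
  exact continuous_const.add
    (intervalIntegral.continuous_primitive (fun _ _ => hψ.integrable.intervalIntegrable) 0)

lemma Psi1_tendsto_atTop {ψ : ℝ → ℝ} (hψ : PsiHyp ψ) :
    Tendsto (Psi1 ψ) atTop (𝓝 (∫ s, ψ s)) :=
  (aecover_Iic tendsto_id).integral_tendsto_of_countably_generated hψ.integrable

lemma Psi1_tendsto_atBot {ψ : ℝ → ℝ} (hψ : PsiHyp ψ) :
    Tendsto (Psi1 ψ) atBot (𝓝 0) := by
  have h1 : Tendsto (fun t => ∫ s in Ioi t, ψ s) atBot (𝓝 (∫ s, ψ s)) :=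
    (aecover_Ioi tendsto_id).integral_tendsto_of_countably_generated hψ.integrable
  have h2 : Psi1 ψ = fun t => (∫ s, ψ s) - ∫ s in Ioi t, ψ s := by
    funext t
    have := integral_add_compl (measurableSet_Iic (a := t)) hψ.integrable
    rw [compl_Iic] at this
    simp only [Psi1]
    linarith
  rw [h2]
  simpa using h1.const_sub (∫ s, ψ s)

lemma Psi1_pos {ψ : ℝ → ℝ} (hψ : PsiHyp ψ) (t : ℝ) : 0 < Psi1 ψ t :=
  lt_of_le_of_lt ((Psi1_strictMono hψ).monotone.le_of_tendsto (Psi1_tendsto_atBot hψ) (t - 1))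
    (Psi1_strictMono hψ (by linarith))

lemma Psi1_lt {ψ : ℝ → ℝ} (hψ : PsiHyp ψ) (t : ℝ) : Psi1 ψ t < ∫ s, ψ s :=
  lt_of_lt_of_le (Psi1_strictMono hψ (by linarith : t < t + 1))
    ((Psi1_strictMono hψ).monotone.ge_of_tendsto (Psi1_tendsto_atTop hψ) (t + 1))

@[simp] lemma Psi1E_coe (ψ : ℝ → ℝ) (t : ℝ) : Psi1E ψ (t : EReal) = Psi1 ψ t := by
  simp [Psi1E]

@[simp] lemma Psi1E_top (ψ : ℝ → ℝ) : Psi1E ψ ⊤ = ∫ s, ψ s := by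
  simp [Psi1E]

@[simp] lemma Psi1E_bot (ψ : ℝ → ℝ) : Psi1E ψ ⊥ = 0 := by
  simp [Psi1E]

lemma Psi1E_strictMono {ψ : ℝ → ℝ} (hψ : PsiHyp ψ) : StrictMono (Psi1E ψ) := by
  intro s t hst
  induction s with
  | top => exact absurd hst not_top_lt
  | bot =>
    induction t with
    | top => simpa using (Psi1_pos hψ 0).trans (Psi1_lt hψ 0)
    | bot => exact absurd hst (lt_irrefl _)
    | coe t => simpa using Psi1_pos hψ t
  | coe s =>
    induction t with
    | top => simpa using Psi1_lt hψ s
    | bot => exact absurd hst not_lt_bot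
    | coe t => simpa using Psi1_strictMono hψ (by exact_mod_cast hst)

lemma exists_Psi1E_eq {ψ : ℝ → ℝ} (hψ : PsiHyp ψ) {c : ℝ} (h0 : 0 ≤ c) (h1 : c ≤ ∫ s, ψ s) :
    ∃ t, Psi1E ψ t = c := by
  rcases h0.eq_or_lt with rfl | h0
  · exact ⟨⊥, by simp⟩
  rcases h1.eq_or_lt with rfl | h1
  · exact ⟨⊤, by simp⟩
  obtain ⟨x, hx⟩ := ((Psi1_tendsto_atBot hψ).eventually (gt_mem_nhds h0)).exists
  obtain ⟨y, hy⟩ := ((Psi1_tendsto_atTop hψ).eventually (lt_mem_nhds h1)).exists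
  have := mem_range_of_exists_le_of_exists_ge (Psi1_continuous hψ) ⟨x, hx.le⟩ ⟨y, hy.le⟩
  obtain ⟨t, ht⟩ := this
  exact ⟨(t : EReal), by simpa using ht⟩

lemma Psi1_nonneg_le {ψ : ℝ → ℝ} (hψ : PsiHyp ψ) (t : ℝ) :
    0 ≤ Psi1 ψ t ∧ Psi1 ψ t ≤ ∫ s, ψ s := ⟨(Psi1_pos hψ t).le, (Psi1_lt hψ t).le⟩

/-- The right-continuous primitive of the signed measure `μp - μn` that vanishes at `a`. -/
def prim (μp μn : Measure ℝ) (a x : ℝ) : ℝ := μp.real (Ioc a x) - μn.real (Ioc a x)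

lemma measureReal_Ioc_sub (μ : Measure ℝ) [IsFiniteMeasure μ] {a x y : ℝ} (hax : a ≤ x)
    (hxy : x ≤ y) : μ.real (Ioc a y) - μ.real (Ioc a x) = μ.real (Ioc x y) := by
  rw [← Ioc_union_Ioc_eq_Ioc hax hxy, measureReal_union (by
    rw [Set.disjoint_left]; intro z hz hz'; exact absurd hz.2 (not_le.2 hz'.1)) measurableSet_Ioc]
  ring

lemma prim_sub (μp μn : Measure ℝ) [IsFiniteMeasure μp] [IsFiniteMeasure μn] {a x y : ℝ}
    (hax : a ≤ x) (hxy : x ≤ y) :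
    prim μp μn a y - prim μp μn a x = μp.real (Ioc x y) - μn.real (Ioc x y) := by
  rw [← measureReal_Ioc_sub μp hax hxy, ← measureReal_Ioc_sub μn hax hxy]
  simp only [prim]; ring

lemma measureReal_Ioc_mono (μ : Measure ℝ) [IsFiniteMeasure μ] (a : ℝ) :
    Monotone fun x => μ.real (Ioc a x) := fun _ _ h =>
  measureReal_mono (Ioc_subset_Ioc_right h)

lemma prim_measurable (μp μn : Measure ℝ) [IsFiniteMeasure μp] [IsFiniteMeasure μn] (a : ℝ) :
    Measurable (prim μp μn a) :=
  (measureReal_Ioc_mono μp a).measurable.sub (measureReal_Ioc_mono μn a).measurable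

lemma abs_prim_le (μp μn : Measure ℝ) [IsFiniteMeasure μp] [IsFiniteMeasure μn] (a x : ℝ) :
    |prim μp μn a x| ≤ μp.real univ + μn.real univ := by
  have h1 : μp.real (Ioc a x) ≤ μp.real univ := measureReal_mono (subset_univ _)
  have h2 : μn.real (Ioc a x) ≤ μn.real univ := measureReal_mono (subset_univ _)
  have h3 : 0 ≤ μp.real (Ioc a x) := measureReal_nonneg
  have h4 : 0 ≤ μn.real (Ioc a x) := measureReal_nonneg
  rw [prim, abs_le]
  constructor <;> linarith

lemma prim_integrableOn (μp μn : Measure ℝ) [IsFiniteMeasure μp] [IsFiniteMeasure μn]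
    (a s t : ℝ) : IntegrableOn (prim μp μn a) (Ioo s t) :=
  Measure.integrableOn_of_bounded (M := μp.real univ + μn.real univ) (by simp)
    (prim_measurable μp μn a).aestronglyMeasurable
    (ae_of_all _ fun x => by simpa using abs_prim_le μp μn a x)

lemma integral_measureReal_Ioc_mul_deriv {a b : ℝ} (μ : Measure ℝ) [IsFiniteMeasure μ]
    (hμ : μ (Ioo a b)ᶜ = 0) {φ : ℝ → ℝ} (hφ : ContDiff ℝ 1 φ) (hs : tsupport φ ⊆ Ioo a b) :
    ∫ x in Ioo a b, μ.real (Ioc a x) * deriv φ x = - ∫ y, φ y ∂μ := by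
  have hcd : Continuous (deriv φ) := hφ.continuous_deriv le_rfl
  have hμae : ∀ᵐ y ∂μ, y ∈ Ioo a b := by
    rw [ae_iff]; exact hμ
  have hdi : IntegrableOn (deriv φ) (Ioo a b) :=
    (hcd.integrableOn_Icc (a := a) (b := b)).mono_set Ioo_subset_Icc_self
  have hm : MeasurableSet {p : ℝ × ℝ | p.2 ≤ p.1} := measurableSet_le measurable_snd measurable_fst
  have hint : Integrable (Function.uncurry fun x y => (Iic x).indicator (fun _ => deriv φ x) y)
      ((volume.restrict (Ioo a b)).prod μ) := by
    have h1 : Integrable (fun p : ℝ × ℝ => deriv φ p.1) ((volume.restrict (Ioo a b)).prod μ) :=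
      Integrable.comp_fst hdi μ
    have h2 := h1.indicator hm
    refine h2.congr (ae_of_all _ fun p => ?_)
    simp [Function.uncurry, indicator]
  have hswap := integral_integral_swap hint
  calc ∫ x in Ioo a b, μ.real (Ioc a x) * deriv φ x
      = ∫ x in Ioo a b, ∫ y, (Iic x).indicator (fun _ => deriv φ x) y ∂μ := by
        refine integral_congr_ae (ae_of_all _ fun x => ?_)
        simp only
        rw [integral_indicator measurableSet_Iic, setIntegral_const, smul_eq_mul]
        congr 1
        refine measureReal_congr ?_
        filter_upwards [hμae] with y hy
        simp only [eq_iff_iff]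
        exact ⟨fun h => h.2, fun h => ⟨hy.1, h⟩⟩
    _ = ∫ y, (∫ x in Ioo a b, (Iic x).indicator (fun _ => deriv φ x) y) ∂μ := hswap
    _ = ∫ y, - φ y ∂μ := by
        refine integral_congr_ae ?_
        filter_upwards [hμae] with y hy
        have h1 : ∀ x, (Iic x).indicator (fun _ => deriv φ x) y = (Ici y).indicator (deriv φ) x := by
          intro x; simp [indicator]
        simp only [h1]
        rw [setIntegral_indicator measurableSet_Ici]
        have h2 : Ioo a b ∩ Ici y = Ico y b := by
          ext z; simp only [mem_inter_iff, mem_Ioo, mem_Ici, mem_Ico]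
          constructor
          · rintro ⟨⟨_, h⟩, h'⟩; exact ⟨h', h⟩
          · rintro ⟨h', h⟩; exact ⟨⟨hy.1.trans_le h', h⟩, h'⟩
        rw [h2, integral_Ico_eq_integral_Ioc, ← intervalIntegral.integral_of_le hy.2.le,
          intervalIntegral.integral_deriv_eq_sub' φ rfl
            (fun x _ => (hφ.differentiable one_ne_zero).differentiableAt) hcd.continuousOn]
        have : φ b = 0 := image_eq_zero_of_notMem_tsupport fun h => lt_irrefl _ (hs h).2
        simp [this]
    _ = - ∫ y, φ y ∂μ := integral_neg _

lemma integral_prim_mul_deriv {a b : ℝ} (μp μn : Measure ℝ) [IsFiniteMeasure μp]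
    [IsFiniteMeasure μn] (hp : μp (Ioo a b)ᶜ = 0) (hn : μn (Ioo a b)ᶜ = 0) (c : ℝ) {φ : ℝ → ℝ}
    (hφ : ContDiff ℝ 1 φ) (hs : tsupport φ ⊆ Ioo a b) :
    ∫ x in Ioo a b, (c + prim μp μn a x) * deriv φ x = (∫ x, φ x ∂μn) - ∫ x, φ x ∂μp := by
  have hcd : Continuous (deriv φ) := hφ.continuous_deriv le_rfl
  have hdi : IntegrableOn (deriv φ) (Ioo a b) :=
    (hcd.integrableOn_Icc (a := a) (b := b)).mono_set Ioo_subset_Icc_self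
  have hb : ∀ (μ : Measure ℝ) [IsFiniteMeasure μ],
      IntegrableOn (fun x => μ.real (Ioc a x) * deriv φ x) (Ioo a b) := by
    intro μ _
    refine hdi.bdd_mul (c := μ.real univ)
      (measureReal_Ioc_mono μ a).measurable.aestronglyMeasurable (ae_of_all _ fun x => ?_)
    rw [Real.norm_of_nonneg measureReal_nonneg]
    exact measureReal_mono (subset_univ _)
  have h0 : ∫ x in Ioo a b, deriv φ x = 0 := by
    by_cases hab : a ≤ b
    · rw [← integral_Ioc_eq_integral_Ioo, ← intervalIntegral.integral_of_le hab,
          intervalIntegral.integral_deriv_eq_sub' φ rfl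
            (fun x _ => (hφ.differentiable one_ne_zero).differentiableAt) hcd.continuousOn]
      have h1 : φ b = 0 := image_eq_zero_of_notMem_tsupport fun h => lt_irrefl _ (hs h).2
      have h2 : φ a = 0 := image_eq_zero_of_notMem_tsupport fun h => lt_irrefl _ (hs h).1
      simp [h1, h2]
    · rw [Ioo_eq_empty (fun h => hab h.le)]; simp
  have h1 : ∀ x, (c + prim μp μn a x) * deriv φ x =
      c * deriv φ x + (μp.real (Ioc a x) * deriv φ x - μn.real (Ioc a x) * deriv φ x) := by
    intro x; simp only [prim]; ring
  simp only [h1]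
  have h2 : IntegrableOn (fun x => μp.real (Ioc a x) * deriv φ x - μn.real (Ioc a x) * deriv φ x)
    (Ioo a b) := (hb μp).sub (hb μn)
  rw [integral_add (hdi.const_mul c) h2, integral_sub (hb μp) (hb μn),
    integral_measureReal_Ioc_mul_deriv μp hp hφ hs, integral_measureReal_Ioc_mul_deriv μn hn hφ hs,
    integral_const_mul, h0]
  ring

/-- The du Bois-Reymond lemma. -/
lemma ae_eq_const_of_integral_mul_deriv_eq_zero {a b : ℝ} (hab : a < b) {f : ℝ → ℝ}
    (hf : IntegrableOn f (Ioo a b))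
    (h : ∀ φ : ℝ → ℝ, ContDiff ℝ 1 φ → tsupport φ ⊆ Ioo a b →
      ∫ x in Ioo a b, f x * deriv φ x = 0) :
    ∃ c, ∀ᵐ x ∂(volume.restrict (Ioo a b)), f x = c := by
  obtain ⟨m, hm⟩ := exists_between hab
  obtain ⟨r, hr, hrs⟩ : ∃ r > 0, Metric.closedBall m r ⊆ Ioo a b :=
    Metric.nhds_basis_closedBall.mem_iff.1 (Ioo_mem_nhds hm.1 hm.2)
  let B : ContDiffBump m := ⟨r / 2, r, by positivity, by linarith⟩
  let η : ℝ → ℝ := B.normed volume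
  have hηs : tsupport η ⊆ Ioo a b := by
    have : tsupport η = Metric.closedBall m r := B.tsupport_normed_eq
    rw [this]; exact hrs
  have hηc : Continuous η := B.continuous_normed
  have hηK : HasCompactSupport η := B.hasCompactSupport_normed
  have hη1 : ∫ x, η x = 1 := B.integral_normed
  have hηi : Integrable η := hηc.integrable_of_hasCompactSupport hηK
  have hmul : ∀ g : ℝ → ℝ, Continuous g → IntegrableOn (fun x => f x * g x) (Ioo a b) := by
    intro g hg
    obtain ⟨C, hC⟩ := (isCompact_Icc (a := a) (b := b)).exists_bound_of_continuousOn hg.continuousOn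
    refine hf.mul_bdd (c := C) hg.aestronglyMeasurable ?_
    filter_upwards [ae_restrict_mem measurableSet_Ioo] with x hx
    exact hC x (Ioo_subset_Icc_self hx)
  set c := ∫ x in Ioo a b, f x * η x with hc
  refine ⟨c, ?_⟩
  have hfc : IntegrableOn (fun x => f x - c) (Ioo a b) := hf.sub (by simp)
  have key := isOpen_Ioo.ae_eq_zero_of_integral_contDiff_smul_eq_zero (μ := volume)
    (U := Ioo a b) (f := fun x => f x - c) hfc.locallyIntegrableOn ?_
  · rw [ae_restrict_iff' measurableSet_Ioo]
    filter_upwards [key] with x hx hxI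
    linarith [hx hxI]
  intro g hg hgK hgs
  have hgc : Continuous g := hg.continuous
  have hgi : Integrable g := hgc.integrable_of_hasCompactSupport hgK
  set k : ℝ → ℝ := fun x => g x - (∫ y, g y) * η x with hk
  have hkc : Continuous k := hgc.sub (continuous_const.mul hηc)
  have hki : Integrable k := hgi.sub (hηi.const_mul _)
  have hk0 : ∫ x, k x = 0 := by
    rw [hk, integral_sub hgi (hηi.const_mul _), integral_const_mul, hη1]; ring
  let φ : ℝ → ℝ := fun x => ∫ t in a..x, k t
  have hφd : ∀ x, HasDerivAt φ (k x) x := fun x => hkc.integral_hasStrictDerivAt a x |>.hasDerivAt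
  have hdφ : deriv φ = k := funext fun x => (hφd x).deriv
  have hφ1 : ContDiff ℝ 1 φ := by
    rw [contDiff_one_iff_deriv]
    exact ⟨fun x => (hφd x).differentiableAt, by rw [hdφ]; exact hkc⟩
  obtain ⟨α, β, hα, hβ, hK⟩ : ∃ α β, a < α ∧ β < b ∧ ∀ x, x ∉ Icc α β → k x = 0 := by
    set K := tsupport g ∪ tsupport η
    have hKc : IsCompact K := IsCompact.union hgK hηK
    have hKs : K ⊆ Ioo a b := union_subset hgs hηs
    have hKn : K.Nonempty := by
      refine ⟨m, Or.inr (subset_tsupport _ ?_)⟩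
      rw [ContDiffBump.support_normed_eq]
      exact Metric.mem_ball_self hr
    refine ⟨sInf K, sSup K, (hKs (hKc.sInf_mem hKn)).1, (hKs (hKc.sSup_mem hKn)).2, ?_⟩
    intro x hx
    have hxK : x ∉ K := fun h => hx ⟨csInf_le hKc.bddBelow h, le_csSup hKc.bddAbove h⟩
    have h1 : g x = 0 := image_eq_zero_of_notMem_tsupport fun h => hxK (Or.inl h)
    have h2 : η x = 0 := image_eq_zero_of_notMem_tsupport fun h => hxK (Or.inr h)
    simp [hk, h1, h2]
  have hφs : tsupport φ ⊆ Ioo a b := by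
    have : tsupport φ ⊆ Icc α β := by
      refine closure_minimal ?_ isClosed_Icc
      intro x hx
      by_contra hxI
      apply hx
      rcases not_and_or.1 hxI with h1 | h1
      · push Not at h1
        refine intervalIntegral.integral_zero_ae (ae_of_all _ fun t ht => hK t fun htI => ?_)
        have : t ≤ max a x := ht.2
        exact absurd (this.trans_lt (max_lt hα h1)) (not_lt.2 htI.1)
      · push Not at h1
        have h2 : ∫ t in a..x, k t = ∫ t, k t := by
          refine intervalIntegral.integral_eq_integral_of_support_subset fun t ht => ?_
          have : t ∈ Icc α β := by
            by_contra h3; exact ht (hK t h3)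
          exact ⟨hα.trans_le this.1, this.2.trans h1.le⟩
        change ∫ t in a..x, k t = 0
        rw [h2, hk0]
    exact this.trans (Icc_subset_Ioo hα hβ)
  have h0 := h φ hφ1 hφs
  rw [hdφ] at h0
  have h1 : ∀ x, f x * k x = f x * g x - (∫ y, g y) * (f x * η x) := by
    intro x; simp only [hk]; ring
  simp only [h1] at h0
  rw [integral_sub (hmul g hgc) ((hmul η hηc).const_mul _), integral_const_mul, ← hc] at h0
  have hout : ∀ x, x ∉ Ioo a b → g x • (f x - c) = 0 := by
    intro x hx
    rw [image_eq_zero_of_notMem_tsupport fun h => hx (hgs h)]; simp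
  rw [← setIntegral_eq_integral_of_forall_compl_eq_zero hout]
  have hgI : ∫ y, g y = ∫ y in Ioo a b, g y :=
    (setIntegral_eq_integral_of_forall_compl_eq_zero fun x hx =>
      image_eq_zero_of_notMem_tsupport fun h => hx (hgs h)).symm
  have h2 : ∀ x, g x • (f x - c) = f x * g x - c * g x := by
    intro x; simp only [smul_eq_mul]; ring
  simp only [h2]
  rw [integral_sub (hmul g hgc) (hgi.integrableOn.const_mul _), integral_const_mul, ← hgI]
  linarith

/-- `f = c + prim μp μn a` almost everywhere in `]a,b[`. -/
def IsPrim (a b : ℝ) (f : ℝ → ℝ) (μp μn : Measure ℝ) (c : ℝ) : Prop :=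
  ∀ᵐ x ∂(volume.restrict (Ioo a b)), f x = c + prim μp μn a x

lemma IsDerivMeasures.exists_isPrim {a b : ℝ} (hab : a < b) {f : ℝ → ℝ} {μp μn : Measure ℝ}
    (h : IsDerivMeasures a b f μp μn) : ∃ c, IsPrim a b f μp μn c := by
  obtain ⟨hf, hfp, hfn, -, hp, hn, hφ⟩ := h
  obtain ⟨c, hc⟩ := ae_eq_const_of_integral_mul_deriv_eq_zero hab
    (f := fun x => f x - prim μp μn a x) (hf.sub (prim_integrableOn μp μn a a b)) (by
      intro φ h1 h2
      have h3 := integral_prim_mul_deriv μp μn hp hn 0 h1 h2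
      have h4 := hφ φ h1 h2
      have hcd : Continuous (deriv φ) := h1.continuous_deriv le_rfl
      obtain ⟨C, hC⟩ :=
        (isCompact_Icc (a := a) (b := b)).exists_bound_of_continuousOn hcd.continuousOn
      have hmul : ∀ g : ℝ → ℝ, IntegrableOn g (Ioo a b) →
          IntegrableOn (fun x => g x * deriv φ x) (Ioo a b) := by
        intro g hg
        refine hg.mul_bdd (c := C) hcd.aestronglyMeasurable ?_
        filter_upwards [ae_restrict_mem measurableSet_Ioo] with x hx
        exact hC x (Ioo_subset_Icc_self hx)
      simp only [sub_mul, zero_add] at h3 ⊢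
      rw [integral_sub (hmul _ hf) (hmul _ (prim_integrableOn μp μn a a b)), h3, h4, sub_self])
  exact ⟨c, by filter_upwards [hc] with x hx; linarith⟩

lemma IsPrim.isDerivMeasures {a b c : ℝ} {f : ℝ → ℝ} {μp μn : Measure ℝ} [IsFiniteMeasure μp]
    [IsFiniteMeasure μn] (h : IsPrim a b f μp μn c) (hs : μp ⟂ₘ μn) (hp : μp (Ioo a b)ᶜ = 0)
    (hn : μn (Ioo a b)ᶜ = 0) : IsDerivMeasures a b f μp μn := by
  refine ⟨?_, inferInstance, inferInstance, hs, hp, hn, fun φ h1 h2 => ?_⟩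
  · refine IntegrableOn.congr_fun_ae ?_ (EventuallyEq.symm h)
    exact Integrable.add (by simp) (prim_integrableOn μp μn a a b)
  · rw [← integral_prim_mul_deriv μp μn hp hn c h1 h2]
    refine integral_congr_ae ?_
    filter_upwards [h] with x hx
    rw [hx]

lemma edist_eq_ofReal_abs (x y : ℝ) : edist x y = ENNReal.ofReal |y - x| := by
  rw [edist_dist, dist_comm, Real.dist_eq]

lemma eVariationOn_le_of_abs_sub_le {f G : ℝ → ℝ} {s : Set ℝ} {C : ℝ}
    (h : ∀ x ∈ s, ∀ y ∈ s, x ≤ y → |f y - f x| ≤ G y - G x)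
    (hG : ∀ x ∈ s, ∀ y ∈ s, x ≤ y → G y - G x ≤ C) :
    eVariationOn f s ≤ ENNReal.ofReal C := by
  refine iSup_le fun p => ?_
  obtain ⟨n, t, ht, hts⟩ := p
  simp only
  have key : ∀ i, edist (f (t (i + 1))) (f (t i)) ≤ ENNReal.ofReal (G (t (i + 1)) - G (t i)) := by
    intro i
    rw [edist_comm, edist_eq_ofReal_abs]
    exact ENNReal.ofReal_le_ofReal (h _ (hts i) _ (hts (i + 1)) (ht (Nat.le_succ i)))
  refine (Finset.sum_le_sum fun i _ => key i).trans ?_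
  rw [← ENNReal.ofReal_sum_of_nonneg]
  · rw [Finset.sum_range_sub (fun i => G (t i))]
    exact ENNReal.ofReal_le_ofReal (hG _ (hts 0) _ (hts n) (ht (Nat.zero_le n)))
  · intro i _
    exact (abs_nonneg _).trans (h _ (hts i) _ (hts (i + 1)) (ht (Nat.le_succ i)))

lemma exists_monotone_of_eVariationOn {f : ℝ → ℝ} {s : Set ℝ} (hs : eVariationOn f s ≠ ⊤) :
    ∃ T : ℝ → ℝ, Monotone T ∧ (∀ x, 0 ≤ T x) ∧ (∀ x, T x ≤ (eVariationOn f s).toReal) ∧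
      ∀ x ∈ s, ∀ y ∈ s, x ≤ y → |f y - f x| ≤ T y - T x := by
  have hfin : ∀ x, eVariationOn f (s ∩ Iic x) ≠ ⊤ := fun x =>
    ((eVariationOn.mono f inter_subset_left).trans_lt hs.lt_top).ne
  refine ⟨fun x => (eVariationOn f (s ∩ Iic x)).toReal, ?_, fun x => ENNReal.toReal_nonneg, ?_, ?_⟩
  · intro x y hxy
    exact ENNReal.toReal_mono (hfin y)
      (eVariationOn.mono f (inter_subset_inter_right _ (Iic_subset_Iic.2 hxy)))
  · intro x
    exact ENNReal.toReal_mono hs (eVariationOn.mono f inter_subset_left)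
  · intro x hx y hy hxy
    have h1 : eVariationOn f (s ∩ Iic x) + eVariationOn f (s ∩ Icc x y) ≤
        eVariationOn f (s ∩ Iic y) := by
      refine (eVariationOn.add_le_union f ?_).trans (eVariationOn.mono f ?_)
      · intro z hz w hw; exact hz.2.trans hw.2.1
      · rintro z (hz | hz)
        · exact ⟨hz.1, hz.2.trans hxy⟩
        · exact ⟨hz.1, hz.2.2⟩
    have h2 : edist (f x) (f y) ≤ eVariationOn f (s ∩ Icc x y) :=
      eVariationOn.edist_le f ⟨hx, le_rfl, hxy⟩ ⟨hy, hxy, le_rfl⟩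
    rw [edist_eq_ofReal_abs] at h2
    have h3 := (add_le_add_right h2 (eVariationOn f (s ∩ Iic x))).trans h1
    have h4 := ENNReal.toReal_mono (hfin y) h3
    rw [ENNReal.toReal_add (hfin x) ENNReal.ofReal_ne_top, ENNReal.toReal_ofReal (abs_nonneg _)]
      at h4
    linarith

/-- Two finite measures can be made mutually singular without changing their difference. -/
lemma exists_mutuallySingular_prim_eq (μ ν : Measure ℝ) [IsFiniteMeasure μ] [IsFiniteMeasure ν] :
    ∃ μp μn : Measure ℝ, IsFiniteMeasure μp ∧ IsFiniteMeasure μn ∧ μp ⟂ₘ μn ∧ μp ≤ μ ∧ μn ≤ ν ∧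
      ∀ a x, prim μp μn a x = prim μ ν a x := by
  refine ⟨μ - ν, ν - μ, inferInstance, inferInstance, Measure.mutually_singular_measure_sub,
    Measure.sub_le, Measure.sub_le, fun a x => ?_⟩
  have h := Measure.sub_toSignedMeasure_eq_toSignedMeasure_sub (μ := μ) (ν := ν)
  have h2 := congrArg (fun S : SignedMeasure ℝ => S (Ioc a x)) h
  simp only [sub_apply, Measure.toSignedMeasure_apply, measurableSet_Ioc, if_true]
    at h2
  simp only [prim]
  linarith

lemma Monotone.stieltjesFunction_eq_self {T : ℝ → ℝ} (hT : Monotone T) {x : ℝ}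
    (hx : ContinuousAt T x) : hT.stieltjesFunction x = T x := by
  rw [Monotone.stieltjesFunction_eq]
  exact hT.continuousWithinAt_Ioi_iff_rightLim_eq.1 hx.continuousWithinAt

lemma ae_continuousAt_of_monotone {T : ℝ → ℝ} (hT : Monotone T) :
    ∀ᵐ x, ContinuousAt T x := by
  rw [ae_iff]
  exact hT.countable_not_continuousAt.measure_zero _

/-- A function of bounded variation on a set of full measure is in `BV(]a,b[)`. -/
lemma exists_isDerivMeasures_of_eVariationOn {a b : ℝ} {f : ℝ → ℝ} {s : Set ℝ}
    (hs : ∀ᵐ x ∂(volume.restrict (Ioo a b)), x ∈ s) (hV : eVariationOn f s ≠ ⊤) :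
    ∃ μp μn : Measure ℝ, IsDerivMeasures a b f μp μn := by
  obtain ⟨T, hT, hT0, hTV, hTf⟩ := exists_monotone_of_eVariationOn hV
  set V := (eVariationOn f s).toReal with hVd
  have hmono : MonotoneOn (fun x => T x - f x) s := by
    intro x hx y hy hxy
    have := (le_abs_self _).trans (hTf x hx y hy hxy)
    simp only; linarith
  have hbd : ∀ x ∈ s, ∀ y ∈ s, |f y - f x| ≤ V := by
    intro x hx y hy
    have := eVariationOn.edist_le f hx hy
    rw [edist_eq_ofReal_abs] at this
    have h2 := ENNReal.toReal_mono hV this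
    rwa [ENNReal.toReal_ofReal (abs_nonneg _)] at h2
  obtain ⟨g, hg, hgeq⟩ : ∃ g : ℝ → ℝ, Monotone g ∧ EqOn (fun x => T x - f x) g s := by
    rcases s.eq_empty_or_nonempty with rfl | ⟨x0, hx0⟩
    · exact ⟨id, monotone_id, by simp⟩
    refine hmono.exists_monotone_extension ⟨- f x0 - V, ?_⟩ ⟨2 * V - f x0, ?_⟩
    · rintro _ ⟨x, hx, rfl⟩
      have h1 := abs_le.1 (hbd x0 hx0 x hx)
      have h2 := hT0 x
      simp only; linarith
    · rintro _ ⟨x, hx, rfl⟩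
      have h1 := abs_le.1 (hbd x0 hx0 x hx)
      have h2 := hTV x
      simp only; linarith
  set μ := hT.stieltjesFunction.measure.restrict (Ioo a b) with hμ
  set ν := hg.stieltjesFunction.measure.restrict (Ioo a b) with hν
  have hfin : ∀ S : StieltjesFunction ℝ, IsFiniteMeasure (S.measure.restrict (Ioo a b)) := by
    intro S
    refine isFiniteMeasure_restrict.2 ?_
    exact ((measure_mono Ioo_subset_Ioc_self).trans_lt
      (by rw [StieltjesFunction.measure_Ioc]; exact ENNReal.ofReal_lt_top)).ne
  have := hfin hT.stieltjesFunction
  have := hfin hg.stieltjesFunction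
  have hreal : ∀ S : StieltjesFunction ℝ, ∀ x ∈ Ioo a b,
      (S.measure.restrict (Ioo a b)).real (Ioc a x) = S x - S a := by
    intro S x hx
    rw [measureReal_restrict_apply measurableSet_Ioc,
      inter_eq_left.2 (show Ioc a x ⊆ Ioo a b from fun z hz => ⟨hz.1, hz.2.trans_lt hx.2⟩),
      Measure.real,
      StieltjesFunction.measure_Ioc, ENNReal.toReal_ofReal (sub_nonneg.2 (S.mono hx.1.le))]
  have hprim : IsPrim a b f μ ν
      (hT.stieltjesFunction a - hg.stieltjesFunction a) := by
    filter_upwards [hs, ae_restrict_of_ae (ae_continuousAt_of_monotone hT),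
      ae_restrict_of_ae (ae_continuousAt_of_monotone hg),
      ae_restrict_mem measurableSet_Ioo] with x hx h1 h2 hxI
    have h3 := hgeq hx
    simp only at h3
    rw [prim, hreal _ x hxI, hreal _ x hxI, hT.stieltjesFunction_eq_self h1,
      hg.stieltjesFunction_eq_self h2]
    linarith
  obtain ⟨μp, μn, i1, i2, hsing, hle1, hle2, hpe⟩ := exists_mutuallySingular_prim_eq μ ν
  refine ⟨μp, μn, IsPrim.isDerivMeasures (c := hT.stieltjesFunction a - hg.stieltjesFunction a)
    ?_ hsing ?_ ?_⟩
  · filter_upwards [hprim] with x hx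
    rw [hx, hpe]
  · refine le_antisymm ((hle1 _).trans ?_) zero_le
    rw [hμ, Measure.restrict_apply measurableSet_Ioo.compl]; simp
  · refine le_antisymm ((hle2 _).trans ?_) zero_le
    rw [hν, Measure.restrict_apply measurableSet_Ioo.compl]; simp

lemma tendsto_measureReal_Ioc_nhdsGT (μ : Measure ℝ) [IsFiniteMeasure μ] (y : ℝ) :
    Tendsto (fun x => μ.real (Ioc y x)) (𝓝[>] y) (𝓝 0) := by
  have h := tendsto_measure_biInter_gt (μ := μ) (s := fun x => Ioc y x) (a := y)
    (fun r _ => measurableSet_Ioc.nullMeasurableSet)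
    (fun i j _ hij => Ioc_subset_Ioc_right hij) ⟨y + 1, by simp, measure_ne_top _ _⟩
  have h0 : (⋂ r > y, Ioc y r) = ∅ := by
    rw [eq_empty_iff_forall_notMem]
    intro z hz
    simp only [mem_iInter] at hz
    have h1 := (hz (y + 1) (by simp)).1
    obtain ⟨w, hw1, hw2⟩ := exists_between h1
    exact absurd (hz w hw1).2 (not_le.2 hw2)
  rw [h0, measure_empty] at h
  exact (ENNReal.tendsto_toReal ENNReal.zero_ne_top).comp h

lemma tendsto_measureReal_Ioo_nhdsLT (μ : Measure ℝ) [IsFiniteMeasure μ] (y : ℝ) :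
    Tendsto (fun x => μ.real (Ioo x y)) (𝓝[<] y) (𝓝 0) := by
  have hlt : OrderDual.toDual (y - 1) > OrderDual.toDual y :=
    OrderDual.toDual_lt_toDual.2 (by linarith)
  have h := tendsto_measure_biInter_gt (μ := μ) (ι := ℝᵒᵈ)
    (s := fun x => Ioo (OrderDual.ofDual x) y) (a := OrderDual.toDual y)
    (fun r _ => measurableSet_Ioo.nullMeasurableSet)
    (fun i j _ hij => Ioo_subset_Ioo_left hij)
    ⟨OrderDual.toDual (y - 1), hlt, measure_ne_top _ _⟩
  have h0 : (⋂ r > OrderDual.toDual y, Ioo (OrderDual.ofDual r) y) = ∅ := by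
    rw [eq_empty_iff_forall_notMem]
    intro z hz
    simp only [mem_iInter] at hz
    have h1 := (hz _ hlt).2
    exact lt_irrefl _ (hz (OrderDual.toDual z) (OrderDual.toDual_lt_toDual.2 h1)).1
  rw [h0, measure_empty] at h
  have h2 := (ENNReal.tendsto_toReal ENNReal.zero_ne_top).comp h
  simp only [ENNReal.toReal_zero] at h2
  exact h2

/-- The left limit of `prim μp μn a`. -/
def primL (μp μn : Measure ℝ) (a x : ℝ) : ℝ := μp.real (Ioo a x) - μn.real (Ioo a x)

lemma measureReal_Ioc_eq_Ioo_add (μ : Measure ℝ) [IsFiniteMeasure μ] {x y : ℝ} (h : x < y) :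
    μ.real (Ioc x y) = μ.real (Ioo x y) + μ.real {y} := by
  rw [← Ioo_union_right h, measureReal_union (by simp) (measurableSet_singleton y)]

lemma prim_eq_primL_add (μp μn : Measure ℝ) [IsFiniteMeasure μp] [IsFiniteMeasure μn] {a x : ℝ}
    (h : a < x) : prim μp μn a x = primL μp μn a x + (μp.real {x} - μn.real {x}) := by
  rw [prim, primL, measureReal_Ioc_eq_Ioo_add μp h, measureReal_Ioc_eq_Ioo_add μn h]; ring

lemma primL_sub_prim (μp μn : Measure ℝ) [IsFiniteMeasure μp] [IsFiniteMeasure μn] {a x y : ℝ}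
    (h : a ≤ x) (hxy : x < y) :
    primL μp μn a y - prim μp μn a x = μp.real (Ioo x y) - μn.real (Ioo x y) := by
  have h1 := prim_sub μp μn h hxy.le
  rw [prim_eq_primL_add μp μn (h.trans_lt hxy), measureReal_Ioc_eq_Ioo_add μp hxy,
    measureReal_Ioc_eq_Ioo_add μn hxy] at h1
  linarith

lemma tendsto_prim_nhdsGT (μp μn : Measure ℝ) [IsFiniteMeasure μp] [IsFiniteMeasure μn]
    {a y : ℝ} (h : a ≤ y) : Tendsto (prim μp μn a) (𝓝[>] y) (𝓝 (prim μp μn a y)) := by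
  have h1 := ((tendsto_measureReal_Ioc_nhdsGT μp y).sub
    (tendsto_measureReal_Ioc_nhdsGT μn y)).const_add (prim μp μn a y)
  simp only [sub_zero, add_zero] at h1
  refine h1.congr' ?_
  filter_upwards [self_mem_nhdsWithin] with x hx
  rw [← prim_sub μp μn h (le_of_lt hx)]; ring

lemma tendsto_prim_nhdsLT (μp μn : Measure ℝ) [IsFiniteMeasure μp] [IsFiniteMeasure μn]
    {a y : ℝ} (h : a < y) : Tendsto (prim μp μn a) (𝓝[<] y) (𝓝 (primL μp μn a y)) := by
  have h1 := ((tendsto_measureReal_Ioo_nhdsLT μp y).sub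
    (tendsto_measureReal_Ioo_nhdsLT μn y)).const_sub (primL μp μn a y)
  simp only [sub_zero] at h1
  refine h1.congr' ?_
  filter_upwards [Ioo_mem_nhdsLT h] with x hx
  rw [← primL_sub_prim μp μn hx.1.le hx.2]; ring

lemma measure_le_stieltjes {μ : Measure ℝ} {S : StieltjesFunction ℝ}
    (h : ∀ x y, μ (Ioc x y) ≤ ENNReal.ofReal (S y - S x)) : μ ≤ S.measure := by
  refine Measure.toOuterMeasure_le.1 ?_
  have : S.measure.toOuterMeasure = S.outer := by
    ext s
    simp [StieltjesFunction.measure_def]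
  rw [this, StieltjesFunction.outer, OuterMeasure.le_ofFunction]
  intro s
  rw [StieltjesFunction.length_eq]
  refine le_iInf fun x => le_iInf fun y => le_iInf fun hs => ?_
  refine (measure_mono ?_).trans (h x y)
  exact fun z hz => hs ⟨hz, notMem_botSet_of_lt (sub_one_lt z)⟩

lemma Measure.le_of_Ioc {μ ν : Measure ℝ} [IsFiniteMeasure ν]
    (h : ∀ x y, x < y → μ (Ioc x y) ≤ ν (Ioc x y)) : μ ≤ ν := by
  have hm : Monotone fun x => ν.real (Iic x) := fun x y hxy =>
    measureReal_mono (Iic_subset_Iic.2 hxy)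
  have hsub : ∀ x y, x ≤ y → ν.real (Iic y) - ν.real (Iic x) = ν.real (Ioc x y) := by
    intro x y hxy
    rw [← Iic_union_Ioc_eq_Iic hxy, measureReal_union (Iic_disjoint_Ioc le_rfl)
      measurableSet_Ioc]
    ring
  let S : StieltjesFunction ℝ :=
    { toFun := fun x => ν.real (Iic x)
      mono' := hm
      right_continuous' := fun x => by
        rw [← continuousWithinAt_Ioi_iff_Ici]
        have h1 := (tendsto_measureReal_Ioc_nhdsGT ν x).const_add (ν.real (Iic x))
        rw [add_zero] at h1
        refine h1.congr' ?_
        filter_upwards [self_mem_nhdsWithin] with y hy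
        rw [← hsub x y (le_of_lt hy)]; ring }
  have hS : ∀ x y, x < y → ENNReal.ofReal (S y - S x) = ν (Ioc x y) := by
    intro x y hxy
    have : S y - S x = ν.real (Ioc x y) := hsub x y hxy.le
    rw [this, ofReal_measureReal]
  have h1 : μ ≤ S.measure := by
    refine measure_le_stieltjes fun x y => ?_
    rcases lt_or_ge x y with hxy | hxy
    · rw [hS x y hxy]; exact h x y hxy
    · simp [Ioc_eq_empty (not_lt.2 hxy)]
  have h2 : ν = S.measure := by
    refine Measure.ext_of_Ioc _ _ fun x y hxy => ?_
    rw [StieltjesFunction.measure_Ioc, hS x y hxy]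
  rw [h2]; exact h1

lemma Measure.add_apply_le_of_le_add {μp μn τ : Measure ℝ} [IsFiniteMeasure τ] (hs : μp ⟂ₘ μn)
    (h1 : μp ≤ τ + μn) (h2 : μn ≤ τ + μp) (J : Set ℝ) :
    (μp + μn) J ≤ τ J := by
  obtain ⟨N, hN, hNp, hNn⟩ := hs
  have e1 : μp J ≤ τ (J ∩ Nᶜ) := by
    calc μp J ≤ μp (J ∩ N) + μp (J ∩ Nᶜ) := by
          rw [← sdiff_eq, measure_inter_add_sdiff J hN]
      _ = μp (J ∩ Nᶜ) := by rw [measure_mono_null inter_subset_right hNp, zero_add]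
      _ ≤ τ (J ∩ Nᶜ) + μn (J ∩ Nᶜ) := h1 _
      _ = τ (J ∩ Nᶜ) := by rw [measure_mono_null inter_subset_right hNn, add_zero]
  have e2 : μn J ≤ τ (J ∩ N) := by
    calc μn J ≤ μn (J ∩ N) + μn (J ∩ Nᶜ) := by
          rw [← sdiff_eq, measure_inter_add_sdiff J hN]
      _ = μn (J ∩ N) := by rw [measure_mono_null inter_subset_right hNn, add_zero]
      _ ≤ τ (J ∩ N) + μp (J ∩ N) := h2 _
      _ = τ (J ∩ N) := by rw [measure_mono_null inter_subset_right hNp, add_zero]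
  calc (μp + μn) J = μp J + μn J := rfl
    _ ≤ τ (J ∩ Nᶜ) + τ (J ∩ N) := add_le_add e1 e2
    _ = τ J := by rw [add_comm, ← sdiff_eq, measure_inter_add_sdiff J hN]

lemma exists_Ioo_mapsTo {v : ℝ → ℝ} {s t x y : ℝ} (hst : s ≤ t) (hv : ContinuousOn v (Icc s t))
    (hsx : v s ≤ x) (hxy : x < y) (hyt : y ≤ v t) :
    ∃ t₁ ∈ Icc s t, ∃ t₂ ∈ Icc s t, t₁ ≤ t₂ ∧ v t₁ = x ∧ v t₂ = y ∧
      MapsTo v (Ioo t₁ t₂) (Ioo x y) := by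
  have hK : IsCompact (Icc s t ∩ v ⁻¹' Ici y) :=
    isCompact_Icc.of_isClosed_subset (hv.preimage_isClosed_of_isClosed isClosed_Icc isClosed_Ici)
      inter_subset_left
  obtain ⟨t₂, ⟨ht₂, hv₂⟩, hmin⟩ := hK.exists_isLeast ⟨t, ⟨hst, le_rfl⟩, hyt⟩
  have hv' : ContinuousOn v (Icc s t₂) := hv.mono (Icc_subset_Icc_right ht₂.2)
  have hK' : IsCompact (Icc s t₂ ∩ v ⁻¹' Iic x) :=
    isCompact_Icc.of_isClosed_subset (hv'.preimage_isClosed_of_isClosed isClosed_Icc isClosed_Iic)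
      inter_subset_left
  obtain ⟨t₁, ⟨ht₁, hv₁⟩, hmax⟩ := hK'.exists_isGreatest ⟨s, ⟨le_rfl, ht₂.1⟩, hsx⟩
  simp only [mem_preimage, mem_Ici, mem_Iic] at hv₁ hv₂
  have hcont : ContinuousOn v (Icc t₁ t₂) := hv'.mono (Icc_subset_Icc_left ht₁.1)
  have e1 : v t₁ = x := by
    obtain ⟨z, hz, hzx⟩ := intermediate_value_Icc ht₁.2 hcont ⟨hv₁, hxy.le.trans hv₂⟩
    have : z ≤ t₁ := hmax ⟨⟨ht₁.1.trans hz.1, hz.2⟩, hzx.le⟩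
    rw [← hzx, le_antisymm this hz.1]
  have e2 : v t₂ = y := by
    obtain ⟨z, hz, hzx⟩ := intermediate_value_Icc ht₁.2 hcont ⟨hv₁.trans hxy.le, hv₂⟩
    have : t₂ ≤ z := hmin ⟨⟨ht₁.1.trans hz.1, hz.2.trans ht₂.2⟩, hzx.ge⟩
    rw [← hzx, le_antisymm hz.2 this]
  refine ⟨t₁, ⟨ht₁.1, ht₁.2.trans ht₂.2⟩, t₂, ht₂, ht₁.2, e1, e2, fun z hz => ⟨?_, ?_⟩⟩
  · by_contra h
    exact absurd (hmax ⟨⟨ht₁.1.trans hz.1.le, hz.2.le⟩, not_lt.1 h⟩) (not_le.2 hz.1)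
  · by_contra h
    exact absurd (hmin ⟨⟨ht₁.1.trans hz.1.le, hz.2.le.trans ht₂.2⟩, not_lt.1 h⟩) (not_le.2 hz.2)

/-- One-sided area inequality for an absolutely continuous function `v` with derivative `w`. -/
lemma lintegral_Ioc_le_lintegral_comp {v w : ℝ → ℝ} {s t : ℝ} (hst : s ≤ t)
    (hw : IntegrableOn w (Icc s t)) (hvc : ContinuousOn v (Icc s t))
    (hv : ∀ x ∈ Icc s t, ∀ y ∈ Icc s t, v y - v x = ∫ z in x..y, w z)
    {g : ℝ → ℝ≥0∞} (hg : Measurable g) :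
    ∫⁻ r in Ioc (v s) (v t), g r ≤ ∫⁻ x in Icc s t, g (v x) * ‖w x‖ₑ := by
  set κ := (volume.restrict (Icc s t)).withDensity fun x => ‖w x‖ₑ with hκ
  have hκac : κ ≪ volume.restrict (Icc s t) := withDensity_absolutelyContinuous _ _
  have hvm : AEMeasurable v (volume.restrict (Icc s t)) := hvc.aemeasurable measurableSet_Icc
  have hκfin : IsFiniteMeasure κ := isFiniteMeasure_withDensity hw.2.ne
  have hle : volume.restrict (Ioc (v s) (v t)) ≤ κ.map v := by
    refine Measure.le_of_Ioc fun x y _ => ?_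
    rw [Measure.restrict_apply measurableSet_Ioc, Ioc_inter_Ioc,
      Measure.map_apply_of_aemeasurable (hvm.mono_ac hκac) measurableSet_Ioc]
    rcases lt_or_ge (max x (v s)) (min y (v t)) with h | h
    · obtain ⟨t₁, ht₁, t₂, ht₂, h12, e1, e2, hm⟩ :=
        exists_Ioo_mapsTo hst hvc (le_max_right _ _) h (min_le_right _ _)
      have hsub : Ioo t₁ t₂ ⊆ v ⁻¹' Ioc x y := fun z hz =>
        ⟨(le_max_left _ _).trans_lt (hm hz).1, (hm hz).2.le.trans (min_le_left _ _)⟩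
      refine le_trans ?_ (measure_mono hsub)
      rw [hκ, withDensity_apply _ measurableSet_Ioo, Measure.restrict_restrict measurableSet_Ioo,
        inter_eq_left.2 (show Ioo t₁ t₂ ⊆ Icc s t from
          fun z hz => ⟨ht₁.1.trans hz.1.le, hz.2.le.trans ht₂.2⟩), Real.volume_Ioc]
      have h3 := hv t₁ ht₁ t₂ ht₂
      rw [e1, e2, intervalIntegral.integral_of_le h12, integral_Ioc_eq_integral_Ioo] at h3
      rw [h3]
      refine (ENNReal.ofReal_le_ofReal (le_abs_self _)).trans ?_
      rw [← Real.norm_eq_abs, ofReal_norm]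
      exact enorm_integral_le_lintegral_enorm _
    · simp [Ioc_eq_empty (not_lt.2 h)]
  calc ∫⁻ r in Ioc (v s) (v t), g r ≤ ∫⁻ r, g r ∂(κ.map v) := lintegral_mono' hle le_rfl
    _ = ∫⁻ x, g (v x) ∂κ := lintegral_map' hg.aemeasurable (hvm.mono_ac hκac)
    _ = ∫⁻ x in Icc s t, g (v x) * ‖w x‖ₑ := by
      refine (lintegral_withDensity_eq_lintegral_mul₀ hw.1.enorm
        (hg.comp_aemeasurable hvm)).trans (lintegral_congr fun x => ?_)
      rw [Pi.mul_apply, mul_comm]; rfl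

lemma W2pRep.continuousOn {p a b : ℝ} {u v w : ℝ → ℝ} (h : W2pRep p a b u v w) {s t : ℝ}
    (hs : s ∈ Ioo a b) (ht : t ∈ Ioo a b) : ContinuousOn v (Icc s t) := by
  rcases lt_or_ge t s with hts | hst
  · rw [Icc_eq_empty (not_le.2 hts)]; exact continuousOn_empty _
  have hw : IntegrableOn w (Icc s t) :=
    h.2.2.2.2.1.mono_set fun z hz => ⟨hs.1.trans_le hz.1, hz.2.trans_lt ht.2⟩
  have h1 := intervalIntegral.continuousOn_primitive_interval (a := s) (b := t) (μ := volume)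
    (f := w) (by rwa [uIcc_of_le hst])
  rw [uIcc_of_le hst] at h1
  refine (h1.const_add (v s)).congr fun x hx => ?_
  have := h.2.1 s hs x ⟨hs.1.trans_le hx.1, hx.2.trans_lt ht.2⟩
  simp only; linarith

lemma abs_Psi1_comp_sub_le {ψ : ℝ → ℝ} (hψ : PsiHyp ψ) {a b : ℝ} {u v w : ℝ → ℝ}
    (h : W2pRep 1 a b u v w) {s t : ℝ} (hs : s ∈ Ioo a b) (ht : t ∈ Ioo a b) (hst : s ≤ t) :
    ENNReal.ofReal |Psi1 ψ (v t) - Psi1 ψ (v s)| ≤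
      ∫⁻ x in Icc s t, ENNReal.ofReal (ψ (v x) * |w x|) := by
  have hsub : Icc s t ⊆ Ioo a b := fun z hz => ⟨hs.1.trans_le hz.1, hz.2.trans_lt ht.2⟩
  have hw : IntegrableOn w (Icc s t) := h.2.2.2.2.1.mono_set hsub
  have hvc := h.continuousOn hs ht
  have hv : ∀ x ∈ Icc s t, ∀ y ∈ Icc s t, v y - v x = ∫ z in x..y, w z := fun x hx y hy =>
    h.2.1 x (hsub hx) y (hsub hy)
  have hnn : ∀ r, 0 ≤ ψ r := fun r => (hψ.pos r).le
  have hR : ∀ x, ENNReal.ofReal (ψ (v x) * |w x|) = ENNReal.ofReal (ψ (v x)) * ‖w x‖ₑ := by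
    intro x
    rw [ENNReal.ofReal_mul (hnn _), ← Real.norm_eq_abs, ofReal_norm]
  simp_rw [hR]
  have hint : ∀ r₁ r₂, r₁ ≤ r₂ → ENNReal.ofReal (Psi1 ψ r₂ - Psi1 ψ r₁) =
      ∫⁻ r in Ioc r₁ r₂, ENNReal.ofReal (ψ r) := by
    intro r₁ r₂ h12
    rw [Psi1_sub_Psi1 hψ, intervalIntegral.integral_of_le h12,
      ofReal_integral_eq_lintegral_ofReal hψ.integrable.integrableOn (ae_of_all _ hnn)]
  rcases le_total (v s) (v t) with hle | hle
  · rw [abs_of_nonneg (sub_nonneg.2 ((Psi1_strictMono hψ).monotone hle)), hint _ _ hle]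
    exact lintegral_Ioc_le_lintegral_comp hst hw hvc hv hψ.measurable.ennreal_ofReal
  · rw [abs_of_nonpos (sub_nonpos.2 ((Psi1_strictMono hψ).monotone hle)), neg_sub, hint _ _ hle]
    have h1 := lintegral_Ioc_le_lintegral_comp (v := fun x => - v x) (w := fun x => - w x) hst hw.neg
      hvc.neg (fun x hx y hy => by
        rw [intervalIntegral.integral_neg, ← hv x hx y hy]; ring)
      (g := fun r => ENNReal.ofReal (ψ (-r))) (hψ.measurable.comp measurable_neg).ennreal_ofReal
    simp only [neg_neg, enorm_neg] at h1
    refine le_trans (le_of_eq ?_) h1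
    have h2 := (Measure.measurePreserving_neg (volume : Measure ℝ)).setLIntegral_comp_preimage
      (s := Ico (v t) (v s)) measurableSet_Ico hψ.measurable.ennreal_ofReal
    rw [setLIntegral_congr Ico_ae_eq_Ioc.symm, ← h2]
    simp

lemma setIntegral_Ioc_sub {f : ℝ → ℝ} {a b x y : ℝ} (hf : IntegrableOn f (Ioo a b))
    (hax : a ≤ x) (hxy : x ≤ y) (hyb : y < b) :
    (∫ z in Ioc a y, f z) - ∫ z in Ioc a x, f z = ∫ z in Ioc x y, f z := by
  have hi : IntegrableOn f (Ioc a y) := hf.mono_set fun z hz => ⟨hz.1, hz.2.trans_lt hyb⟩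
  rw [← Ioc_union_Ioc_eq_Ioc hax hxy, setIntegral_union (Ioc_disjoint_Ioc_of_le le_rfl)
    measurableSet_Ioc (hi.mono_set (Ioc_subset_Ioc_right hxy))
    (hi.mono_set (Ioc_subset_Ioc_left hax))]
  ring

lemma eVariationOn_le_of_abs_sub_le_integral {f g : ℝ → ℝ} {a b : ℝ}
    (hg : IntegrableOn g (Ioo a b)) (h0 : ∀ x, 0 ≤ g x)
    (h : ∀ x ∈ Ioo a b, ∀ y ∈ Ioo a b, x ≤ y → |f y - f x| ≤ ∫ z in Ioc x y, g z) :
    eVariationOn f (Ioo a b) ≤ ENNReal.ofReal (∫ x in Ioo a b, g x) := by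
  refine eVariationOn_le_of_abs_sub_le (G := fun x => ∫ z in Ioc a x, g z) ?_ ?_
  · intro x hx y hy hxy
    rw [setIntegral_Ioc_sub hg hx.1.le hxy hy.2]
    exact h x hx y hy hxy
  · intro x hx y hy hxy
    rw [setIntegral_Ioc_sub hg hx.1.le hxy hy.2]
    exact setIntegral_mono_set hg (ae_of_all _ h0)
      (LE.le.eventuallyLE (show Ioc x y ⊆ Ioo a b from
        fun z hz => ⟨hx.1.trans hz.1, hz.2.trans_lt hy.2⟩))

lemma PsiHyp.integrableOn_comp_mul {ψ : ℝ → ℝ} (hψ : PsiHyp ψ) {a b : ℝ} {v w : ℝ → ℝ}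
    (hv : AEStronglyMeasurable v (volume.restrict (Ioo a b))) (hw : IntegrableOn w (Ioo a b)) :
    IntegrableOn (fun x => ψ (v x) * |w x|) (Ioo a b) := by
  obtain ⟨C, hC⟩ := hψ.bounded
  refine hw.abs.bdd_mul (c := C) (hψ.measurable.comp_aemeasurable hv.aemeasurable).aestronglyMeasurable
    (ae_of_all _ fun x => ?_)
  rw [Real.norm_eq_abs, abs_of_pos (hψ.pos _)]
  exact hC _

lemma W2pRep.eVariationOn_add_le {ψ : ℝ → ℝ} (hψ : PsiHyp ψ) {a b : ℝ} {u v w : ℝ → ℝ}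
    (h : W2pRep 1 a b u v w) :
    eVariationOn u (Ioo a b) + eVariationOn (fun x => Psi1 ψ (v x)) (Ioo a b) ≤
      ENNReal.ofReal ((∫ x in Ioo a b, |v x|) + ∫ x in Ioo a b, ψ (v x) * |w x| ^ (1 : ℝ)) := by
  simp only [Real.rpow_one]
  have hv : IntegrableOn v (Ioo a b) := h.2.2.2.1
  have hw : IntegrableOn w (Ioo a b) := h.2.2.2.2.1
  have hnn : ∀ x, 0 ≤ ψ (v x) * |w x| := fun x => mul_nonneg (hψ.pos _).le (abs_nonneg _)
  have hg := hψ.integrableOn_comp_mul hv.1 hw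
  rw [ENNReal.ofReal_add (integral_nonneg fun x => abs_nonneg _) (integral_nonneg hnn)]
  refine add_le_add (eVariationOn_le_of_abs_sub_le_integral hv.abs (fun x => abs_nonneg _) ?_)
    (eVariationOn_le_of_abs_sub_le_integral hg hnn ?_)
  · intro x hx y hy hxy
    have hsub : Icc x y ⊆ Ioo a b := fun z hz => ⟨hx.1.trans_le hz.1, hz.2.trans_lt hy.2⟩
    have h1 := intervalIntegral.integral_eq_sub_of_hasDerivAt (f := u) (f' := v) (a := x) (b := y)
      (fun z hz => h.1 z (hsub (by rwa [uIcc_of_le hxy] at hz)))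
      ((intervalIntegrable_iff_integrableOn_Icc_of_le hxy).2 (hv.mono_set hsub))
    rw [← h1, intervalIntegral.integral_of_le hxy]
    exact abs_integral_le_integral_abs
  · intro x hx y hy hxy
    have hsub : Icc x y ⊆ Ioo a b := fun z hz => ⟨hx.1.trans_le hz.1, hz.2.trans_lt hy.2⟩
    have h1 := abs_Psi1_comp_sub_le hψ h hx hy hxy
    rw [← ofReal_integral_eq_lintegral_ofReal (hg.mono_set hsub) (ae_of_all _ hnn),
      integral_Icc_eq_integral_Ioc] at h1
    exact (ENNReal.ofReal_le_ofReal_iff (integral_nonneg hnn)).1 h1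

/-- Lower semicontinuity of the variation under a weak form of graph convergence. -/
lemma eventually_lt_eVariationOn {ι : Type*} {l : Filter ι} {f : ι → ℝ → ℝ} {e : ℝ → ℝ}
    {D I : Set ℝ} (h : ∀ p ∈ D, ∀ ε > 0, ∀ᶠ k in l, ∃ ξ ∈ I, |ξ - p| < ε ∧ |f k ξ - e p| < ε)
    {c : ℝ≥0∞} (hc : c < eVariationOn e D) : ∀ᶠ k in l, c < eVariationOn (f k) I := by
  rw [eVariationOn.eVariationOn_eq_strictMonoOn, lt_iSup_iff] at hc
  obtain ⟨⟨n, t, ht, htD⟩, hc⟩ := hc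
  simp only at hc
  have hsum : ∀ (g : ℕ → ℝ), ∑ i ∈ Finset.range n, edist (g (i + 1)) (g i) =
      ENNReal.ofReal (∑ i ∈ Finset.range n, |g (i + 1) - g i|) := by
    intro g
    rw [ENNReal.ofReal_sum_of_nonneg fun i _ => abs_nonneg _]
    exact Finset.sum_congr rfl fun i _ => by rw [edist_comm, edist_eq_ofReal_abs]
  rw [hsum fun i => e (t i)] at hc
  obtain ⟨c', hc', rfl⟩ : ∃ c' : ℝ, 0 ≤ c' ∧ ENNReal.ofReal c' = c :=
    ⟨c.toReal, ENNReal.toReal_nonneg, ENNReal.ofReal_toReal hc.ne_top⟩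
  rw [ENNReal.ofReal_lt_ofReal_iff_of_nonneg hc'] at hc
  obtain ⟨ε, hε, hgap, hεc⟩ : ∃ ε > 0, (∀ i ∈ Finset.range n, 2 * ε < t (i + 1) - t i) ∧
      c' + n * (2 * ε) < ∑ i ∈ Finset.range n, |e (t (i + 1)) - e (t i)| := by
    have h1 : ∀ᶠ ε in 𝓝[>] (0 : ℝ), ∀ i ∈ Finset.range n, 2 * ε < t (i + 1) - t i := by
      rw [Filter.eventually_all_finset]
      intro i hi
      have hi' := Finset.mem_range.1 hi
      have hpos : (0 : ℝ) < (t (i + 1) - t i) / 2 := by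
        have := ht (show i ∈ Iic n from hi'.le) (show i + 1 ∈ Iic n from hi') (Nat.lt_succ_self i)
        linarith
      filter_upwards [Ioo_mem_nhdsGT hpos] with ε hε
      have := hε.2
      linarith
    have h2 : ∀ᶠ ε in 𝓝[>] (0 : ℝ), c' + n * (2 * ε) <
        ∑ i ∈ Finset.range n, |e (t (i + 1)) - e (t i)| := by
      have h3 : Tendsto (fun ε : ℝ => c' + n * (2 * ε)) (𝓝[>] 0) (𝓝 (c' + n * (2 * 0))) :=
        (Continuous.tendsto (by fun_prop) 0).mono_left nhdsWithin_le_nhds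
      exact h3.eventually (gt_mem_nhds (by simpa using hc))
    obtain ⟨ε, h3, h4, h5⟩ := (h1.and (h2.and self_mem_nhdsWithin)).exists
    exact ⟨ε, h5, h3, h4⟩
  have hev : ∀ᶠ k in l, ∀ i ∈ Finset.range (n + 1),
      ∃ ξ ∈ I, |ξ - t i| < ε ∧ |f k ξ - e (t i)| < ε := by
    rw [Filter.eventually_all_finset]
    exact fun i hi => h _ (htD i (Nat.lt_succ_iff.1 (Finset.mem_range.1 hi))) ε hε
  filter_upwards [hev] with k hk
  choose! ξ hξI hξt hξe using hk
  have hmem : ∀ i ≤ n, i ∈ Finset.range (n + 1) := fun i hi => Finset.mem_range.2 (by omega)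
  have hstep : ∀ i < n, ξ i ≤ ξ (i + 1) := by
    intro i hi
    have h1 := abs_lt.1 (hξt i (hmem i hi.le))
    have h2 := abs_lt.1 (hξt (i + 1) (hmem _ hi))
    have h3 := hgap i (Finset.mem_range.2 hi)
    linarith
  have hmono : MonotoneOn ξ (Iic n) := by
    intro i hi j hj hij
    induction j, hij using Nat.le_induction with
    | base => exact le_rfl
    | succ j hij ih =>
      exact (ih (show j ∈ Iic n from (Nat.le_succ j).trans hj)).trans (hstep j hj)
  refine lt_of_lt_of_le ?_ (eVariationOn.sum_le_of_monotoneOn_Iic (f := f k) hmono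
    fun i hi => hξI i (hmem i hi))
  rw [hsum fun i => f k (ξ i), ENNReal.ofReal_lt_ofReal_iff_of_nonneg hc']
  have hle : ∀ i ∈ Finset.range n, |e (t (i + 1)) - e (t i)| ≤
      |f k (ξ (i + 1)) - f k (ξ i)| + 2 * ε := by
    intro i hi
    have hi' := Finset.mem_range.1 hi
    have h1 := abs_lt.1 (hξe i (hmem i hi'.le))
    have h2 := abs_lt.1 (hξe (i + 1) (hmem _ hi'))
    have h3 := abs_le.1 (le_refl |f k (ξ (i + 1)) - f k (ξ i)|)
    rw [abs_le]
    constructor <;> linarith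
  have h1 := Finset.sum_le_sum hle
  rw [Finset.sum_add_distrib, Finset.sum_const, Finset.card_range, nsmul_eq_mul] at h1
  linarith

lemma ENNReal.add_le_of_forall_lt {x y z : ℝ≥0∞} (h : ∀ c < x, ∀ d < y, c + d ≤ z)
    (hx : x ≠ 0 → y = 0 → x ≤ z) (hy : y ≠ 0 → x = 0 → y ≤ z) : x + y ≤ z := by
  rcases eq_or_ne x 0 with rfl | hx0
  · rcases eq_or_ne y 0 with rfl | hy0
    · simp
    · simpa using hy hy0 rfl
  rcases eq_or_ne y 0 with rfl | hy0
  · simpa using hx hx0 rfl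
  have h1 : ∀ c < x, c + y ≤ z := by
    intro c hc
    have hcz : c ≤ z := by simpa using h c hc 0 (pos_iff_ne_zero.2 hy0)
    refine add_le_of_le_tsub_left_of_le hcz (le_of_forall_lt_imp_le_of_dense fun d hd => ?_)
    exact ENNReal.le_sub_of_add_le_left hc.ne_top (h c hc d hd)
  have hyz : y ≤ z := by simpa using h1 0 (pos_iff_ne_zero.2 hx0)
  rcases eq_or_ne y ⊤ with rfl | hyt
  · rw [top_le_iff.1 hyz]; exact le_top
  · refine add_le_of_le_tsub_right_of_le hyz (le_of_forall_lt_imp_le_of_dense fun c hc => ?_)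
    exact ENNReal.le_sub_of_add_le_right hyt (h1 c hc)

lemma eVariationOn_add_le_of_frequently {ι : Type*} {l : Filter ι} [l.NeBot] {f z : ι → ℝ → ℝ}
    {u e : ℝ → ℝ} {G D I : Set ℝ} {B : ℝ≥0∞}
    (hf : ∀ p ∈ G, ∀ ε > 0, ∀ᶠ k in l, ∃ ξ ∈ I, |ξ - p| < ε ∧ |f k ξ - u p| < ε)
    (hz : ∀ p ∈ D, ∀ ε > 0, ∀ᶠ k in l, ∃ ξ ∈ I, |ξ - p| < ε ∧ |z k ξ - e p| < ε)
    (hB : ∀ᶠ k in l, eVariationOn (f k) I + eVariationOn (z k) I ≤ B) :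
    eVariationOn u G + eVariationOn e D ≤ B := by
  refine ENNReal.add_le_of_forall_lt (fun c hc d hd => ?_) (fun _ h0 => ?_) (fun _ h0 => ?_)
  · obtain ⟨k, h1, h2, h3⟩ := ((eventually_lt_eVariationOn hf hc).and
      ((eventually_lt_eVariationOn hz hd).and hB)).exists
    exact (add_le_add h1.le h2.le).trans h3
  · refine le_of_forall_lt_imp_le_of_dense fun c hc => ?_
    obtain ⟨k, h1, h3⟩ := ((eventually_lt_eVariationOn hf hc).and hB).exists
    exact h1.le.trans (le_self_add.trans h3)
  · refine le_of_forall_lt_imp_le_of_dense fun c hc => ?_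
    obtain ⟨k, h1, h3⟩ := ((eventually_lt_eVariationOn hz hc).and hB).exists
    exact h1.le.trans (le_add_self.trans h3)

lemma TendstoL1.exists_seq_tendsto_ae {a b : ℝ} {U : ℕ → ℝ → ℝ} {u : ℝ → ℝ}
    (h : TendstoL1 a b U u) : ∃ ns : ℕ → ℕ, StrictMono ns ∧
      ∀ᵐ x ∂(volume.restrict (Ioo a b)), Tendsto (fun i => U (ns i) x) atTop (𝓝 (u x)) := by
  obtain ⟨hU, hu, hlim⟩ := h
  refine TendstoInMeasure.exists_seq_tendsto_ae (tendstoInMeasure_of_tendsto_eLpNorm one_ne_zero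
    (fun n => (hU n).1) hu.1 ?_)
  have h1 : ∀ n, eLpNorm (U n - u) 1 (volume.restrict (Ioo a b)) =
      ENNReal.ofReal (∫ x in Ioo a b, |U n x - u x|) := by
    intro n
    rw [eLpNorm_one_eq_lintegral_enorm, ← ofReal_integral_norm_eq_lintegral_enorm
      ((hU n).sub hu)]
    simp [Real.norm_eq_abs]
  simp_rw [h1]
  simpa using ENNReal.tendsto_ofReal hlim

lemma exists_W2pRep_of_Fp_lt {ψ : ℝ → ℝ} {p a b : ℝ} {u : ℝ → ℝ} {B : ℝ≥0∞}
    (h : Fp ψ p a b u < B) : ∃ v w, W2pRep p a b u v w ∧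
      ENNReal.ofReal ((∫ x in Ioo a b, |v x|) + ∫ x in Ioo a b, ψ (v x) * |w x| ^ p) < B := by
  simp only [Fp, iInf_lt_iff] at h
  obtain ⟨v, w, hr, hlt⟩ := h
  exact ⟨v, w, hr, hlt⟩

/-- The fundamental lower bound for the relaxed functional. -/
lemma exists_ae_eVariationOn_add_le {ψ : ℝ → ℝ} (hψ : PsiHyp ψ) {a b : ℝ} {u : ℝ → ℝ} {B : ℝ≥0∞}
    (h : FpRel ψ 1 a b u < B) :
    ∃ G ⊆ Ioo a b, (∀ᵐ x ∂(volume.restrict (Ioo a b)), x ∈ G) ∧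
      ∀ (D : Set ℝ) (e : ℝ → ℝ), (∀ p ∈ D, ∀ ε > 0, ∃ α ∈ G, ∃ β ∈ G, α < β ∧ |α - p| < ε ∧
        |β - p| < ε ∧ |Psi1 ψ ((u β - u α) / (β - α)) - e p| < ε) →
      eVariationOn u G + eVariationOn e D ≤ B := by
  simp only [FpRel, iInf_lt_iff] at h
  obtain ⟨U, hU, hlt⟩ := h
  obtain ⟨φ, hφ, hφB⟩ := extraction_of_frequently_atTop (frequently_lt_of_liminf_lt (by isBoundedDefault) hlt)
  have hU' : TendstoL1 a b (fun n => U (φ n)) u :=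
    ⟨fun k => hU.1 _, hU.2.1, hU.2.2.comp hφ.tendsto_atTop⟩
  obtain ⟨ns, hns, hae⟩ := hU'.exists_seq_tendsto_ae
  choose v w hr hB using fun n => exists_W2pRep_of_Fp_lt (hφB (ns n))
  refine ⟨{x | x ∈ Ioo a b ∧ Tendsto (fun i => U (φ (ns i)) x) atTop (𝓝 (u x))},
    fun x hx => hx.1, ?_, fun D e hD => ?_⟩
  · filter_upwards [hae, ae_restrict_mem measurableSet_Ioo] with x h1 h2 using ⟨h2, h1⟩
  · refine eVariationOn_add_le_of_frequently (l := atTop) (f := fun i => U (φ (ns i)))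
      (z := fun i x => Psi1 ψ (v i x)) (I := Ioo a b) (fun p hp ε hε => ?_) (fun p hp ε hε => ?_)
      (Eventually.of_forall fun n => ((hr n).eVariationOn_add_le hψ).trans (hB n).le)
    · have := (hp.2.sub_const (u p)).abs
      rw [sub_self, abs_zero] at this
      filter_upwards [this.eventually (gt_mem_nhds hε)] with k hk
      exact ⟨p, hp.1, by simpa using hε, hk⟩
    · obtain ⟨α, hα, β, hβ, hαβ, hαp, hβp, hs⟩ := hD p hp ε hε
      have h1 : Tendsto (fun i => |Psi1 ψ ((U (φ (ns i)) β - U (φ (ns i)) α) / (β - α)) - e p|)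
          atTop (𝓝 |Psi1 ψ ((u β - u α) / (β - α)) - e p|) :=
        ((((Psi1_continuous hψ).tendsto _).comp ((hβ.2.sub hα.2).div_const _)).sub_const _).abs
      filter_upwards [h1.eventually (gt_mem_nhds hs)] with k hk
      have hsub : Icc α β ⊆ Ioo a b := fun z hz => ⟨hα.1.1.trans_le hz.1, hz.2.trans_lt hβ.1.2⟩
      obtain ⟨ξ, hξ, hξe⟩ := exists_hasDerivAt_eq_slope (U (φ (ns k))) (v k) hαβ
        (fun z hz => ((hr k).1 z (hsub hz)).continuousAt.continuousWithinAt)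
        (fun z hz => (hr k).1 z (hsub (Ioo_subset_Icc_self hz)))
      refine ⟨ξ, hsub (Ioo_subset_Icc_self hξ), ?_, ?_⟩
      · rw [abs_lt] at hαp hβp ⊢
        constructor <;> linarith [hξ.1, hξ.2]
      · rw [hξe]; exact hk

/-- The mean slope of `μp - μn` over the ball `[x - r, x + r]`. -/
def symmSlope (μp μn : Measure ℝ) (x r : ℝ) : ℝ :=
  (μp.real (Metric.closedBall x r) - μn.real (Metric.closedBall x r)) / (2 * r)

lemma ae_tendsto_symmSlope (μp μn : Measure ℝ) [IsFiniteMeasure μp] [IsFiniteMeasure μn] :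
    ∀ᵐ x, Tendsto (symmSlope μp μn x) (𝓝[>] 0) (𝓝 (uaD μp μn x)) := by
  filter_upwards [Besicovitch.ae_tendsto_rnDeriv μp volume,
    Besicovitch.ae_tendsto_rnDeriv μn volume, Measure.rnDeriv_lt_top μp volume,
    Measure.rnDeriv_lt_top μn volume] with x hp hn hp' hn'
  have h1 := ((ENNReal.tendsto_toReal hp'.ne).comp hp).sub ((ENNReal.tendsto_toReal hn'.ne).comp hn)
  refine h1.congr' ?_
  filter_upwards [self_mem_nhdsWithin] with r hr
  have hr' : (0 : ℝ) ≤ 2 * r := by have := mem_Ioi.1 hr; linarith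
  simp only [Function.comp, ENNReal.toReal_div, Real.volume_closedBall, symmSlope, sub_div,
    ENNReal.toReal_ofReal hr', Measure.real]

lemma ae_singularPart_tendsto_symmSlope_atTop (μp μn : Measure ℝ) [IsFiniteMeasure μp]
    [IsFiniteMeasure μn] (hs : μp ⟂ₘ μn) :
    ∀ᵐ x ∂(μp.singularPart volume), Tendsto (symmSlope μp μn x) (𝓝[>] 0) atTop := by
  have hle : μp.singularPart volume ≪ μp := (Measure.singularPart_le _ _).absolutelyContinuous
  have hvol : ∀ᵐ x ∂(μp.singularPart volume), (volume : Measure ℝ).rnDeriv μp x = 0 := by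
    obtain ⟨N, hN, hN1, hN2⟩ := Measure.mutuallySingular_singularPart μp (volume : Measure ℝ)
    have h1 : ∫⁻ x in Nᶜ, (volume : Measure ℝ).rnDeriv μp x ∂μp = 0 :=
      le_antisymm ((Measure.setLIntegral_rnDeriv_le _).trans hN2.le) zero_le
    rw [lintegral_eq_zero_iff (Measure.measurable_rnDeriv _ _)] at h1
    have h2 := (ae_restrict_iff' hN.compl).1 h1
    filter_upwards [hle.ae_le h2, (measure_eq_zero_iff_ae_notMem.1 hN1 : ∀ᵐ x ∂_, x ∉ N)]
      with x hx hxN using hx hxN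
  have hn0 : ∀ᵐ x ∂μp, μn.rnDeriv μp x = 0 := hs.symm.rnDeriv_ae_eq_zero
  filter_upwards [hvol, hle.ae_le hn0, hle.ae_le (Besicovitch.ae_tendsto_rnDeriv volume μp),
    hle.ae_le (Besicovitch.ae_tendsto_rnDeriv μn μp)] with x h1 h2 h3 h4
  rw [h1] at h3
  rw [h2] at h4
  have h3' := (ENNReal.tendsto_toReal ENNReal.zero_ne_top).comp h3
  have h4' := (ENNReal.tendsto_toReal ENNReal.zero_ne_top).comp h4
  simp only [ENNReal.toReal_zero] at h3' h4'
  have hpos : ∀ᶠ r in 𝓝[>] (0 : ℝ), 0 < r ∧ 0 < μp.real (Metric.closedBall x r) := by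
    filter_upwards [self_mem_nhdsWithin, h3.eventually (gt_mem_nhds ENNReal.zero_lt_top)] with r hr hlt
    refine ⟨hr, ENNReal.toReal_pos (fun h0 => ?_) (measure_ne_top _ _)⟩
    rw [h0, ENNReal.div_zero (by
      rw [Real.volume_closedBall]; simpa using hr)] at hlt
    exact lt_irrefl _ hlt
  have h5 : Tendsto (fun r => ((volume.real (Metric.closedBall x r)) /
      μp.real (Metric.closedBall x r))⁻¹) (𝓝[>] 0) atTop := by
    refine Tendsto.inv_tendsto_nhdsGT_zero ?_
    refine tendsto_nhdsWithin_iff.2 ⟨h3'.congr fun r => by simp [ENNReal.toReal_div, Measure.real], ?_⟩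
    filter_upwards [hpos] with r hr
    refine div_pos ?_ hr.2
    rw [Measure.real, Real.volume_closedBall, ENNReal.toReal_ofReal] <;> linarith [hr.1]
  have h6 : Tendsto (fun r => 1 - μn.real (Metric.closedBall x r) /
      μp.real (Metric.closedBall x r)) (𝓝[>] 0) (𝓝 (1 - 0)) :=
    (h4'.congr fun r => by simp [ENNReal.toReal_div, Measure.real]).const_sub 1
  refine (h5.atTop_mul_pos (by norm_num) h6).congr' ?_
  filter_upwards [hpos] with r hr
  have hv : volume.real (Metric.closedBall x r) = 2 * r := by
    rw [Measure.real, Real.volume_closedBall, ENNReal.toReal_ofReal]; linarith [hr.1]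
  rw [hv, symmSlope]
  have := hr.1.ne'
  have := hr.2.ne'
  field_simp

lemma ae_singularPart_tendsto_symmSlope_atBot (μp μn : Measure ℝ) [IsFiniteMeasure μp]
    [IsFiniteMeasure μn] (hs : μp ⟂ₘ μn) :
    ∀ᵐ x ∂(μn.singularPart volume), Tendsto (symmSlope μp μn x) (𝓝[>] 0) atBot := by
  filter_upwards [ae_singularPart_tendsto_symmSlope_atTop μn μp hs.symm] with x hx
  refine (tendsto_neg_atTop_atBot.comp hx).congr fun r => ?_
  simp only [Function.comp, symmSlope]; ring

/-- Difference quotients of a primitive at points of a set of full measure see the symmetric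
slopes. -/
lemma exists_slope_close {a b c : ℝ} {u : ℝ → ℝ} {μp μn : Measure ℝ} [IsFiniteMeasure μp]
    [IsFiniteMeasure μn] (hu : IsPrim a b u μp μn c) {G : Set ℝ}
    (hG : ∀ᵐ x ∂(volume.restrict (Ioo a b)), x ∈ G) {g : ℝ → ℝ} {x m : ℝ} (hx : x ∈ Ioo a b)
    (h : Tendsto (fun r => g (symmSlope μp μn x r)) (𝓝[>] 0) (𝓝 m)) {ε : ℝ} (hε : 0 < ε) :
    ∃ α ∈ G, ∃ β ∈ G, α < β ∧ |α - x| < ε ∧ |β - x| < ε ∧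
      |g ((u β - u α) / (β - α)) - m| < ε := by
  have hgood : ∀ᵐ y, y ∈ Ioo a b → y ∈ G ∧ u y = c + prim μp μn a y :=
    (ae_restrict_iff' measurableSet_Ioo).1 (hG.and hu)
  have hat : ∀ᵐ y, μp {y} = 0 ∧ μn {y} = 0 := by
    have h1 := (Measure.countable_meas_pos_of_disjoint_iUnion (μ := μp)
      (As := fun y : ℝ => {y}) (fun y => measurableSet_singleton y)
      (fun i j hij => by simpa using hij)).measure_zero volume
    have h2 := (Measure.countable_meas_pos_of_disjoint_iUnion (μ := μn)
      (As := fun y : ℝ => {y}) (fun y => measurableSet_singleton y)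
      (fun i j hij => by simpa using hij)).measure_zero volume
    filter_upwards [measure_eq_zero_iff_ae_notMem.1 h1, measure_eq_zero_iff_ae_notMem.1 h2] with y h3 h4
    simpa [pos_iff_ne_zero] using And.intro h3 h4
  have hP := hgood.and hat
  have hp1 : ∀ᵐ r, (x + r ∈ Ioo a b → x + r ∈ G ∧ u (x + r) = c + prim μp μn a (x + r)) ∧
      μp {x + r} = 0 ∧ μn {x + r} = 0 :=
    (measurePreserving_add_left volume x).quasiMeasurePreserving.ae hP
  have hp2 : ∀ᵐ r, (x - r ∈ Ioo a b → x - r ∈ G ∧ u (x - r) = c + prim μp μn a (x - r)) ∧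
      μp {x - r} = 0 ∧ μn {x - r} = 0 :=
    (Measure.measurePreserving_sub_left volume x).quasiMeasurePreserving.ae hP
  have hclose : ∀ᶠ r in 𝓝[>] (0 : ℝ), |g (symmSlope μp μn x r) - m| < ε := by
    have := (h.sub_const m).abs
    rw [sub_self, abs_zero] at this
    exact this.eventually (gt_mem_nhds hε)
  have hsmall : ∀ᶠ r in 𝓝[>] (0 : ℝ), r ∈ Ioo 0 (min ε (min (x - a) (b - x))) :=
    Ioo_mem_nhdsGT (lt_min hε (lt_min (by linarith [hx.1]) (by linarith [hx.2])))
  obtain ⟨r, hr1, hr2, hrc, hrs⟩ : ∃ r : ℝ, _ ∧ _ ∧ _ ∧ _ := by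
    have hmem := hclose.and hsmall
    obtain ⟨δ, hδ, hδs⟩ := mem_nhdsGT_iff_exists_Ioo_subset.1 hmem
    have hne : volume (Ioo 0 δ) ≠ 0 := by
      rw [Real.volume_Ioo]; simpa using hδ
    have hae := ae_restrict_of_ae (s := Ioo 0 δ) (hp1.and hp2)
    have : (ae (volume.restrict (Ioo 0 δ))).NeBot := by
      rw [ae_neBot]; simpa [Measure.restrict_eq_zero] using hne
    obtain ⟨r, ⟨h1, h2⟩, h3⟩ := (hae.and (ae_restrict_mem measurableSet_Ioo)).exists
    exact ⟨r, h1, h2, (hδs h3).1, (hδs h3).2⟩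
  have hr0 : 0 < r := hrs.1
  have hrε : r < ε := hrs.2.trans_le (min_le_left _ _)
  have hra : r < x - a := hrs.2.trans_le ((min_le_right _ _).trans (min_le_left _ _))
  have hrb : r < b - x := hrs.2.trans_le ((min_le_right _ _).trans (min_le_right _ _))
  have hβI : x + r ∈ Ioo a b := ⟨by linarith, by linarith⟩
  have hαI : x - r ∈ Ioo a b := ⟨by linarith, by linarith⟩
  refine ⟨x - r, (hr2.1 hαI).1, x + r, (hr1.1 hβI).1, by linarith, ?_, ?_, ?_⟩
  · rw [abs_lt]; constructor <;> linarith
  · rw [abs_lt]; constructor <;> linarith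
  · have hball : ∀ μ : Measure ℝ, IsFiniteMeasure μ → μ {x - r} = 0 →
        μ.real (Metric.closedBall x r) = μ.real (Ioc (x - r) (x + r)) := by
      intro μ _ h0
      rw [Real.closedBall_eq_Icc, ← Ioc_union_left (by linarith : x - r ≤ x + r),
        measureReal_union (by simp) (measurableSet_singleton _), measureReal_def μ {x - r}, h0]
      simp
    have : (u (x + r) - u (x - r)) / (x + r - (x - r)) = symmSlope μp μn x r := by
      rw [(hr2.1 hαI).2, (hr1.1 hβI).2, symmSlope, hball μp inferInstance hr2.2.1,
        hball μn inferInstance hr2.2.2, ← prim_sub μp μn hαI.1.le (by linarith)]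
      congr 1 <;> ring
    rw [this]; exact hrc

/-- `f` has essential limit `t` at `y` along `D`. -/
def EssLim (f : ℝ → ℝ) (D : Set ℝ) (y : ℝ) (t : EReal) : Prop :=
  (∀ s : ℝ, (s : EReal) < t → ∃ δ > 0, ∀ᵐ x, x ∈ Ioo (y - δ) (y + δ) ∩ D → s ≤ f x) ∧
  (∀ s : ℝ, t < (s : EReal) → ∃ δ > 0, ∀ᵐ x, x ∈ Ioo (y - δ) (y + δ) ∩ D → f x ≤ s)

lemma EssLim.tendsto_average {f : ℝ → ℝ} {D : Set ℝ} {y : ℝ} {t : EReal} (h : EssLim f D y t)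
    {l r : ℝ → ℝ} (hlr : ∀ ε > 0, l ε < r ε)
    (hs : ∀ ε > 0, Ioo (l ε) (r ε) ⊆ Ioo (y - ε) (y + ε) ∩ D)
    (hf : ∀ᶠ ε in 𝓝[>] (0 : ℝ), IntegrableOn f (Ioo (l ε) (r ε))) :
    Tendsto (fun ε => (((∫ x in Ioo (l ε) (r ε), f x) / (r ε - l ε) : ℝ) : EReal))
      (𝓝[>] 0) (𝓝 t) := by
  have key : ∀ ε > 0, IntegrableOn f (Ioo (l ε) (r ε)) → ∀ P : ℝ → Prop,
      (∃ δ > 0, ε < δ ∧ ∀ᵐ x, x ∈ Ioo (y - δ) (y + δ) ∩ D → P x) →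
      ∀ᵐ x ∂(volume.restrict (Ioo (l ε) (r ε))), P x := by
    rintro ε hε hi P ⟨δ, hδ, hεδ, hP⟩
    refine (ae_restrict_iff' measurableSet_Ioo).2 ?_
    filter_upwards [hP] with x hx hxm
    have := hs ε hε hxm
    exact hx ⟨⟨by linarith [this.1.1], by linarith [this.1.2]⟩, this.2⟩
  have hvol : ∀ ε > 0, volume.real (Ioo (l ε) (r ε)) = r ε - l ε := fun ε hε => by
    rw [Measure.real, Real.volume_Ioo, ENNReal.toReal_ofReal (by linarith [hlr ε hε])]
  have hconst : ∀ ε > 0, ∀ s : ℝ, ∫ _ in Ioo (l ε) (r ε), s = s * (r ε - l ε) := fun ε hε s => by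
    rw [setIntegral_const, hvol ε hε, smul_eq_mul, mul_comm]
  have hci : ∀ ε, ∀ s : ℝ, IntegrableOn (fun _ => s) (Ioo (l ε) (r ε)) := fun ε s =>
    integrableOn_const (by rw [Real.volume_Ioo]; exact ENNReal.ofReal_ne_top)
  refine tendsto_order.2 ⟨fun t' ht' => ?_, fun t' ht' => ?_⟩
  · obtain ⟨s, hs1, hs2⟩ := EReal.lt_iff_exists_real_btwn.1 ht'
    obtain ⟨δ, hδ, hP⟩ := h.1 s hs2
    filter_upwards [hf, Ioo_mem_nhdsGT hδ] with ε hi hε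
    refine hs1.trans_le (EReal.coe_le_coe_iff.2 ?_)
    rw [le_div_iff₀ (by linarith [hlr ε hε.1]), ← hconst ε hε.1 s]
    exact setIntegral_mono_ae_restrict (hci ε s) hi (key ε hε.1 hi _ ⟨δ, hδ, hε.2, hP⟩)
  · obtain ⟨s, hs1, hs2⟩ := EReal.lt_iff_exists_real_btwn.1 ht'
    obtain ⟨δ, hδ, hP⟩ := h.2 s hs1
    filter_upwards [hf, Ioo_mem_nhdsGT hδ] with ε hi hε
    refine lt_of_le_of_lt (EReal.coe_le_coe_iff.2 ?_) hs2
    rw [div_le_iff₀ (by linarith [hlr ε hε.1]), ← hconst ε hε.1 s]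
    exact setIntegral_mono_ae_restrict hi (hci ε s) (key ε hε.1 hi _ ⟨δ, hδ, hε.2, hP⟩)

lemma essLim_of_strictMono {a b y : ℝ} (hy : y ∈ Ioo a b) {f g : ℝ → ℝ} {D : Set ℝ} {t : EReal}
    {h : EReal → EReal} (hh : StrictMono h)
    (hfg : ∀ᵐ x ∂(volume.restrict (Ioo a b)), h (f x) = g x)
    (hg : Tendsto (fun x => (g x : EReal)) (𝓝[D] y) (𝓝 (h t))) : EssLim f D y t := by
  have hfg' := (ae_restrict_iff' measurableSet_Ioo).1 hfg
  have key : ∀ P : ℝ → Prop, (∀ᶠ x in 𝓝[D] y, P x) →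
      ∃ δ > 0, ∀ x ∈ Ioo (y - δ) (y + δ) ∩ D, x ∈ Ioo a b ∧ P x := by
    intro P hP
    have h2 : ∀ᶠ x in 𝓝[D] y, x ∈ Ioo a b ∧ P x :=
      (eventually_nhdsWithin_of_eventually_nhds (isOpen_Ioo.mem_nhds hy)).and hP
    obtain ⟨δ, hδ, hδP⟩ := Metric.mem_nhdsWithin_iff.1 h2
    refine ⟨δ, hδ, fun x hx => hδP ⟨?_, hx.2⟩⟩
    rw [Real.ball_eq_Ioo]; exact hx.1
  constructor
  · intro s hs
    obtain ⟨δ, hδ, hP⟩ := key _ (hg.eventually (lt_mem_nhds (hh hs)))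
    refine ⟨δ, hδ, ?_⟩
    filter_upwards [hfg'] with x hx hxD
    have := hP x hxD
    rw [← hx this.1] at this
    exact (EReal.coe_lt_coe_iff.1 (hh.lt_iff_lt.1 this.2)).le
  · intro s hs
    obtain ⟨δ, hδ, hP⟩ := key _ (hg.eventually (gt_mem_nhds (hh hs)))
    refine ⟨δ, hδ, ?_⟩
    filter_upwards [hfg'] with x hx hxD
    have := hP x hxD
    rw [← hx this.1] at this
    exact (EReal.coe_lt_coe_iff.1 (hh.lt_iff_lt.1 this.2)).le

lemma eventually_integrableOn_of_subset {a b y : ℝ} (hy : y ∈ Ioo a b) {f : ℝ → ℝ}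
    (hf : IntegrableOn f (Ioo a b)) {l r : ℝ → ℝ}
    (hs : ∀ ε > 0, Ioo (l ε) (r ε) ⊆ Ioo (y - ε) (y + ε)) :
    ∀ᶠ ε in 𝓝[>] (0 : ℝ), IntegrableOn f (Ioo (l ε) (r ε)) := by
  filter_upwards [Ioo_mem_nhdsGT (lt_min (sub_pos.2 hy.1) (sub_pos.2 hy.2))] with ε hε
  refine hf.mono_set ((hs ε hε.1).trans fun x hx => ?_)
  have h1 := hε.2.trans_le (min_le_left _ _)
  have h2 := hε.2.trans_le (min_le_right _ _)
  exact ⟨by linarith [hx.1], by linarith [hx.2]⟩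

lemma EssLim.tendsto_left {a b y : ℝ} (hy : y ∈ Ioo a b) {f : ℝ → ℝ}
    (hf : IntegrableOn f (Ioo a b)) {t : EReal} (h : EssLim f (Iio y) y t) :
    Tendsto (fun ε => (((∫ x in Ioo (y - ε) y, f x) / ε : ℝ) : EReal)) (𝓝[>] 0) (𝓝 t) := by
  have hs : ∀ ε > 0, Ioo (y - ε) y ⊆ Ioo (y - ε) (y + ε) ∩ Iio y := fun ε hε x hx =>
    ⟨⟨hx.1, by linarith [hx.2]⟩, hx.2⟩
  have := h.tendsto_average (l := fun ε => y - ε) (r := fun _ => y)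
    (fun ε hε => by linarith) hs
    (eventually_integrableOn_of_subset hy hf fun ε hε => (hs ε hε).trans inter_subset_left)
  simpa using this

lemma EssLim.tendsto_right {a b y : ℝ} (hy : y ∈ Ioo a b) {f : ℝ → ℝ}
    (hf : IntegrableOn f (Ioo a b)) {t : EReal} (h : EssLim f (Ioi y) y t) :
    Tendsto (fun ε => (((∫ x in Ioo y (y + ε), f x) / ε : ℝ) : EReal)) (𝓝[>] 0) (𝓝 t) := by
  have hs : ∀ ε > 0, Ioo y (y + ε) ⊆ Ioo (y - ε) (y + ε) ∩ Ioi y := fun ε hε x hx =>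
    ⟨⟨by linarith [hx.1], hx.2⟩, hx.1⟩
  have := h.tendsto_average (l := fun _ => y) (r := fun ε => y + ε)
    (fun ε hε => by linarith) hs
    (eventually_integrableOn_of_subset hy hf fun ε hε => (hs ε hε).trans inter_subset_left)
  simpa using this

lemma EssLim.tendsto_symm {a b y : ℝ} (hy : y ∈ Ioo a b) {f : ℝ → ℝ}
    (hf : IntegrableOn f (Ioo a b)) {t : EReal} (h : EssLim f univ y t) :
    Tendsto (fun ε => (((∫ x in Ioo (y - ε) (y + ε), f x) / (2 * ε) : ℝ) : EReal))
      (𝓝[>] 0) (𝓝 t) := by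
  have := h.tendsto_average (l := fun ε => y - ε) (r := fun ε => y + ε)
    (fun ε hε => by linarith) (fun ε hε => by simp)
    (eventually_integrableOn_of_subset hy hf fun ε hε => subset_rfl)
  refine this.congr fun ε => ?_
  rw [show y + ε - (y - ε) = 2 * ε by ring]

lemma EssLim.mem_ZPlus {a b y : ℝ} (hy : y ∈ Ioo a b) {f : ℝ → ℝ}
    (hf : IntegrableOn f (Ioo a b)) (h : EssLim f univ y ⊤) : y ∈ ZPlus a b f := by
  refine ⟨hy, ?_⟩
  exact EReal.tendsto_coe_nhds_top_iff.1 (h.tendsto_symm hy hf)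

lemma EssLim.mem_ZMinus {a b y : ℝ} (hy : y ∈ Ioo a b) {f : ℝ → ℝ}
    (hf : IntegrableOn f (Ioo a b)) (h : EssLim f univ y ⊥) : y ∈ ZMinus a b f := by
  refine ⟨hy, ?_⟩
  exact EReal.tendsto_coe_nhds_bot_iff.1 (h.tendsto_symm hy hf)

lemma MeasureTheory.Measure.MutuallySingular.measureReal_singleton {μp μn : Measure ℝ}
    (hs : μp ⟂ₘ μn) (y : ℝ) :
    μp.real {y} = 0 ∨ μn.real {y} = 0 := by
  obtain ⟨N, hN, h1, h2⟩ := hs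
  by_cases hy : y ∈ N
  · left; simp [Measure.real, measure_mono_null (singleton_subset_iff.2 hy) h1]
  · right; simp [Measure.real, measure_mono_null (singleton_subset_iff.2 (show y ∈ Nᶜ from hy)) h2]

section Jump

variable {a b c y : ℝ} {u : ℝ → ℝ} {μp μn : Measure ℝ} [IsFiniteMeasure μp] [IsFiniteMeasure μn]

lemma leftApproxLim_eq (hy : y ∈ Ioo a b) (hf : IntegrableOn u (Ioo a b))
    (hu : IsPrim a b u μp μn c) : leftApproxLim u y = c + primL μp μn a y := by
  have h1 : EssLim u (Iio y) y ((c + primL μp μn a y : ℝ) : EReal) :=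
    essLim_of_strictMono hy (h := id) strictMono_id (g := fun x => c + prim μp μn a x)
      (hu.mono fun x hx => by simp [hx])
      (EReal.tendsto_coe.2 ((tendsto_prim_nhdsLT μp μn hy.1).const_add c))
  exact (EReal.tendsto_coe.1 (h1.tendsto_left hy hf)).limUnder_eq

lemma rightApproxLim_eq (hy : y ∈ Ioo a b) (hf : IntegrableOn u (Ioo a b))
    (hu : IsPrim a b u μp μn c) : rightApproxLim u y = c + prim μp μn a y := by
  have h1 : EssLim u (Ioi y) y ((c + prim μp μn a y : ℝ) : EReal) :=
    essLim_of_strictMono hy (h := id) strictMono_id (g := fun x => c + prim μp μn a x)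
      (hu.mono fun x hx => by simp [hx])
      (EReal.tendsto_coe.2 ((tendsto_prim_nhdsGT μp μn hy.1.le).const_add c))
  exact (EReal.tendsto_coe.1 (h1.tendsto_right hy hf)).limUnder_eq

lemma rightApproxLim_sub_leftApproxLim (hy : y ∈ Ioo a b) (hf : IntegrableOn u (Ioo a b))
    (hu : IsPrim a b u μp μn c) :
    rightApproxLim u y - leftApproxLim u y = μp.real {y} - μn.real {y} := by
  rw [leftApproxLim_eq hy hf hu, rightApproxLim_eq hy hf hu, prim_eq_primL_add μp μn hy.1]
  ring

lemma mem_jumpSet_iff (hf : IntegrableOn u (Ioo a b)) (hu : IsPrim a b u μp μn c)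
    (hs : μp ⟂ₘ μn) : y ∈ jumpSet a b u ↔ y ∈ Ioo a b ∧ (0 < μp.real {y} ∨ 0 < μn.real {y}) := by
  refine and_congr_right fun hy => ?_
  have h1 := rightApproxLim_sub_leftApproxLim hy hf hu
  rw [ne_comm, ← sub_ne_zero, h1]
  have hp : 0 ≤ μp.real {y} := measureReal_nonneg
  have hn : 0 ≤ μn.real {y} := measureReal_nonneg
  rcases hs.measureReal_singleton y with h | h
  · simp [h, hn.lt_iff_ne']
  · simp [h, hp.lt_iff_ne']

lemma jumpSign_pos_iff (hy : y ∈ Ioo a b) (hf : IntegrableOn u (Ioo a b))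
    (hu : IsPrim a b u μp μn c) (hs : μp ⟂ₘ μn) : 0 < jumpSign u y ↔ 0 < μp.real {y} := by
  rw [jumpSign, rightApproxLim_sub_leftApproxLim hy hf hu]
  have hp : 0 ≤ μp.real {y} := measureReal_nonneg
  have hn : 0 ≤ μn.real {y} := measureReal_nonneg
  rcases hs.measureReal_singleton y with h | h
  · rw [h]
    refine iff_of_false ?_ (lt_irrefl _)
    rcases hn.eq_or_lt with h0 | h0
    · rw [← h0]; simp
    · rw [Real.sign_of_neg (by linarith)]; norm_num
  · rw [h, sub_zero]
    rcases hp.eq_or_lt with h0 | h0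
    · rw [← h0]; simp
    · rw [Real.sign_of_pos h0]; simp [h0]

lemma countable_atoms (μ : Measure ℝ) [IsFiniteMeasure μ] : {y : ℝ | 0 < μ.real {y}}.Countable := by
  refine (Measure.countable_meas_pos_of_disjoint_iUnion (μ := μ)
      (As := fun y : ℝ => {y}) (fun y => measurableSet_singleton y)
      (fun i j hij => by simpa using hij)).mono fun y hy => ?_
  exact (ENNReal.toReal_pos_iff.1 hy).1

lemma countable_jumpSet (hf : IntegrableOn u (Ioo a b)) (hu : IsPrim a b u μp μn c)
    (hs : μp ⟂ₘ μn) : (jumpSet a b u).Countable := by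
  refine ((countable_atoms μp).union (countable_atoms μn)).mono fun y hy => ?_
  exact ((mem_jumpSet_iff hf hu hs).1 hy).2

lemma uaD_integrable (μp μn : Measure ℝ) [IsFiniteMeasure μp] [IsFiniteMeasure μn] :
    Integrable (uaD μp μn) :=
  Measure.integrable_toReal_rnDeriv.sub Measure.integrable_toReal_rnDeriv

end Jump

lemma essLim_of_tendsto_prim {a b c y : ℝ} {ψ w : ℝ → ℝ} {νp νn : Measure ℝ} (hψ : PsiHyp ψ) (hy : y ∈ Ioo a b)
    (hw : IsPrim a b (fun x => Psi1 ψ (w x)) νp νn c) {D : Set ℝ} {L : ℝ}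
    (h : Tendsto (prim νp νn a) (𝓝[D] y) (𝓝 L)) {t : EReal} (ht : Psi1E ψ t = c + L) :
    EssLim w D y t := by
  refine essLim_of_strictMono hy (h := fun t => (Psi1E ψ t : EReal))
    (EReal.coe_strictMono.comp (Psi1E_strictMono hψ)) (g := fun x => c + prim νp νn a x)
    (hw.mono fun x hx => by simp [← hx]) ?_
  simp only [ht]
  exact EReal.tendsto_coe.2 (h.const_add c)

lemma mem_Icc_of_tendsto_prim {a b c y : ℝ} {ψ w : ℝ → ℝ} {νp νn : Measure ℝ} (hψ : PsiHyp ψ) (hy : y ∈ Ioo a b)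
    (hw : IsPrim a b (fun x => Psi1 ψ (w x)) νp νn c) {D : Set ℝ} {L : ℝ}
    (hI : ∀ s ∈ 𝓝[D] y, ∃ p q, p < q ∧ Ioo p q ⊆ s)
    (h : Tendsto (prim νp νn a) (𝓝[D] y) (𝓝 L)) : c + L ∈ Icc 0 (∫ s, ψ s) := by
  by_contra hL
  have h1 := (h.const_add c).eventually (isClosed_Icc.isOpen_compl.mem_nhds hL)
  have h2 : Ioo a b ∈ 𝓝[D] y := nhdsWithin_le_nhds (isOpen_Ioo.mem_nhds hy)
  obtain ⟨p, q, hpq, hs⟩ := hI _ (inter_mem h1 h2)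
  have h3 := (ae_restrict_iff' measurableSet_Ioo).1 hw
  have : (ae (volume.restrict (Ioo p q))).NeBot := by
    rw [ae_neBot, Ne, Measure.restrict_eq_zero, Real.volume_Ioo]; simpa using hpq
  obtain ⟨x, hx, hxm⟩ := ((ae_restrict_of_ae (s := Ioo p q) h3).and
    (ae_restrict_mem measurableSet_Ioo)).exists
  have h4 := hs hxm
  refine h4.1 ?_
  show c + prim νp νn a x ∈ Icc 0 (∫ s, ψ s)
  rw [← hx h4.2]
  exact Psi1_nonneg_le hψ _

section Slope

variable {a b c y : ℝ} {ψ w : ℝ → ℝ} {νp νn : Measure ℝ} [IsFiniteMeasure νp] [IsFiniteMeasure νn]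

lemma exists_Psi1E_eq_left (hψ : PsiHyp ψ) (hy : y ∈ Ioo a b)
    (hw : IsPrim a b (fun x => Psi1 ψ (w x)) νp νn c) :
    ∃ t, Psi1E ψ t = c + primL νp νn a y := by
  have := mem_Icc_of_tendsto_prim hψ hy hw (D := Iio y) (fun s hs => by
    obtain ⟨l, hl, hls⟩ := (mem_nhdsLT_iff_exists_Ioo_subset).1 hs
    exact ⟨l, y, hl, hls⟩) (tendsto_prim_nhdsLT νp νn hy.1)
  exact exists_Psi1E_eq hψ this.1 this.2

lemma exists_Psi1E_eq_right (hψ : PsiHyp ψ) (hy : y ∈ Ioo a b)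
    (hw : IsPrim a b (fun x => Psi1 ψ (w x)) νp νn c) :
    ∃ t, Psi1E ψ t = c + prim νp νn a y := by
  have := mem_Icc_of_tendsto_prim hψ hy hw (D := Ioi y) (fun s hs => by
    obtain ⟨l, hl, hls⟩ := (mem_nhdsGT_iff_exists_Ioo_subset).1 hs
    exact ⟨y, l, hl, hls⟩) (tendsto_prim_nhdsGT νp νn hy.1.le)
  exact exists_Psi1E_eq hψ this.1 this.2

lemma Psi1E_leftApproxLimE (hψ : PsiHyp ψ) (hy : y ∈ Ioo a b) (hf : IntegrableOn w (Ioo a b))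
    (hw : IsPrim a b (fun x => Psi1 ψ (w x)) νp νn c) :
    Psi1E ψ (leftApproxLimE w y) = c + primL νp νn a y := by
  obtain ⟨t, ht⟩ := exists_Psi1E_eq_left hψ hy hw
  have h := essLim_of_tendsto_prim hψ hy hw (tendsto_prim_nhdsLT νp νn hy.1) ht
  rw [leftApproxLimE, (h.tendsto_left hy hf).limUnder_eq, ht]

lemma Psi1E_rightApproxLimE (hψ : PsiHyp ψ) (hy : y ∈ Ioo a b) (hf : IntegrableOn w (Ioo a b))
    (hw : IsPrim a b (fun x => Psi1 ψ (w x)) νp νn c) :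
    Psi1E ψ (rightApproxLimE w y) = c + prim νp νn a y := by
  obtain ⟨t, ht⟩ := exists_Psi1E_eq_right hψ hy hw
  have h := essLim_of_tendsto_prim hψ hy hw (tendsto_prim_nhdsGT νp νn hy.1.le) ht
  rw [rightApproxLimE, (h.tendsto_right hy hf).limUnder_eq, ht]

lemma exists_tendsto_symm_of_no_atom (hψ : PsiHyp ψ) (hy : y ∈ Ioo a b)
    (hf : IntegrableOn w (Ioo a b)) (hw : IsPrim a b (fun x => Psi1 ψ (w x)) νp νn c)
    (hp : νp.real {y} = 0) (hn : νn.real {y} = 0) :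
    ∃ t, Psi1E ψ t = c + prim νp νn a y ∧
      Tendsto (fun ε => (((∫ x in Ioo (y - ε) (y + ε), w x) / (2 * ε) : ℝ) : EReal))
      (𝓝[>] 0) (𝓝 t) := by
  obtain ⟨t, ht⟩ := exists_Psi1E_eq_right hψ hy hw
  refine ⟨t, ht, (essLim_of_tendsto_prim hψ hy hw ?_ ht).tendsto_symm hy hf⟩
  have h1 : primL νp νn a y = prim νp νn a y := by
    rw [prim_eq_primL_add νp νn hy.1, hp, hn]; ring
  have h2 := tendsto_prim_nhdsLT νp νn hy.1
  rw [h1] at h2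
  rw [nhdsWithin_univ]
  exact continuousAt_iff_continuous_left'_right'.2 ⟨h2, tendsto_prim_nhdsGT νp νn hy.1.le⟩

lemma prim_eq_of_mem_ZPlus (hψ : PsiHyp ψ) (hy : y ∈ ZPlus a b w)
    (hf : IntegrableOn w (Ioo a b)) (hw : IsPrim a b (fun x => Psi1 ψ (w x)) νp νn c)
    (hp : νp.real {y} = 0) (hn : νn.real {y} = 0) :
    c + prim νp νn a y = ∫ s, ψ s := by
  obtain ⟨t, ht, h⟩ := exists_tendsto_symm_of_no_atom hψ hy.1 hf hw hp hn
  rw [← ht, tendsto_nhds_unique h (EReal.tendsto_coe_nhds_top_iff.2 hy.2)]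
  simp

lemma prim_eq_of_mem_ZMinus (hψ : PsiHyp ψ) (hy : y ∈ ZMinus a b w)
    (hf : IntegrableOn w (Ioo a b)) (hw : IsPrim a b (fun x => Psi1 ψ (w x)) νp νn c)
    (hp : νp.real {y} = 0) (hn : νn.real {y} = 0) :
    c + prim νp νn a y = 0 := by
  obtain ⟨t, ht, h⟩ := exists_tendsto_symm_of_no_atom hψ hy.1 hf hw hp hn
  rw [← ht, tendsto_nhds_unique h (EReal.tendsto_coe_nhds_bot_iff.2 hy.2)]
  simp

end Slope

/-- Points at which `Ψ₁` of the symmetric slopes of `μp - μn` converges. -/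
def slopeSet (ψ : ℝ → ℝ) (a b : ℝ) (μp μn : Measure ℝ) : Set ℝ :=
  {x | x ∈ Ioo a b ∧ ∃ m, Tendsto (fun r => Psi1 ψ (symmSlope μp μn x r)) (𝓝[>] 0) (𝓝 m)}

/-- The limit of `Ψ₁` of the symmetric slopes of `μp - μn`. -/
def slopeVal (ψ : ℝ → ℝ) (μp μn : Measure ℝ) (x : ℝ) : ℝ :=
  limUnder (𝓝[>] 0) fun r => Psi1 ψ (symmSlope μp μn x r)

section

variable {ψ : ℝ → ℝ} {a b c : ℝ} {u : ℝ → ℝ} {μp μn : Measure ℝ}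

lemma slope_of_tendsto {x m : ℝ} (hx : x ∈ Ioo a b)
    (h : Tendsto (fun r => Psi1 ψ (symmSlope μp μn x r)) (𝓝[>] 0) (𝓝 m)) :
    x ∈ slopeSet ψ a b μp μn ∧ slopeVal ψ μp μn x = m :=
  ⟨⟨hx, m, h⟩, h.limUnder_eq⟩

variable [IsFiniteMeasure μp] [IsFiniteMeasure μn]

lemma ae_slope (hψ : PsiHyp ψ) : ∀ᵐ x ∂(volume.restrict (Ioo a b)),
    x ∈ slopeSet ψ a b μp μn ∧ slopeVal ψ μp μn x = Psi1 ψ (uaD μp μn x) := by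
  filter_upwards [ae_restrict_of_ae (ae_tendsto_symmSlope μp μn),
    ae_restrict_mem measurableSet_Ioo] with x hx hxI
  exact slope_of_tendsto hxI (((Psi1_continuous hψ).tendsto _).comp hx)

lemma ae_singularPart_slope_pos (hψ : PsiHyp ψ) (hs : μp ⟂ₘ μn) (hp : μp (Ioo a b)ᶜ = 0) :
    ∀ᵐ x ∂(μp.singularPart volume),
      x ∈ slopeSet ψ a b μp μn ∧ slopeVal ψ μp μn x = ∫ s, ψ s := by
  have hI : ∀ᵐ x ∂(μp.singularPart volume), x ∈ Ioo a b :=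
    (Measure.singularPart_le _ _).absolutelyContinuous.ae_le hp
  filter_upwards [ae_singularPart_tendsto_symmSlope_atTop μp μn hs, hI] with x hx hxI
  exact slope_of_tendsto hxI ((Psi1_tendsto_atTop hψ).comp hx)

lemma ae_singularPart_slope_neg (hψ : PsiHyp ψ) (hs : μp ⟂ₘ μn) (hn : μn (Ioo a b)ᶜ = 0) :
    ∀ᵐ x ∂(μn.singularPart volume),
      x ∈ slopeSet ψ a b μp μn ∧ slopeVal ψ μp μn x = 0 := by
  have hI : ∀ᵐ x ∂(μn.singularPart volume), x ∈ Ioo a b :=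
    (Measure.singularPart_le _ _).absolutelyContinuous.ae_le hn
  filter_upwards [ae_singularPart_tendsto_symmSlope_atBot μp μn hs, hI] with x hx hxI
  exact slope_of_tendsto hxI ((Psi1_tendsto_atBot hψ).comp hx)

/-- Lower bound for the relaxed functional in terms of essential variations. -/
lemma exists_eVariationOn_slope_le (hψ : PsiHyp ψ) {B : ℝ≥0∞} (h : FpRel ψ 1 a b u < B) :
    ∃ G ⊆ Ioo a b, (∀ᵐ x ∂(volume.restrict (Ioo a b)), x ∈ G) ∧ eVariationOn u G ≤ B ∧
      ∀ (μp μn : Measure ℝ) [IsFiniteMeasure μp] [IsFiniteMeasure μn] (c : ℝ),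
        IsPrim a b u μp μn c →
        eVariationOn u G + eVariationOn (slopeVal ψ μp μn) (slopeSet ψ a b μp μn) ≤ B := by
  obtain ⟨G, hGI, hG, hGe⟩ := exists_ae_eVariationOn_add_le hψ h
  refine ⟨G, hGI, hG, ?_, fun μp μn _ _ c hu => hGe _ _ ?_⟩
  · exact le_self_add.trans (hGe ∅ id (by simp))
  · rintro p ⟨hp, m, hm⟩ ε hε
    rw [slopeVal, hm.limUnder_eq]
    exact exists_slope_close hu hG hp hm hε

lemma measure_atom_singularPart_eq_zero {μ : Measure ℝ} [IsFiniteMeasure μ] {y : ℝ}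
    (h : ¬ 0 < μ.real {y}) : μ.singularPart volume {y} = 0 := by
  refine le_antisymm ((Measure.singularPart_le _ _ _).trans ?_) zero_le
  have h1 : μ.real {y} = 0 := le_antisymm (not_lt.1 h) measureReal_nonneg
  rw [measureReal_eq_zero_iff] at h1
  exact h1.le

lemma ae_notMem_of_countable {μ : Measure ℝ} {C : Set ℝ} (hC : C.Countable)
    (h : ∀ y ∈ C, μ {y} = 0) : ∀ᵐ x ∂μ, x ∉ C := by
  refine measure_eq_zero_iff_ae_notMem.1 ?_
  rw [← biUnion_of_singleton C]
  exact (measure_biUnion_null_iff hC).2 h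

lemma essLim_of_slope (hψ : PsiHyp ψ) {D : Set ℝ} {e T w : ℝ → ℝ} {x : ℝ} (hx : x ∈ Ioo a b)
    (hxD : x ∈ D) (he : ∀ᵐ x ∂(volume.restrict (Ioo a b)), x ∈ D ∧ e x = Psi1 ψ (w x))
    (hT : ContinuousAt T x) (heT : ∀ x ∈ D, ∀ y ∈ D, x ≤ y → |e y - e x| ≤ T y - T x) {t : EReal}
    (hex : e x = Psi1E ψ t) : EssLim w univ x t := by
  have he' := (ae_restrict_iff' measurableSet_Ioo).1 he
  have key : ∀ η > 0, ∃ δ > 0, ∀ᵐ z, z ∈ Ioo (x - δ) (x + δ) ∩ univ →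
      |Psi1 ψ (w z) - e x| < η := by
    intro η hη
    obtain ⟨δ, hδ, hδT⟩ := Metric.continuousAt_iff.1 hT η hη
    obtain ⟨δ', hδ', hδI⟩ := Metric.isOpen_iff.1 isOpen_Ioo x hx
    refine ⟨min δ δ', lt_min hδ hδ', ?_⟩
    filter_upwards [he'] with z hz hzm
    have hz1 : |z - x| < min δ δ' := by
      rw [abs_lt]; constructor <;> linarith [hzm.1.1, hzm.1.2]
    have hzI : z ∈ Ioo a b := hδI (by
      rw [Metric.mem_ball, Real.dist_eq]; exact hz1.trans_le (min_le_right _ _))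
    obtain ⟨hzD, hze⟩ := hz hzI
    have h1 : |T z - T x| < η := by
      rw [← Real.dist_eq]; refine hδT ?_
      rw [Real.dist_eq]; exact hz1.trans_le (min_le_left _ _)
    rw [← hze]
    rcases le_total x z with h | h
    · exact (heT x hxD z hzD h).trans_lt ((le_abs_self _).trans_lt h1)
    · rw [abs_sub_comm]
      refine (heT z hzD x hxD h).trans_lt (lt_of_le_of_lt ?_ h1)
      rw [abs_sub_comm]; exact le_abs_self _
  constructor
  · intro s hs
    have h1 := Psi1E_strictMono hψ hs
    rw [← hex, Psi1E_coe] at h1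
    obtain ⟨δ, hδ, hk⟩ := key (e x - Psi1 ψ s) (by linarith)
    refine ⟨δ, hδ, hk.mono fun z hz hzm => ?_⟩
    have h2 := abs_lt.1 (hz hzm)
    exact ((Psi1_strictMono hψ).lt_iff_lt.1 (by linarith [h2.1])).le
  · intro s hs
    have h1 := Psi1E_strictMono hψ hs
    rw [← hex, Psi1E_coe] at h1
    obtain ⟨δ, hδ, hk⟩ := key (Psi1 ψ s - e x) (by linarith)
    refine ⟨δ, hδ, hk.mono fun z hz hzm => ?_⟩
    have h2 := abs_lt.1 (hz hzm)
    exact ((Psi1_strictMono hψ).lt_iff_lt.1 (by linarith [h2.2])).le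

end

/-- Finiteness of the relaxed functional forces `u ∈ X¹_ψ`. -/
lemma exists_memX1_of_FpRel_ne_top {ψ : ℝ → ℝ} (hψ : PsiHyp ψ) {a b : ℝ} (hab : a < b) {u : ℝ → ℝ}
    (hui : IntegrableOn u (Ioo a b)) (h : FpRel ψ 1 a b u ≠ ⊤) :
    ∃ μp μn : Measure ℝ, MemX1 ψ a b u μp μn := by
  obtain ⟨B, hB, hBt⟩ := exists_between h.lt_top
  obtain ⟨G, hGI, hG, hV, hVe⟩ := exists_eVariationOn_slope_le hψ hB
  obtain ⟨μp, μn, hμ⟩ := exists_isDerivMeasures_of_eVariationOn hG (hV.trans_lt hBt).ne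
  obtain ⟨c, hc⟩ := hμ.exists_isPrim hab
  obtain ⟨-, hfp, hfn, hs, hp, hn, -⟩ := id hμ
  have hVs : eVariationOn (slopeVal ψ μp μn) (slopeSet ψ a b μp μn) ≠ ⊤ :=
    ((le_add_self.trans (hVe μp μn c hc)).trans_lt hBt).ne
  have hsl := ae_slope (a := a) (b := b) (μp := μp) (μn := μn) hψ
  have hv : eVariationOn (fun x => Psi1 ψ (uaD μp μn x))
      {x | x ∈ slopeSet ψ a b μp μn ∧ slopeVal ψ μp μn x = Psi1 ψ (uaD μp μn x)} ≠ ⊤ := by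
    refine ne_top_of_le_ne_top hVs ?_
    rw [eVariationOn.eq_of_eqOn (f' := slopeVal ψ μp μn) (fun x hx => hx.2.symm)]
    exact eVariationOn.mono _ fun x hx => hx.1
  obtain ⟨T, hT, -, -, hTe⟩ := exists_monotone_of_eVariationOn hVs
  have hcount := hT.countable_not_continuousAt
  have hwi : IntegrableOn (uaD μp μn) (Ioo a b) := (uaD_integrable μp μn).integrableOn
  have hSm : MeasurableSet (jumpSet a b u)ᶜ := (countable_jumpSet hui hc hs).measurableSet.compl
  have hatom : ∀ (μ : Measure ℝ) [IsFiniteMeasure μ], μ (Ioo a b)ᶜ = 0 →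
      (∀ y ∈ Ioo a b, y ∉ jumpSet a b u → ¬ 0 < μ.real {y}) →
      ∀ᵐ x ∂(μ.singularPart volume), x ∉ {x | ¬ ContinuousAt T x} \ jumpSet a b u := by
    intro μ _ hμ0 hμ1
    refine ae_notMem_of_countable (hcount.mono sdiff_subset) fun y hy => ?_
    refine measure_atom_singularPart_eq_zero ?_
    by_cases hyI : y ∈ Ioo a b
    · exact hμ1 y hyI hy.2
    · rw [Measure.real, measure_mono_null (singleton_subset_iff.2 hyI) hμ0]; simp
  refine ⟨μp, μn, hμ, exists_isDerivMeasures_of_eVariationOn hsl hv, ?_, ?_⟩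
  · rw [cantorPos, ← mem_ae_iff]
    refine (ae_restrict_iff' hSm).2 ?_
    filter_upwards [ae_singularPart_slope_pos hψ hs hp, hatom μp hp fun y hy hyS h0 =>
      hyS ((mem_jumpSet_iff hui hc hs).2 ⟨hy, Or.inl h0⟩)] with x hx hxT hxS
    have hTx : ContinuousAt T x := by
      by_contra hcon
      exact hxT ⟨hcon, hxS⟩
    exact (essLim_of_slope hψ hx.1.1 hx.1 hsl hTx hTe (t := ⊤) (by simp [hx.2])).mem_ZPlus
      hx.1.1 hwi
  · rw [cantorNeg, ← mem_ae_iff]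
    refine (ae_restrict_iff' hSm).2 ?_
    filter_upwards [ae_singularPart_slope_neg hψ hs hn, hatom μn hn fun y hy hyS h0 =>
      hyS ((mem_jumpSet_iff hui hc hs).2 ⟨hy, Or.inr h0⟩)] with x hx hxT hxS
    have hTx : ContinuousAt T x := by
      by_contra hcon
      exact hxT ⟨hcon, hxS⟩
    exact (essLim_of_slope hψ hx.1.1 hx.1 hsl hTx hTe (t := ⊥) (by simp [hx.2])).mem_ZMinus
      hx.1.1 hwi

/-- A transition from `s` to `t` inside `]p,q]` which costs no more than `|Ψ₁ t - Ψ₁ s|` and is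
`L¹`-close to the constant `s`. -/
lemma exists_transition {ψ : ℝ → ℝ} (hψ : PsiHyp ψ) {p q η : ℝ} (s t : ℝ) (hpq : p < q)
    (hη : 0 < η) :
    ∃ w : ℝ → ℝ, Integrable w ∧ (∀ x ∉ Ioc p q, w x = 0) ∧ (∫ x in p..q, w x = t - s) ∧
      (∫ x in p..q, |∫ y in p..x, w y| ≤ η) ∧
      ∫ x in p..q, ψ (s + ∫ y in p..x, w y) * |w x| ≤ |Psi1 ψ t - Psi1 ψ s| := by
  obtain ⟨δ, hδ, hδ1, hδ2⟩ : ∃ δ > 0, δ < q - p ∧ |t - s| * δ ≤ η := by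
    refine ⟨min ((q - p) / 2) (η / (|t - s| + 1)), ?_, ?_, ?_⟩
    · have := abs_nonneg (t - s)
      exact lt_min (by linarith) (by positivity)
    · exact (min_le_left _ _).trans_lt (by linarith)
    · have h1 := abs_nonneg (t - s)
      refine (mul_le_mul_of_nonneg_left (min_le_right _ _) h1).trans ?_
      rw [mul_div_assoc', div_le_iff₀ (by positivity)]
      nlinarith
  set r := q - δ with hr
  have hpr : p < r := by linarith
  have hrq : r < q := by linarith
  set k := (t - s) / δ with hk
  set w : ℝ → ℝ := indicator (Ioc r q) fun _ => k with hw
  have hwi : Integrable w := (integrable_indicator_iff measurableSet_Ioc).2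
    (integrableOn_const (by rw [Real.volume_Ioc]; exact ENNReal.ofReal_ne_top))
  have hw0 : ∀ x ≤ r, w x = 0 := fun x hx => indicator_of_notMem (fun h => (h.1.trans_le hx).false) _
  have hwk : ∀ x ∈ Ioc r q, w x = k := fun x hx => indicator_of_mem hx _
  have hJ0 : ∀ x, p ≤ x → x ≤ r → ∫ y in p..x, w y = 0 := fun x h1 h2 =>
    intervalIntegral.integral_zero_ae (Eventually.of_forall fun y hy => by
      rw [uIoc_of_le h1] at hy; exact hw0 y (hy.2.trans h2))
  have hJ1 : ∀ x, r ≤ x → x ≤ q → ∫ y in p..x, w y = k * (x - r) := fun x h1 h2 => by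
    rw [← intervalIntegral.integral_add_adjacent_intervals (b := r) hwi.intervalIntegrable
      hwi.intervalIntegrable, hJ0 r hpr.le le_rfl, intervalIntegral.integral_congr_ae
      (g := fun _ => k) (Eventually.of_forall fun y hy => by
        rw [uIoc_of_le h1] at hy; exact hwk y ⟨hy.1, hy.2.trans h2⟩)]
    simp [mul_comm]
  have hJc : Continuous fun x => ∫ y in p..x, w y :=
    intervalIntegral.continuous_primitive (fun _ _ => hwi.intervalIntegrable) p
  have hkδ : k * δ = t - s := div_mul_cancel₀ _ hδ.ne'
  refine ⟨w, hwi, fun x hx => indicator_of_notMem (fun h => hx ⟨hpr.trans h.1, h.2⟩) _, ?_, ?_, ?_⟩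
  · rw [hJ1 q hrq.le le_rfl, hr, ← hkδ]; ring
  · rw [← intervalIntegral.integral_add_adjacent_intervals (b := r)
      (hJc.abs.intervalIntegrable _ _) (hJc.abs.intervalIntegrable _ _)]
    have h1 : ∫ x in p..r, |∫ y in p..x, w y| = 0 :=
      intervalIntegral.integral_zero_ae (Eventually.of_forall fun y hy => by
        rw [uIoc_of_le hpr.le] at hy; rw [hJ0 y hy.1.le hy.2, abs_zero])
    have h2 : ∫ x in r..q, |∫ y in p..x, w y| ≤ ∫ x in r..q, |t - s| := by
      refine intervalIntegral.integral_mono_on hrq.le (hJc.abs.intervalIntegrable _ _)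
        (continuous_const.intervalIntegrable _ _) fun x hx => ?_
      rw [hJ1 x hx.1 hx.2, ← hkδ, abs_mul, abs_mul]
      refine mul_le_mul_of_nonneg_left ?_ (abs_nonneg _)
      rw [abs_of_nonneg (by linarith [hx.1]), abs_of_pos hδ]; linarith [hx.2]
    rw [intervalIntegral.integral_const, smul_eq_mul] at h2
    rw [h1, zero_add]
    refine h2.trans (le_trans (le_of_eq ?_) hδ2)
    rw [hr]; ring
  · have hint : ∀ x y, IntervalIntegrable (fun x => ψ (s + ∫ y in p..x, w y) * |w x|) volume x y := by
      intro x y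
      obtain ⟨C, hC⟩ := hψ.bounded
      refine (hwi.abs.bdd_mul (c := C) (hψ.measurable.comp
        (hJc.measurable.const_add s)).aestronglyMeasurable ?_).intervalIntegrable
      refine Eventually.of_forall fun z => ?_
      rw [Function.comp_apply, Real.norm_of_nonneg (hψ.pos _).le]; exact hC _
    rw [← intervalIntegral.integral_add_adjacent_intervals (b := r) (hint _ _) (hint _ _)]
    have h1 : ∫ x in p..r, ψ (s + ∫ y in p..x, w y) * |w x| = 0 :=
      intervalIntegral.integral_zero_ae (Eventually.of_forall fun y hy => by
        rw [uIoc_of_le hpr.le] at hy; rw [hw0 y hy.2, abs_zero, mul_zero])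
    have h2 : ∫ x in r..q, ψ (s + ∫ y in p..x, w y) * |w x| =
        (∫ x in r..q, ψ (k * x + (s - k * r))) * |k| := by
      rw [← intervalIntegral.integral_mul_const]
      refine intervalIntegral.integral_congr_ae (Eventually.of_forall fun y hy => ?_)
      rw [uIoc_of_le hrq.le] at hy
      rw [hJ1 y hy.1.le hy.2, hwk y hy]
      congr 2; ring
    rw [h1, h2, zero_add]
    rcases eq_or_ne k 0 with hk0 | hk0
    · rw [hk0, abs_zero, mul_zero]; exact abs_nonneg _
    · rw [intervalIntegral.integral_comp_mul_add _ hk0, smul_eq_mul,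
        show k * r + (s - k * r) = s by ring,
        show k * q + (s - k * r) = t by linarith [show k * (q - r) = t - s by rw [← hkδ, hr]; ring],
        ← Psi1_sub_Psi1 hψ s t]
      refine (le_abs_self _).trans (le_of_eq ?_)
      rw [abs_mul, abs_mul, abs_inv, abs_abs]
      have := abs_pos.2 hk0
      field_simp

/-- A piecewise affine interpolation of the values `s i` on consecutive blocks of length `h`. -/
lemma exists_interpolation {ψ : ℝ → ℝ} (hψ : PsiHyp ψ) (a : ℝ) {h η : ℝ} (hh : 0 < h) (hη : 0 < η)
    (s : ℕ → ℝ) (n : ℕ) :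
    ∃ w : ℝ → ℝ, Integrable w ∧ ∀ i < n,
      (∫ x in (a + i * h)..(a + (i + 1 : ℕ) * h), |s 0 + (∫ y in a..x, w y) - s i| ≤ η) ∧
      ∫ x in (a + i * h)..(a + (i + 1 : ℕ) * h), ψ (s 0 + ∫ y in a..x, w y) * |w x| ≤
        |Psi1 ψ (s (i + 1)) - Psi1 ψ (s i)| := by
  set X : ℕ → ℝ := fun i => a + i * h with hX
  have hXlt : ∀ i, X i < X (i + 1) := fun i => by simp only [hX]; push_cast; linarith
  have hXm : Monotone X := monotone_nat_of_le_succ fun i => (hXlt i).le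
  have hX0 : X 0 = a := by simp [hX]
  choose W hW1 hW2 hW3 hW4 hW5 using fun i => exists_transition hψ (s i) (s (i + 1)) (hXlt i) hη
  set w : ℝ → ℝ := fun x => ∑ i ∈ Finset.range n, W i x with hw
  have hwi : Integrable w := integrable_finsetSum _ fun i _ => hW1 i
  have hwW : ∀ i < n, ∀ x ∈ Ioc (X i) (X (i + 1)), w x = W i x := by
    intro i hi x hx
    refine Finset.sum_eq_single_of_mem i (Finset.mem_range.2 hi) fun j _ hji => hW2 j x fun hxj => ?_
    exact (disjoint_left.1 (hXm.pairwise_disjoint_on_Ioc_succ hji)) hxj hx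
  have hint : ∀ i < n, ∀ x ∈ Icc (X i) (X (i + 1)), ∫ y in (X i)..x, w y = ∫ y in (X i)..x, W i y := by
    intro i hi x hx
    refine intervalIntegral.integral_congr_ae (Eventually.of_forall fun y hy => ?_)
    rw [uIoc_of_le hx.1] at hy
    exact hwW i hi y ⟨hy.1, hy.2.trans hx.2⟩
  have hval : ∀ i ≤ n, s 0 + ∫ y in a..(X i), w y = s i := by
    intro i
    induction i with
    | zero => intro _; simp [hX0]
    | succ i ih =>
      intro hi
      rw [← intervalIntegral.integral_add_adjacent_intervals (b := X i) hwi.intervalIntegrable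
        hwi.intervalIntegrable, ← add_assoc, ih (by omega),
        hint i (by omega) _ (right_mem_Icc.2 (hXlt i).le), hW3]
      ring
  have hblock : ∀ i < n, ∀ x ∈ Ioc (X i) (X (i + 1)),
      s 0 + ∫ y in a..x, w y = s i + ∫ y in (X i)..x, W i y := by
    intro i hi x hx
    rw [← hint i hi x (Ioc_subset_Icc_self hx), ← hval i hi.le, add_assoc,
      intervalIntegral.integral_add_adjacent_intervals hwi.intervalIntegrable
        hwi.intervalIntegrable]
  refine ⟨w, hwi, fun i hi => ⟨?_, ?_⟩⟩
  · refine le_trans (le_of_eq ?_) (hW4 i)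
    refine intervalIntegral.integral_congr_ae (Eventually.of_forall fun x hx => ?_)
    rw [uIoc_of_le (hXlt i).le] at hx
    rw [hblock i hi x hx, add_sub_cancel_left]
  · refine le_trans (le_of_eq ?_) (hW5 i)
    refine intervalIntegral.integral_congr_ae (Eventually.of_forall fun x hx => ?_)
    rw [uIoc_of_le (hXlt i).le] at hx
    rw [hblock i hi x hx, hwW i hi x hx]

lemma convexOn_abs_affine (A B : ℝ) : ConvexOn ℝ univ fun t : ℝ => |A * t + B| := by
  refine ⟨convex_univ, fun x _ y _ p q hp hq hpq => ?_⟩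
  simp only [smul_eq_mul]
  rw [← abs_of_nonneg hp, ← abs_of_nonneg hq, ← abs_mul, ← abs_mul, abs_of_nonneg hp,
    abs_of_nonneg hq]
  refine le_trans (le_of_eq ?_) (abs_add_le _ _)
  congr 1
  linear_combination B * (-hpq)

/-- The discrete variation is convex in each variable, hence maximized at extreme values. -/
lemma exists_extreme_sum_abs_sub_le (N : ℕ) {l r c : ℕ → ℝ}
    (hc : ∀ i ≤ N, c i ∈ Icc (l i) (r i)) :
    ∃ d : ℕ → ℝ, (∀ i ≤ N, d i = l i ∨ d i = r i) ∧
      ∑ i ∈ Finset.range N, |c (i + 1) - c i| ≤ ∑ i ∈ Finset.range N, |d (i + 1) - d i| := by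
  suffices H : ∀ m ≤ N + 1, ∃ d : ℕ → ℝ, (∀ i < m, d i = l i ∨ d i = r i) ∧ (∀ i ≥ m, d i = c i) ∧
      ∑ i ∈ Finset.range N, |c (i + 1) - c i| ≤ ∑ i ∈ Finset.range N, |d (i + 1) - d i| by
    obtain ⟨d, h1, -, h2⟩ := H (N + 1) le_rfl
    exact ⟨d, fun i hi => h1 i (by omega), h2⟩
  intro m
  induction m with
  | zero => exact fun _ => ⟨c, by simp, fun _ _ => rfl, le_rfl⟩
  | succ m ih =>
    intro hm
    obtain ⟨d, h1, h2, h3⟩ := ih (by omega)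
    set V : ℝ → ℝ := fun t => ∑ i ∈ Finset.range N,
      |Function.update d m t (i + 1) - Function.update d m t i| with hV
    have hconv : ConvexOn ℝ univ V := by
      have : V = ∑ i ∈ Finset.range N, fun t : ℝ =>
          |((if i + 1 = m then 1 else 0) - (if i = m then 1 else 0)) * t +
            ((if i + 1 = m then 0 else d (i + 1)) - (if i = m then 0 else d i))| := by
        funext t
        rw [Finset.sum_apply]
        refine Finset.sum_congr rfl fun i _ => ?_
        simp only [Function.update_apply]
        congr 1
        split_ifs <;> ring
      rw [this]
      exact Finset.sum_induction _ (ConvexOn ℝ univ) (fun _ _ h h' => h.add h')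
        (convexOn_const 0 convex_univ) fun i _ => convexOn_abs_affine _ _
    have hcm := hc m (by omega)
    have hle : V (c m) ≤ max (V (l m)) (V (r m)) :=
      hconv.le_max_of_mem_Icc (mem_univ _) (mem_univ _) hcm
    have hVc : V (c m) = ∑ i ∈ Finset.range N, |d (i + 1) - d i| := by
      simp only [hV, ← h2 m le_rfl, Function.update_eq_self]
    rw [hVc] at hle
    obtain ⟨t, ht, htV⟩ : ∃ t, (t = l m ∨ t = r m) ∧ ∑ i ∈ Finset.range N, |d (i + 1) - d i| ≤ V t := by
      rcases le_max_iff.1 hle with h | h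
      · exact ⟨_, Or.inl rfl, h⟩
      · exact ⟨_, Or.inr rfl, h⟩
    refine ⟨Function.update d m t, fun i hi => ?_, fun i hi => ?_, h3.trans htV⟩
    · rcases eq_or_ne i m with rfl | him
      · rwa [Function.update_self]
      · rw [Function.update_of_ne him]; exact h1 i (by omega)
    · rw [Function.update_of_ne (by omega)]; exact h2 i (by omega)

section Block

variable {ψ : ℝ → ℝ} {a b : ℝ} {μp μn : Measure ℝ} [IsFiniteMeasure μp] [IsFiniteMeasure μn]

lemma measureReal_eq_setIntegral_add (μ : Measure ℝ) [IsFiniteMeasure μ] (s : Set ℝ) :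
    μ.real s = (∫ x in s, (μ.rnDeriv volume x).toReal) + (μ.singularPart volume).real s := by
  rw [Measure.setIntegral_toReal_rnDeriv_eq_withDensity]
  nth_rw 1 [← Measure.singularPart_add_rnDeriv μ volume]
  rw [measureReal_add_apply, add_comm]

lemma prim_sub_eq (μp μn : Measure ℝ) [IsFiniteMeasure μp] [IsFiniteMeasure μn] {x y : ℝ}
    (hax : a ≤ x) (hxy : x ≤ y) :
    prim μp μn a y - prim μp μn a x = (∫ z in Ioc x y, uaD μp μn z) +
      (μp.singularPart volume).real (Ioc x y) - (μn.singularPart volume).real (Ioc x y) := by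
  rw [prim_sub μp μn hax hxy, measureReal_eq_setIntegral_add μp, measureReal_eq_setIntegral_add μn]
  have h1 : ∫ z in Ioc x y, uaD μp μn z = (∫ z in Ioc x y, (μp.rnDeriv volume z).toReal) -
      ∫ z in Ioc x y, (μn.rnDeriv volume z).toReal :=
    integral_sub Measure.integrable_toReal_rnDeriv.integrableOn
      Measure.integrable_toReal_rnDeriv.integrableOn
  rw [h1]; ring

lemma setIntegral_lt_of_ae_lt {f : ℝ → ℝ} {x y s : ℝ} (hxy : x < y) (hf : IntegrableOn f (Ioc x y))
    (h : ∀ᵐ z ∂(volume.restrict (Ioc x y)), f z < s) : ∫ z in Ioc x y, f z < s * (y - x) := by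
  have hc : IntegrableOn (fun _ : ℝ => s) (Ioc x y) :=
    integrableOn_const (by rw [Real.volume_Ioc]; exact ENNReal.ofReal_ne_top)
  have h1 : 0 < ∫ z in Ioc x y, (s - f z) := by
    rw [integral_pos_iff_support_of_nonneg_ae (h.mono fun z hz => (sub_pos.2 hz).le) (hc.sub hf)]
    have : volume.restrict (Ioc x y) univ ≤
        volume.restrict (Ioc x y) (Function.support fun z => s - f z) := by
      refine measure_mono_ae (h.mono fun z hz _ => ?_)
      exact (sub_pos.2 hz).ne'
    refine lt_of_lt_of_le ?_ this
    rw [Measure.restrict_apply_univ, Real.volume_Ioc]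
    simpa using hxy
  rw [integral_sub hc hf, setIntegral_const, Measure.real, Real.volume_Ioc,
    ENNReal.toReal_ofReal (by linarith), smul_eq_mul] at h1
  linarith

lemma exists_le_slope {D : Set ℝ} {e : ℝ → ℝ} (hψ : PsiHyp ψ)
    (hv : ∀ᵐ x ∂(volume.restrict (Ioo a b)), x ∈ D ∧ e x = Psi1 ψ (uaD μp μn x))
    (hp : ∀ᵐ x ∂(μp.singularPart volume), x ∈ D ∧ e x = ∫ s, ψ s)
    {x y : ℝ} (hax : a ≤ x) (hxy : x < y) (hyb : y ≤ b) :
    ∃ z ∈ D, z ∈ Ioc x y ∧ Psi1 ψ ((prim μp μn a y - prim μp μn a x) / (y - x)) ≤ e z := by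
  by_contra! hcon
  set s := (prim μp μn a y - prim μp μn a x) / (y - x)
  have hsub : Ioo x y ⊆ Ioo a b := Ioo_subset_Ioo hax hyb
  have h1 : ∀ᵐ z ∂(volume.restrict (Ioc x y)), uaD μp μn z < s := by
    rw [← restrict_Ioo_eq_restrict_Ioc]
    filter_upwards [ae_restrict_of_ae_restrict_of_subset hsub hv,
      ae_restrict_mem measurableSet_Ioo] with z hz hzm
    have := hcon z hz.1 (Ioo_subset_Ioc_self hzm)
    rw [hz.2] at this
    exact (Psi1_strictMono hψ).lt_iff_lt.1 this
  have h2 : (μp.singularPart volume).real (Ioc x y) = 0 := by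
    rw [measureReal_eq_zero_iff, measure_eq_zero_iff_ae_notMem]
    filter_upwards [hp] with z hz hzm
    have := hcon z hz.1 hzm
    rw [hz.2] at this
    exact (this.trans (Psi1_lt hψ s)).false
  have h3 := setIntegral_lt_of_ae_lt hxy (uaD_integrable μp μn).integrableOn h1
  have h4 := prim_sub_eq μp μn hax hxy.le
  have h5 : 0 ≤ (μn.singularPart volume).real (Ioc x y) := measureReal_nonneg
  have h6 : s * (y - x) = prim μp μn a y - prim μp μn a x :=
    div_mul_cancel₀ _ (by linarith)
  linarith

lemma exists_slope_le {D : Set ℝ} {e : ℝ → ℝ} (hψ : PsiHyp ψ)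
    (hv : ∀ᵐ x ∂(volume.restrict (Ioo a b)), x ∈ D ∧ e x = Psi1 ψ (uaD μp μn x))
    (hn : ∀ᵐ x ∂(μn.singularPart volume), x ∈ D ∧ e x = 0)
    {x y : ℝ} (hax : a ≤ x) (hxy : x < y) (hyb : y ≤ b) :
    ∃ z ∈ D, z ∈ Ioc x y ∧ e z ≤ Psi1 ψ ((prim μp μn a y - prim μp μn a x) / (y - x)) := by
  by_contra! hcon
  set s := (prim μp μn a y - prim μp μn a x) / (y - x)
  have hsub : Ioo x y ⊆ Ioo a b := Ioo_subset_Ioo hax hyb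
  have h1 : ∀ᵐ z ∂(volume.restrict (Ioc x y)), -uaD μp μn z < -s := by
    rw [← restrict_Ioo_eq_restrict_Ioc]
    filter_upwards [ae_restrict_of_ae_restrict_of_subset hsub hv,
      ae_restrict_mem measurableSet_Ioo] with z hz hzm
    have := hcon z hz.1 (Ioo_subset_Ioc_self hzm)
    rw [hz.2] at this
    exact neg_lt_neg ((Psi1_strictMono hψ).lt_iff_lt.1 this)
  have h2 : (μn.singularPart volume).real (Ioc x y) = 0 := by
    rw [measureReal_eq_zero_iff, measure_eq_zero_iff_ae_notMem]
    filter_upwards [hn] with z hz hzm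
    have := hcon z hz.1 hzm
    rw [hz.2] at this
    exact (this.trans (Psi1_pos hψ s)).false
  have h3 : ∫ z in Ioc x y, -uaD μp μn z < -s * (y - x) :=
    setIntegral_lt_of_ae_lt hxy (uaD_integrable μp μn).neg.integrableOn h1
  have h4 := prim_sub_eq μp μn hax hxy.le
  have h5 : 0 ≤ (μp.singularPart volume).real (Ioc x y) := measureReal_nonneg
  have h6 : s * (y - x) = prim μp μn a y - prim μp μn a x :=
    div_mul_cancel₀ _ (by linarith)
  have h7 : ∫ z in Ioc x y, -uaD μp μn z = -∫ z in Ioc x y, uaD μp μn z := integral_neg _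
  linarith

/-- The variation of `Ψ₁` of the mean slopes on consecutive blocks is controlled. -/
lemma sum_abs_Psi1_slope_le {D : Set ℝ} {e : ℝ → ℝ} (hψ : PsiHyp ψ)
    (hv : ∀ᵐ x ∂(volume.restrict (Ioo a b)), x ∈ D ∧ e x = Psi1 ψ (uaD μp μn x))
    (hp : ∀ᵐ x ∂(μp.singularPart volume), x ∈ D ∧ e x = ∫ s, ψ s)
    (hn : ∀ᵐ x ∂(μn.singularPart volume), x ∈ D ∧ e x = 0) (hV : eVariationOn e D ≠ ⊤)
    {X s : ℕ → ℝ} {N : ℕ} (hX : StrictMono X) (h0 : a ≤ X 0) (hN : X (N + 1) ≤ b)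
    (hs : ∀ i ≤ N, s i = (prim μp μn a (X (i + 1)) - prim μp μn a (X i)) / (X (i + 1) - X i)) :
    ∑ i ∈ Finset.range N, |Psi1 ψ (s (i + 1)) - Psi1 ψ (s i)| ≤ (eVariationOn e D).toReal := by
  have hy : ∀ i, ∃ y, i ≤ N → y ∈ D ∧ y ∈ Ioc (X i) (X (i + 1)) ∧ Psi1 ψ (s i) ≤ e y := by
    intro i
    by_cases hi : i ≤ N
    · obtain ⟨y, h1, h2, h3⟩ := exists_le_slope hψ hv hp (h0.trans (hX.monotone (Nat.zero_le i)))
        (hX (Nat.lt_succ_self i)) ((hX.monotone (by omega)).trans hN)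
      exact ⟨y, fun _ => ⟨h1, h2, by rw [hs i hi]; exact h3⟩⟩
    · exact ⟨0, fun h => absurd h hi⟩
  have hz : ∀ i, ∃ y, i ≤ N → y ∈ D ∧ y ∈ Ioc (X i) (X (i + 1)) ∧ e y ≤ Psi1 ψ (s i) := by
    intro i
    by_cases hi : i ≤ N
    · obtain ⟨y, h1, h2, h3⟩ := exists_slope_le hψ hv hn (h0.trans (hX.monotone (Nat.zero_le i)))
        (hX (Nat.lt_succ_self i)) ((hX.monotone (by omega)).trans hN)
      exact ⟨y, fun _ => ⟨h1, h2, by rw [hs i hi]; exact h3⟩⟩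
    · exact ⟨0, fun h => absurd h hi⟩
  choose y hy using hy
  choose z hz using hz
  obtain ⟨d, hd, hle⟩ := exists_extreme_sum_abs_sub_le N (l := fun i => e (z i))
    (r := fun i => e (y i)) (c := fun i => Psi1 ψ (s i))
    fun i hi => ⟨(hz i hi).2.2, (hy i hi).2.2⟩
  have ht : ∀ i, ∃ t, i ≤ N → t ∈ D ∧ t ∈ Ioc (X i) (X (i + 1)) ∧ d i = e t := by
    intro i
    by_cases hi : i ≤ N
    · rcases hd i hi with h | h
      · exact ⟨z i, fun _ => ⟨(hz i hi).1, (hz i hi).2.1, h⟩⟩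
      · exact ⟨y i, fun _ => ⟨(hy i hi).1, (hy i hi).2.1, h⟩⟩
    · exact ⟨0, fun h => absurd h hi⟩
  choose t ht using ht
  refine hle.trans ?_
  have hmono : MonotoneOn t (Iic N) := by
    intro i hi j hj hij
    rcases hij.eq_or_lt with rfl | hlt
    · exact le_rfl
    · exact (ht i hi).2.1.2.trans ((hX.monotone hlt).trans (ht j hj).2.1.1.le)
  have h1 := eVariationOn.sum_le_of_monotoneOn_Iic (f := e) hmono fun i hi => (ht i hi).1
  have h2 : ENNReal.ofReal (∑ i ∈ Finset.range N, |d (i + 1) - d i|) ≤ eVariationOn e D := by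
    rw [ENNReal.ofReal_sum_of_nonneg fun _ _ => abs_nonneg _]
    refine le_trans (le_of_eq (Finset.sum_congr rfl fun i hi => ?_)) h1
    have hi' := Finset.mem_range.1 hi
    rw [edist_comm, edist_eq_ofReal_abs, (ht i hi'.le).2.2, (ht (i + 1) hi').2.2]
  exact (ENNReal.ofReal_le_iff_le_toReal hV).1 h2

end Block

section Recovery

variable {ψ : ℝ → ℝ} {a b : ℝ} {μp μn : Measure ℝ} [IsFiniteMeasure μp] [IsFiniteMeasure μn]

lemma measureReal_Ioc_block_sum (μ : Measure ℝ) [IsFiniteMeasure μ] {X : ℕ → ℝ} (hX : StrictMono X)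
    (hX0 : X 0 = a) (n : ℕ) :
    ∑ i ∈ Finset.range n, μ.real (Ioc (X i) (X (i + 1))) ≤ μ.real univ := by
  have h1 : ∀ i, μ.real (Ioc (X i) (X (i + 1))) = μ.real (Ioc a (X (i + 1))) - μ.real (Ioc a (X i)) :=
    fun i => (measureReal_Ioc_sub μ (hX0 ▸ hX.monotone (Nat.zero_le i))
      (hX (Nat.lt_succ_self i)).le).symm
  simp only [h1]
  rw [Finset.sum_range_sub fun i => μ.real (Ioc a (X i))]
  have h2 : μ.real (Ioc a (X n)) ≤ μ.real univ := measureReal_mono (subset_univ _)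
  have h3 : 0 ≤ μ.real (Ioc a (X 0)) := measureReal_nonneg
  linarith

lemma abs_prim_sub_le (μp μn : Measure ℝ) [IsFiniteMeasure μp] [IsFiniteMeasure μn] {x y : ℝ}
    (hax : a ≤ x) (hxy : x ≤ y) : |prim μp μn a y - prim μp μn a x| ≤
      μp.real (Ioc x y) + μn.real (Ioc x y) := by
  rw [prim_sub μp μn hax hxy]
  have h3 : 0 ≤ μp.real (Ioc x y) := measureReal_nonneg
  have h4 : 0 ≤ μn.real (Ioc x y) := measureReal_nonneg
  rw [abs_le]
  constructor <;> linarith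

lemma exists_recovery {D : Set ℝ} {e u : ℝ → ℝ} {c : ℝ} (hψ : PsiHyp ψ) (hab : a < b)
    (hv : ∀ᵐ x ∂(volume.restrict (Ioo a b)), x ∈ D ∧ e x = Psi1 ψ (uaD μp μn x))
    (hp : ∀ᵐ x ∂(μp.singularPart volume), x ∈ D ∧ e x = ∫ s, ψ s)
    (hn : ∀ᵐ x ∂(μn.singularPart volume), x ∈ D ∧ e x = 0) (hV : eVariationOn e D ≠ ⊤)
    (hu : IsPrim a b u μp μn c) (N : ℕ) {η : ℝ} (hη : 0 < η) :
    ∃ U : ℝ → ℝ, IntegrableOn U (Ioo a b) ∧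
      ∫ x in Ioo a b, |U x - u x| ≤ (b - a) * ((N + 1) * η) +
        2 * ((b - a) / (N + 1)) * (μp.real univ + μn.real univ) ∧
      Fp ψ 1 a b U ≤ ENNReal.ofReal
        (μp.real univ + μn.real univ + (N + 1) * η + (eVariationOn e D).toReal) := by
  set h := (b - a) / (N + 1) with hh
  have hN : (0 : ℝ) < N + 1 := by positivity
  have hh0 : 0 < h := div_pos (by linarith) hN
  have hhN : (N + 1) * h = b - a := by rw [hh]; field_simp
  set X : ℕ → ℝ := fun i => a + i * h with hXdef
  have hX : StrictMono X := fun i j hij => by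
    have : (i : ℝ) < j := by exact_mod_cast hij
    simp only [hXdef]; nlinarith
  have hX0 : X 0 = a := by simp [hXdef]
  have hXN : X (N + 1) = b := by
    simp only [hXdef]; push_cast; linarith
  have hXs : ∀ i, X (i + 1) - X i = h := fun i => by simp only [hXdef]; push_cast; ring
  have haX : ∀ i, a ≤ X i := fun i => hX0 ▸ hX.monotone (Nat.zero_le i)
  have hXX : ∀ i, X i ≤ X (i + 1) := fun i => (hX (Nat.lt_succ_self i)).le
  set s : ℕ → ℝ := fun i => (prim μp μn a (X (min i N + 1)) - prim μp μn a (X (min i N))) / h with hs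
  have hsi : ∀ i ≤ N, s i = (prim μp μn a (X (i + 1)) - prim μp μn a (X i)) / h := fun i hi => by
    simp only [hs, min_eq_left hi]
  have hsN : s (N + 1) = s N := by simp [hs]
  have hsh : ∀ i ≤ N, s i * h = prim μp μn a (X (i + 1)) - prim μp μn a (X i) := fun i hi => by
    rw [hsi i hi, div_mul_cancel₀ _ hh0.ne']
  obtain ⟨w, hw, hblock⟩ := exists_interpolation hψ a hh0 hη s (N + 1)
  set v : ℝ → ℝ := fun x => s 0 + ∫ y in a..x, w y with hvdef
  have hvc : Continuous v := continuous_const.add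
    (intervalIntegral.continuous_primitive (fun _ _ => hw.intervalIntegrable) a)
  have hvi : ∀ x y, IntervalIntegrable v volume x y := fun x y => hvc.intervalIntegrable x y
  set l : ℕ → ℝ := fun i => μp.real (Ioc (X i) (X (i + 1))) + μn.real (Ioc (X i) (X (i + 1))) with hl
  have hl0 : ∀ i, 0 ≤ l i := fun i => add_nonneg measureReal_nonneg measureReal_nonneg
  have hlsum : ∑ i ∈ Finset.range (N + 1), l i ≤ μp.real univ + μn.real univ := by
    rw [Finset.sum_add_distrib]
    exact add_le_add (measureReal_Ioc_block_sum μp hX hX0 _) (measureReal_Ioc_block_sum μn hX hX0 _)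
  have hclose : ∀ i ≤ N, ∫ x in X i..X (i + 1), |v x - s i| ≤ η := fun i hi =>
    (hblock i (by omega)).1
  have habsv : ∀ i ≤ N, ∫ x in X i..X (i + 1), |v x| ≤ η + l i := by
    intro i hi
    have h1 : ∫ x in X i..X (i + 1), |v x| ≤ ∫ x in X i..X (i + 1), (|v x - s i| + |s i|) := by
      refine intervalIntegral.integral_mono_on (hXX i) (hvc.abs.intervalIntegrable _ _)
        (((hvc.sub continuous_const).abs.add continuous_const).intervalIntegrable _ _) fun x _ => ?_
      have := abs_add_le (v x - s i) (s i)
      rwa [sub_add_cancel] at this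
    rw [intervalIntegral.integral_add (f := fun x => |v x - s i|)
      ((hvc.sub continuous_const).abs.intervalIntegrable _ _)
      (continuous_const.intervalIntegrable _ _), intervalIntegral.integral_const, hXs, smul_eq_mul]
      at h1
    have h2 : h * |s i| = |prim μp μn a (X (i + 1)) - prim μp μn a (X i)| := by
      rw [← hsh i hi, abs_mul, abs_of_pos hh0, mul_comm]
    have h3 := abs_prim_sub_le μp μn (haX i) (hXX i)
    linarith [hclose i hi]
  have hstep : ∀ i ≤ N, |(∫ x in X i..X (i + 1), v x) - (prim μp μn a (X (i + 1)) - prim μp μn a (X i))|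
      ≤ η := by
    intro i hi
    have h1 : (∫ x in X i..X (i + 1), v x) - (prim μp μn a (X (i + 1)) - prim μp μn a (X i)) =
        ∫ x in X i..X (i + 1), (v x - s i) := by
      rw [intervalIntegral.integral_sub (hvi _ _) (continuous_const.intervalIntegrable _ _),
        intervalIntegral.integral_const, hXs, smul_eq_mul, mul_comm, hsh i hi]
    rw [h1]
    exact (intervalIntegral.abs_integral_le_integral_abs (hXX i)).trans (hclose i hi)
  have hnode : ∀ i ≤ N + 1, |(∫ x in a..X i, v x) - prim μp μn a (X i)| ≤ i * η := by
    intro i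
    induction i with
    | zero => intro _; rw [hX0]; simp [prim]
    | succ i ih =>
      intro hi
      have h1 := ih (by omega)
      have h2 := hstep i (by omega)
      rw [← intervalIntegral.integral_add_adjacent_intervals (hvi a (X i)) (hvi (X i) (X (i + 1)))]
      have h3 := abs_add_le ((∫ x in a..X i, v x) - prim μp μn a (X i))
        ((∫ x in X i..X (i + 1), v x) - (prim μp μn a (X (i + 1)) - prim μp μn a (X i)))
      push_cast
      refine (le_of_eq ?_).trans (h3.trans (by linarith))
      congr 1; ring
  have hpt : ∀ i ≤ N, ∀ x ∈ Icc (X i) (X (i + 1)), |(∫ y in a..x, v y) - prim μp μn a x| ≤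
      (N + 1) * η + 2 * l i := by
    intro i hi x hx
    have h1 := hnode i (by omega)
    have h2 := habsv i hi
    have h3 : |∫ y in X i..x, v y| ≤ ∫ y in X i..X (i + 1), |v y| := by
      refine (intervalIntegral.abs_integral_le_integral_abs hx.1).trans ?_
      exact intervalIntegral.integral_mono_interval le_rfl hx.1 hx.2
        (ae_of_all _ fun _ => abs_nonneg _) (hvc.abs.intervalIntegrable _ _)
    have h4 : |prim μp μn a x - prim μp μn a (X i)| ≤ l i :=
      (abs_prim_sub_le μp μn (haX i) hx.1).trans (add_le_add
        (measureReal_mono (Ioc_subset_Ioc_right hx.2)) (measureReal_mono (Ioc_subset_Ioc_right hx.2)))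
    have h5 : ((i : ℝ) + 1) * η ≤ (N + 1) * η := by
      have : (i : ℝ) ≤ N := by exact_mod_cast hi
      gcongr
    rw [← intervalIntegral.integral_add_adjacent_intervals (hvi a (X i)) (hvi (X i) x)]
    rw [abs_le] at h1 h3 h4 ⊢
    constructor <;> linarith [h1.1, h1.2, h3.1, h3.2, h4.1, h4.2]
  set U : ℝ → ℝ := fun x => c + ∫ y in a..x, v y with hU
  have hUd : ∀ x, HasDerivAt U (v x) x := fun x =>
    (intervalIntegral.integral_hasDerivAt_right (hvi a x)
      (hvc.stronglyMeasurableAtFilter _ _) hvc.continuousAt).const_add c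
  have hUc : Continuous U := continuous_iff_continuousAt.2 fun x => (hUd x).continuousAt
  have hci : ∀ {f : ℝ → ℝ}, Continuous f → IntegrableOn f (Ioo a b) := fun hf =>
    (hf.integrableOn_Icc).mono_set Ioo_subset_Icc_self
  have hIoo : ∀ f : ℝ → ℝ, ∫ x in Ioo a b, f x = ∫ x in a..b, f x := fun f => by
    rw [intervalIntegral.integral_of_le hab.le, integral_Ioc_eq_integral_Ioo]
  have hsplit : ∀ f : ℝ → ℝ, IntegrableOn f (Ioo a b) →
      ∫ x in Ioo a b, f x = ∑ i ∈ Finset.range (N + 1), ∫ x in X i..X (i + 1), f x := by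
    intro f hf
    rw [hIoo, intervalIntegral.sum_integral_adjacent_intervals, hX0, hXN]
    intro i hi
    rw [intervalIntegrable_iff_integrableOn_Ioo_of_le (hXX i)]
    exact hf.mono_set (Ioo_subset_Ioo (haX i) (hXN ▸ hX.monotone hi))
  have hwψ : IntegrableOn (fun x => ψ (v x) * |w x|) (Ioo a b) :=
    PsiHyp.integrableOn_comp_mul hψ hvc.aestronglyMeasurable hw.integrableOn
  refine ⟨U, hci hUc, ?_, ?_⟩
  · have h1 : ∫ x in Ioo a b, |U x - u x| = ∫ x in Ioo a b, |(∫ y in a..x, v y) - prim μp μn a x| := by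
      refine integral_congr_ae (hu.mono fun x hx => ?_)
      simp only [hx, hU]
      congr 1; ring
    have h2 : IntegrableOn (fun x => |(∫ y in a..x, v y) - prim μp μn a x|) (Ioo a b) :=
      ((hci (intervalIntegral.continuous_primitive hvi a)).sub
        (prim_integrableOn μp μn a a b)).abs
    rw [h1, hsplit _ h2]
    have h3 : ∀ i ∈ Finset.range (N + 1),
        ∫ x in X i..X (i + 1), |(∫ y in a..x, v y) - prim μp μn a x| ≤
          h * ((N + 1) * η) + 2 * h * l i := by
      intro i hi
      have hi' : i ≤ N := Nat.lt_succ_iff.1 (Finset.mem_range.1 hi)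
      have hii : IntervalIntegrable (fun x => |(∫ y in a..x, v y) - prim μp μn a x|) volume
          (X i) (X (i + 1)) := by
        rw [intervalIntegrable_iff_integrableOn_Ioo_of_le (hXX i)]
        exact h2.mono_set (Ioo_subset_Ioo (haX i) (hXN ▸ hX.monotone (by omega)))
      have := intervalIntegral.integral_mono_on (hXX i) hii
        (intervalIntegrable_const (c := (N + 1) * η + 2 * l i)) (hpt i hi')
      rw [intervalIntegral.integral_const, hXs, smul_eq_mul] at this
      linarith
    refine (Finset.sum_le_sum h3).trans ?_
    rw [Finset.sum_add_distrib, Finset.sum_const, Finset.card_range, nsmul_eq_mul, ← Finset.mul_sum,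
      ← mul_assoc, Nat.cast_succ, hhN]
    gcongr
  · have hrep : W2pRep 1 a b U v w := by
      refine ⟨fun x _ => hUd x, fun x _ y _ => ?_, hci hUc, hci hvc, hw.integrableOn, ?_⟩
      · simp only [hvdef]
        rw [add_sub_add_left_eq_sub, intervalIntegral.integral_interval_sub_left
          hw.intervalIntegrable hw.intervalIntegrable]
      · simp only [Real.rpow_one]
        exact hw.integrableOn.abs
    unfold Fp
    refine ((iInf_le _ v).trans ((iInf_le _ w).trans (iInf_le _ hrep))).trans (ENNReal.ofReal_le_ofReal ?_)
    simp only [Real.rpow_one]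
    refine add_le_add ?_ ?_
    · rw [hsplit _ (hci hvc.abs)]
      refine (Finset.sum_le_sum fun i hi => habsv i (Nat.lt_succ_iff.1 (Finset.mem_range.1 hi))).trans ?_
      rw [Finset.sum_add_distrib, Finset.sum_const, Finset.card_range, nsmul_eq_mul, Nat.cast_succ]
      linarith
    · rw [hsplit _ hwψ]
      refine (Finset.sum_le_sum fun i hi => (hblock i (Finset.mem_range.1 hi)).2).trans ?_
      rw [Finset.sum_range_succ, hsN, sub_self, abs_zero, add_zero]
      exact sum_abs_Psi1_slope_le hψ hv hp hn hV hX hX0.ge hXN.le fun i hi => by rw [hsi i hi, hXs]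

/-- The upper bound for the relaxed functional. -/
lemma FpRel_le_add_eVariationOn {D : Set ℝ} {e u : ℝ → ℝ} {c : ℝ} (hψ : PsiHyp ψ) (hab : a < b)
    (hui : IntegrableOn u (Ioo a b))
    (hv : ∀ᵐ x ∂(volume.restrict (Ioo a b)), x ∈ D ∧ e x = Psi1 ψ (uaD μp μn x))
    (hp : ∀ᵐ x ∂(μp.singularPart volume), x ∈ D ∧ e x = ∫ s, ψ s)
    (hn : ∀ᵐ x ∂(μn.singularPart volume), x ∈ D ∧ e x = 0)
    (hu : IsPrim a b u μp μn c) (hμp : μp (Ioo a b)ᶜ = 0) (hμn : μn (Ioo a b)ᶜ = 0) :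
    FpRel ψ 1 a b u ≤ (μp + μn) (Ioo a b) + eVariationOn e D := by
  by_cases hV : eVariationOn e D = ⊤
  · simp [hV]
  have hη : ∀ N : ℕ, (0 : ℝ) < 1 / ((N : ℝ) + 1) ^ 2 := fun N => by positivity
  choose U hUi hU1 hU2 using fun N : ℕ => exists_recovery hψ hab hv hp hn hV hu N (hη N)
  set m := μp.real univ + μn.real univ with hm
  have hlim : Tendsto (fun N : ℕ => 1 / ((N : ℝ) + 1)) atTop (𝓝 0) :=
    tendsto_one_div_add_atTop_nhds_zero_nat
  have hsimp : ∀ N : ℕ, ((N : ℝ) + 1) * (1 / ((N : ℝ) + 1) ^ 2) = 1 / ((N : ℝ) + 1) := fun N => by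
    field_simp
  have hL : TendstoL1 a b U u := by
    refine ⟨hUi, hui, ?_⟩
    have h0 : Tendsto (fun N : ℕ => ((b - a) + 2 * (b - a) * m) * (1 / ((N : ℝ) + 1))) atTop (𝓝 0) := by
      simpa using hlim.const_mul ((b - a) + 2 * (b - a) * m)
    refine squeeze_zero (fun N => integral_nonneg fun _ => abs_nonneg _) (fun N => ?_) h0
    refine (hU1 N).trans (le_of_eq ?_)
    rw [hsimp]; ring
  refine (iInf_le_of_le U (iInf_le _ hL)).trans ?_
  have hmass : (μp + μn) (Ioo a b) = ENNReal.ofReal m := by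
    have h1 : ∀ μ : Measure ℝ, IsFiniteMeasure μ → μ (Ioo a b)ᶜ = 0 →
        μ (Ioo a b) = ENNReal.ofReal (μ.real univ) := by
      intro μ hf h
      rw [measureReal_def, ENNReal.ofReal_toReal (measure_ne_top _ _)]
      refine le_antisymm (measure_mono (subset_univ _)) ?_
      rw [← union_compl_self (Ioo a b)]
      exact (measure_union_le _ _).trans (by rw [h, add_zero])
    rw [Measure.add_apply, h1 μp inferInstance hμp, h1 μn inferInstance hμn,
      ← ENNReal.ofReal_add measureReal_nonneg measureReal_nonneg]
  have hfin : (μp + μn) (Ioo a b) + eVariationOn e D =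
      ENNReal.ofReal (m + 0 + (eVariationOn e D).toReal) := by
    have hm0 : 0 ≤ m := add_nonneg measureReal_nonneg measureReal_nonneg
    rw [hmass, add_zero, ENNReal.ofReal_add hm0 ENNReal.toReal_nonneg, ENNReal.ofReal_toReal hV]
  rw [hfin]
  have hT : Tendsto (fun N : ℕ => ENNReal.ofReal (m + 1 / ((N : ℝ) + 1) + (eVariationOn e D).toReal))
      atTop (𝓝 (ENNReal.ofReal (m + 0 + (eVariationOn e D).toReal))) :=
    ENNReal.tendsto_ofReal ((hlim.const_add m).add_const _)
  rw [← hT.liminf_eq]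
  refine liminf_le_liminf (Eventually.of_forall fun N => ?_)
  have := hU2 N
  rwa [hsimp] at this

end Recovery

lemma nhdsWithin_inter_Ioi_neBot {p q x : ℝ} {s : Set ℝ} (hd : Ioo p q ⊆ closure s)
    (hx : x ∈ Ioo p q) : (𝓝[s ∩ Ioi x] x).NeBot := by
  rw [← mem_closure_iff_nhdsWithin_neBot, mem_closure_iff]
  intro o ho hxo
  obtain ⟨z, hz1, hz2⟩ := (inter_mem (mem_nhdsWithin_of_mem_nhds (ho.mem_nhds hxo))
    (Ioo_mem_nhdsGT hx.2) |> (inferInstance : (𝓝[>] x).NeBot).nonempty_of_mem)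
  obtain ⟨w, hw1, hw2⟩ := mem_closure_iff.1 (hd ⟨hx.1.trans hz2.1, hz2.2⟩) (o ∩ Ioi x)
    (ho.inter isOpen_Ioi) ⟨hz1, hz2.1⟩
  exact ⟨w, hw1.1, hw2, hw1.2⟩

lemma nhdsWithin_inter_Iio_neBot {p q x : ℝ} {s : Set ℝ} (hd : Ioo p q ⊆ closure s)
    (hx : x ∈ Ioo p q) : (𝓝[s ∩ Iio x] x).NeBot := by
  rw [← mem_closure_iff_nhdsWithin_neBot, mem_closure_iff]
  intro o ho hxo
  obtain ⟨z, hz1, hz2⟩ := (inter_mem (mem_nhdsWithin_of_mem_nhds (ho.mem_nhds hxo))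
    (Ioo_mem_nhdsLT hx.1) |> (inferInstance : (𝓝[<] x).NeBot).nonempty_of_mem)
  obtain ⟨w, hw1, hw2⟩ := mem_closure_iff.1 (hd ⟨hz2.1, hz2.2.trans hx.2⟩) (o ∩ Iio x)
    (ho.inter isOpen_Iio) ⟨hz1, hz2.2⟩
  exact ⟨w, hw1.1, hw2, hw1.2⟩

/-- A measure of mass at most the variation of `f` which dominates the total variation of a
primitive agreeing with `f` on a dense set, and charges the deviation of `f` from it. -/
lemma exists_measure_ge_of_eVariationOn {a p q c : ℝ} {f : ℝ → ℝ} {s D : Set ℝ} (μp μn : Measure ℝ)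
    [IsFiniteMeasure μp] [IsFiniteMeasure μn] (hsing : μp ⟂ₘ μn) (hap : a ≤ p)
    (hsD : s ⊆ D) (hd : Ioo p q ⊆ closure s) (hf : ∀ x ∈ s, f x = c + prim μp μn a x)
    (hV : eVariationOn f D ≠ ⊤) :
    ∃ τ : Measure ℝ, τ (Ioo p q) ≤ eVariationOn f D ∧
      (∀ J ⊆ Ioo p q, MeasurableSet J → (μp + μn) J ≤ τ J) ∧
      ∀ x ∈ D ∩ Ioo p q, ENNReal.ofReal
        (|f x - (c + primL μp μn a x)| + |c + prim μp μn a x - f x|) ≤ τ {x} := by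
  obtain ⟨T, hT, hT0, hTV, hTf⟩ := exists_monotone_of_eVariationOn hV
  have hST : ∀ x, T x ≤ hT.stieltjesFunction x := fun x => by
    rw [Monotone.stieltjesFunction_eq]; exact hT.le_rightLim le_rfl
  have hSV : ∀ x, hT.stieltjesFunction x ≤ (eVariationOn f D).toReal := fun x => by
    rw [Monotone.stieltjesFunction_eq]
    exact (hT.rightLim_le (lt_add_one x)).trans (hTV _)
  have hτT : ∀ x, Tendsto T (𝓝[s ∩ Ioi x] x) (𝓝 (hT.stieltjesFunction x)) := by
    intro x
    rw [Monotone.stieltjesFunction_eq]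
    exact (hT.tendsto_rightLim x).mono_left (nhdsWithin_mono _ inter_subset_right)
  have hF : ∀ x ∈ Ioo p q, Tendsto f (𝓝[s ∩ Ioi x] x) (𝓝 (c + prim μp μn a x)) := by
    intro x hx
    have := ((tendsto_prim_nhdsGT μp μn (hap.trans hx.1.le)).mono_left
      (nhdsWithin_mono x (inter_subset_right (s := s)))).const_add c
    refine this.congr' ?_
    filter_upwards [self_mem_nhdsWithin] with z hz
    rw [hf z hz.1]
  have hFL : ∀ x ∈ Ioo p q, Tendsto f (𝓝[s ∩ Iio x] x) (𝓝 (c + primL μp μn a x)) := by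
    intro x hx
    have := ((tendsto_prim_nhdsLT μp μn (hap.trans_lt hx.1)).mono_left
      (nhdsWithin_mono x (inter_subset_right (s := s)))).const_add c
    refine this.congr' ?_
    filter_upwards [self_mem_nhdsWithin] with z hz
    rw [hf z hz.1]
  have key : ∀ x ∈ Ioo p q, ∀ y ∈ Ioo p q, x < y →
      |prim μp μn a y - prim μp μn a x| ≤ hT.stieltjesFunction y - hT.stieltjesFunction x := by
    intro x hx y hy hxy
    have h1 : ∀ x' ∈ s, x' < y → |(c + prim μp μn a y) - f x'| ≤ hT.stieltjesFunction y - T x' := by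
      intro x' hx' hxy'
      have := nhdsWithin_inter_Ioi_neBot hd hy
      refine le_of_tendsto_of_tendsto ((hF y hy).sub_const (f x')).abs
        ((hτT y).sub_const (T x')) ?_
      filter_upwards [self_mem_nhdsWithin] with z hz
      exact hTf x' (hsD hx') z (hsD hz.1) (hxy'.le.trans (le_of_lt hz.2))
    have h2 : |(c + prim μp μn a y) - (c + prim μp μn a x)| ≤
        hT.stieltjesFunction y - hT.stieltjesFunction x := by
      have := nhdsWithin_inter_Ioi_neBot hd hx
      refine le_of_tendsto_of_tendsto ((hF x hx).const_sub (c + prim μp μn a y)).abs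
        ((hτT x).const_sub (hT.stieltjesFunction y)) ?_
      filter_upwards [self_mem_nhdsWithin,
        (Iio_mem_nhds hxy : Iio y ∈ 𝓝 x) |> mem_nhdsWithin_of_mem_nhds] with z hz hz2
      exact h1 z hz.1 hz2
    simpa using h2
  have hIoc : ∀ x y, x < y → x ∈ Ioo p q → y ∈ Ioo p q →
      μp (Ioc x y) ≤ hT.stieltjesFunction.measure (Ioc x y) + μn (Ioc x y) ∧
      μn (Ioc x y) ≤ hT.stieltjesFunction.measure (Ioc x y) + μp (Ioc x y) := by
    intro x y hxy hx hy
    have h1 := key x hx y hy hxy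
    rw [prim_sub μp μn (hap.trans hx.1.le) hxy.le, abs_le] at h1
    have h0 : 0 ≤ hT.stieltjesFunction y - hT.stieltjesFunction x :=
      sub_nonneg.2 (hT.stieltjesFunction.mono hxy.le)
    rw [StieltjesFunction.measure_Ioc]
    constructor
    · rw [← ofReal_measureReal (μ := μp), ← ofReal_measureReal (μ := μn),
        ← ENNReal.ofReal_add h0 measureReal_nonneg]
      exact ENNReal.ofReal_le_ofReal (by linarith)
    · rw [← ofReal_measureReal (μ := μp), ← ofReal_measureReal (μ := μn),
        ← ENNReal.ofReal_add h0 measureReal_nonneg]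
      exact ENNReal.ofReal_le_ofReal (by linarith)
  have main : ∀ p' q', p < p' → q' < q → ∀ K ⊆ Ioc p' q',
      (μp + μn) K ≤ hT.stieltjesFunction.measure K := by
    intro p' q' hp hq K hK
    set J := Ioc p' q' with hJ
    set τ := hT.stieltjesFunction.measure.restrict J with hτ
    have : IsFiniteMeasure τ := isFiniteMeasure_restrict.2 (by
      rw [StieltjesFunction.measure_Ioc]; exact ENNReal.ofReal_ne_top)
    have hJoin : ∀ x y, Ioc x y ∩ J = Ioc (max x p') (min y q') := fun x y => by
      rw [hJ, Ioc_inter_Ioc]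
    have hboth : ∀ x y,
        (μp.restrict J) (Ioc x y) ≤ (τ + μn.restrict J) (Ioc x y) ∧
        (μn.restrict J) (Ioc x y) ≤ (τ + μp.restrict J) (Ioc x y) := by
      intro x y
      simp only [Measure.add_apply, hτ, Measure.restrict_apply measurableSet_Ioc, hJoin]
      rcases lt_or_ge (max x p') (min y q') with h | h
      · refine hIoc _ _ h ⟨hp.trans_le (le_max_right _ _), ?_⟩ ⟨?_, ?_⟩
        · exact h.trans_le (min_le_right _ _) |>.trans hq
        · exact (hp.trans_le (le_max_right _ _)).trans h
        · exact (min_le_right _ _).trans_lt hq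
      · simp [Ioc_eq_empty (not_lt.2 h)]
    have := Measure.add_apply_le_of_le_add (τ := τ)
      (hsing.mono_ac Measure.absolutelyContinuous_restrict Measure.absolutelyContinuous_restrict)
      (Measure.le_of_Ioc fun x y _ => (hboth x y).1) (Measure.le_of_Ioc fun x y _ => (hboth x y).2)
      K
    rw [Measure.add_apply, Measure.restrict_apply' measurableSet_Ioc,
      Measure.restrict_apply' measurableSet_Ioc, hτ, Measure.restrict_apply' measurableSet_Ioc,
      inter_eq_left.2 hK] at this
    exact this
  refine ⟨hT.stieltjesFunction.measure, ?_, fun J hJI hJ => ?_, fun x hx => ?_⟩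
  · rw [StieltjesFunction.measure_Ioo]
    refine ENNReal.ofReal_le_of_le_toReal ?_
    have h1 := (hT.stieltjesFunction.mono.leftLim_le (le_refl q)).trans (hSV q)
    have h2 := (hT0 p).trans (hST p)
    linarith
  · rw [hJ.measure_eq_iSup_isCompact]
    refine iSup_le fun K => iSup_le fun hK => iSup_le fun hKc => ?_
    rcases K.eq_empty_or_nonempty with rfl | hKn
    · simp
    obtain ⟨p', hp1, hp2⟩ := exists_between (hJI (hK (hKc.sInf_mem hKn))).1
    obtain ⟨q', hq1, hq2⟩ := exists_between (hJI (hK (hKc.sSup_mem hKn))).2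
    exact (main p' q' hp1 hq2 K fun z hz => ⟨hp2.trans_le (csInf_le hKc.bddBelow hz),
      (le_csSup hKc.bddAbove hz).trans hq1.le⟩).trans (measure_mono hK)
  · rw [StieltjesFunction.measure_singleton]
    refine ENNReal.ofReal_le_ofReal ?_
    have h1 : |c + prim μp μn a x - f x| ≤ hT.stieltjesFunction x - T x := by
      have := nhdsWithin_inter_Ioi_neBot hd hx.2
      refine le_of_tendsto_of_tendsto ((hF x hx.2).sub_const (f x)).abs
        ((hτT x).sub_const (T x)) ?_
      filter_upwards [self_mem_nhdsWithin] with z hz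
      exact hTf x hx.1 z (hsD hz.1) (le_of_lt hz.2)
    have h2 : |f x - (c + primL μp μn a x)| ≤ T x - Function.leftLim T x := by
      have := nhdsWithin_inter_Iio_neBot hd hx.2
      refine le_of_tendsto_of_tendsto ((hFL x hx.2).const_sub (f x)).abs
        (((hT.tendsto_leftLim x).mono_left
          (nhdsWithin_mono x (inter_subset_right (s := s)))).const_sub (T x)) ?_
      filter_upwards [self_mem_nhdsWithin] with z hz
      exact hTf z (hsD hz.1) x hx.1 (le_of_lt hz.2)
    have h3 : Function.leftLim hT.stieltjesFunction x ≤ Function.leftLim T x := by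
      refine le_of_tendsto (hT.stieltjesFunction.mono.tendsto_leftLim x) ?_
      filter_upwards [self_mem_nhdsWithin] with z hz
      rw [Monotone.stieltjesFunction_eq]
      obtain ⟨z', hz1, hz2⟩ := exists_between (mem_Iio.1 hz)
      exact (hT.rightLim_le hz1).trans (hT.le_leftLim hz2)
    linarith

section Relaxed

variable {a b c : ℝ} {S : Set ℝ} {μp μn : Measure ℝ} [IsFiniteMeasure μp] [IsFiniteMeasure μn]

/-- Lower bound of the variation of a function deviating from a primitive on a countable set. -/
lemma measure_add_tsum_le_eVariationOn {f : ℝ → ℝ} {s D : Set ℝ} (hsing : μp ⟂ₘ μn)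
    (hsD : s ⊆ D) (hd : Ioo a b ⊆ closure s) (hf : ∀ x ∈ s, f x = c + prim μp μn a x)
    (hS : S.Countable) (hSD : S ⊆ D) (hSI : S ⊆ Ioo a b) :
    (μp + μn) (Ioo a b \ S) + ∑' x : S, ENNReal.ofReal
      (|f x - (c + primL μp μn a x)| + |c + prim μp μn a x - f x|) ≤ eVariationOn f D := by
  by_cases hV : eVariationOn f D = ⊤
  · rw [hV]; exact le_top
  obtain ⟨τ, h1, h2, h3⟩ := exists_measure_ge_of_eVariationOn μp μn hsing le_rfl hsD hd hf hV
  refine le_trans ?_ h1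
  have h4 : τ S = ∑' x : S, τ {(x : ℝ)} := by
    rw [← measure_biUnion hS (fun x _ y _ hxy => by simpa using hxy)
      (fun x _ => measurableSet_singleton x), biUnion_of_singleton]
  calc _ ≤ τ (Ioo a b \ S) + τ S := by
        refine add_le_add (h2 _ sdiff_subset (measurableSet_Ioo.diff hS.measurableSet)) ?_
        rw [h4]
        exact ENNReal.tsum_le_tsum fun x => h3 x ⟨hSD x.2, hSI x.2⟩
    _ = τ (Ioo a b) := by
        rw [← measure_union disjoint_sdiff_left hS.measurableSet, sdiff_union_of_subset hSI]

end Relaxed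

section UpperVariation

variable {a b c : ℝ} {S : Set ℝ} {μp μn : Measure ℝ} [IsFiniteMeasure μp] [IsFiniteMeasure μn]

lemma measure_eq_tsum_singleton (τ : Measure ℝ) (hS : S.Countable) :
    τ S = ∑' x : S, τ {(x : ℝ)} := by
  rw [← measure_biUnion hS (fun x _ y _ hxy => by simpa using hxy)
    (fun x _ => measurableSet_singleton x), biUnion_of_singleton]

lemma measureReal_add_singleton (hs : μp ⟂ₘ μn) {x : ℝ} (hx : a < x) :
    (μp + μn).real {x} = |prim μp μn a x - primL μp μn a x| := by
  rw [prim_eq_primL_add μp μn hx, add_sub_cancel_left, measureReal_add_apply]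
  rcases hs.measureReal_singleton x with h | h
  · rw [h, zero_sub, abs_neg, abs_of_nonneg measureReal_nonneg, zero_add]
  · rw [h, sub_zero, abs_of_nonneg measureReal_nonneg, add_zero]

/-- Upper bound of the variation of a function deviating from a primitive on a countable set. -/
lemma eVariationOn_le_measure_add_tsum {f : ℝ → ℝ} {D : Set ℝ} (hsing : μp ⟂ₘ μn)
    (hDI : D ⊆ Ioo a b) (hf : ∀ x ∈ D, x ∉ S → f x = c + prim μp μn a x)
    (hS : S.Countable) (hSI : S ⊆ Ioo a b) :
    eVariationOn f D ≤ (μp + μn) (Ioo a b \ S) + ∑' x : S, ENNReal.ofReal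
      (|f x - (c + primL μp μn a x)| + |c + prim μp μn a x - f x|) := by
  set φ : ℝ → ℝ := fun x => |f x - (c + primL μp μn a x)| + |c + prim μp μn a x - f x| with hφ
  by_cases hT : ∑' x : S, ENNReal.ofReal (φ x) = ⊤
  · rw [hT, add_top]; exact le_top
  classical
  set κ : Measure ℝ := Measure.sum fun x : S => ENNReal.ofReal (φ x) • Measure.dirac (x : ℝ) with hκ
  set τ : Measure ℝ := (μp + μn).restrict (Ioo a b \ S) + κ with hτ
  have hSm : MeasurableSet S := hS.measurableSet
  have hτu : τ univ = (μp + μn) (Ioo a b \ S) + ∑' x : S, ENNReal.ofReal (φ x) := by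
    rw [hτ, Measure.add_apply, Measure.restrict_apply_univ, hκ, Measure.sum_apply _ MeasurableSet.univ]
    simp
  have hτfin : IsFiniteMeasure τ := ⟨by
    rw [hτu]; exact ENNReal.add_lt_top.2 ⟨measure_lt_top _ _, lt_top_iff_ne_top.2 hT⟩⟩
  have hκx : ∀ x, κ {x} = if x ∈ S then ENNReal.ofReal (φ x) else 0 := by
    intro x
    rw [hκ, Measure.sum_apply _ (measurableSet_singleton x)]
    split_ifs with hx
    · rw [tsum_eq_single ⟨x, hx⟩]
      · simp
      · intro y hy
        have : (y : ℝ) ≠ x := fun h => hy (Subtype.ext h)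
        simp [this]
    · refine ENNReal.tsum_eq_zero.2 fun y => ?_
      have : (y : ℝ) ≠ x := fun h => hx (h ▸ y.2)
      simp [this]
  have hφν : ∀ x ∈ Ioo a b, (μp + μn).real {x} ≤ φ x := by
    intro x hx
    rw [measureReal_add_singleton hsing hx.1]
    refine (le_of_eq ?_).trans (abs_add_le _ _)
    congr 1; ring
  have hτx : ∀ x ∈ D, τ.real {x} = φ x := by
    intro x hx
    have h0 : 0 ≤ φ x := add_nonneg (abs_nonneg _) (abs_nonneg _)
    rw [measureReal_def, hτ, Measure.add_apply, hκx, Measure.restrict_apply (measurableSet_singleton x)]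
    split_ifs with hxS
    · have : ({x} : Set ℝ) ∩ (Ioo a b \ S) = ∅ := by
        rw [← disjoint_iff_inter_eq_empty, disjoint_singleton_left]
        exact fun h => h.2 hxS
      rw [this, measure_empty, zero_add, ENNReal.toReal_ofReal h0]
    · have : ({x} : Set ℝ) ∩ (Ioo a b \ S) = {x} :=
        inter_eq_left.2 (singleton_subset_iff.2 ⟨hDI hx, hxS⟩)
      rw [this, add_zero, ← measureReal_def, measureReal_add_singleton hsing (hDI hx).1, hφ]
      simp only [hf x hx hxS, sub_self, abs_zero, add_zero]
      congr 1; ring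
  have hντ : ∀ J ⊆ Ioo a b, (μp + μn) J ≤ τ J := by
    intro J hJ
    have h1 : (μp + μn) (J ∩ S) ≤ κ (J ∩ S) := by
      have hc : (J ∩ S).Countable := hS.mono inter_subset_right
      rw [measure_eq_tsum_singleton _ hc, measure_eq_tsum_singleton κ hc]
      refine ENNReal.tsum_le_tsum fun x => ?_
      rw [hκx, if_pos x.2.2, ← ofReal_measureReal]
      exact ENNReal.ofReal_le_ofReal (hφν x (hSI x.2.2))
    calc (μp + μn) J ≤ (μp + μn) (J ∩ S) + (μp + μn) (J \ S) := measure_le_inter_add_sdiff _ _ _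
      _ ≤ κ J + (μp + μn).restrict (Ioo a b \ S) J := by
          refine add_le_add (h1.trans (measure_mono inter_subset_left)) ?_
          rw [Measure.restrict_apply' (measurableSet_Ioo.diff hSm)]
          exact measure_mono fun z hz => ⟨hz.1, hJ hz.1, hz.2⟩
      _ = τ J := by rw [hτ, Measure.add_apply, add_comm]
  have hIco : ∀ p q, p ≤ q → τ.real (Iio q) - τ.real (Iio p) = τ.real (Ico p q) := by
    intro p q hpq
    rw [← Iio_union_Ico_eq_Iio hpq, measureReal_union (by
      rw [Set.disjoint_left]; exact fun z hz hz' => absurd hz'.1 (not_le.2 hz)) measurableSet_Ico]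
    ring
  have hle := eVariationOn_le_of_abs_sub_le (f := f) (s := D)
    (G := fun x => τ.real (Iio x) + |f x - (c + primL μp μn a x)|) (C := τ.real univ) ?_ ?_
  · rwa [ofReal_measureReal, hτu] at hle
  · intro x hx y hy hxy
    rcases hxy.eq_or_lt with rfl | hlt
    · simp
    have h1 := hIco x y hlt.le
    have h2 : τ.real (Ico x y) = τ.real {x} + τ.real (Ioo x y) := by
      rw [← Ioo_union_left hlt, union_comm, measureReal_union (by simp) measurableSet_Ioo]
    have h3 := hτx x hx
    have h4 : (μp + μn).real (Ioo x y) ≤ τ.real (Ioo x y) :=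
      ENNReal.toReal_mono (measure_ne_top _ _)
        (hντ _ (Ioo_subset_Ioo (hDI hx).1.le (hDI hy).2.le))
    have h5 := primL_sub_prim μp μn (hDI hx).1.le hlt
    rw [measureReal_add_apply] at h4
    have h6 : 0 ≤ μp.real (Ioo x y) := measureReal_nonneg
    have h7 : 0 ≤ μn.real (Ioo x y) := measureReal_nonneg
    have h8 : |primL μp μn a y - prim μp μn a x| ≤ τ.real (Ioo x y) := by
      rw [h5, abs_le]; constructor <;> linarith
    have h9 : |f y - f x| ≤ |f y - (c + primL μp μn a y)| +
        |primL μp μn a y - prim μp μn a x| + |c + prim μp μn a x - f x| := by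
      refine (le_of_eq ?_).trans (abs_add_three _ _ _)
      congr 1; ring
    simp only [hφ] at h3
    linarith
  · intro x hx y hy hxy
    have h1 := hIco x y hxy
    have h2 : τ.real (Ico x y) + τ.real {y} ≤ τ.real univ := by
      rw [← measureReal_union (by simp) (measurableSet_singleton y)]
      exact measureReal_mono (subset_univ _)
    have h3 := hτx y hy
    have h4 : 0 ≤ |c + prim μp μn a y - f y| := abs_nonneg _
    have h5 : 0 ≤ |f x - (c + primL μp μn a x)| := abs_nonneg _
    simp only [hφ] at h3
    linarith

end UpperVariation

lemma Ioo_subset_closure_of_ae {a b : ℝ} {s : Set ℝ}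
    (hs : ∀ᵐ x ∂(volume.restrict (Ioo a b)), x ∈ s) : Ioo a b ⊆ closure s := by
  intro y hy
  rw [mem_closure_iff]
  intro o ho hyo
  by_contra hne
  rw [not_nonempty_iff_eq_empty] at hne
  have h1 : (volume.restrict (Ioo a b)) (o ∩ Ioo a b) = 0 := by
    refine measure_mono_null (t := {x | x ∉ s}) (fun x hx hxs => ?_) (ae_iff.1 hs)
    exact (hne ▸ (⟨hx.1, hxs⟩ : x ∈ o ∩ s) : x ∈ (∅ : Set ℝ))
  rw [Measure.restrict_eq_self _ inter_subset_right] at h1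
  exact ((ho.inter isOpen_Ioo).measure_pos volume ⟨y, hyo, hy⟩).ne' h1

lemma Psi1E_mem_Icc {ψ : ℝ → ℝ} (hψ : PsiHyp ψ) (t : EReal) :
    Psi1E ψ t ∈ Icc 0 (∫ s, ψ s) := by
  constructor
  · rw [← Psi1E_bot ψ]; exact (Psi1E_strictMono hψ).monotone bot_le
  · rw [← Psi1E_top ψ]; exact (Psi1E_strictMono hψ).monotone le_top

lemma Phi_eq_abs_add_abs {ψ : ℝ → ℝ} (hψ : PsiHyp ψ) (σ : ℝ) (s t : EReal) :
    Phi ψ σ s t = |(if 0 < σ then ∫ r, ψ r else 0) - Psi1E ψ s| +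
      |Psi1E ψ t - (if 0 < σ then ∫ r, ψ r else 0)| := by
  have hs := Psi1E_mem_Icc hψ s
  have ht := Psi1E_mem_Icc hψ t
  unfold Phi
  split_ifs
  · rw [abs_of_nonneg (sub_nonneg.2 hs.2), abs_of_nonpos (sub_nonpos.2 ht.2), neg_sub]
  · rw [zero_sub, sub_zero, abs_neg, abs_of_nonneg hs.1, abs_of_nonneg ht.1]

section Relaxation

variable {ψ u : ℝ → ℝ} {a b c d : ℝ} {μp μn νp νn : Measure ℝ}

lemma Phi_approxLimE_eq [IsFiniteMeasure μp] [IsFiniteMeasure μn] [IsFiniteMeasure νp]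
    [IsFiniteMeasure νn] {x : ℝ} (hψ : PsiHyp ψ) (hui : IntegrableOn u (Ioo a b))
    (hu : IsPrim a b u μp μn c) (hv : IsPrim a b (fun x => Psi1 ψ (uaD μp μn x)) νp νn d)
    (hμ : μp ⟂ₘ μn) (hx : x ∈ Ioo a b) :
    Phi ψ (jumpSign u x) (leftApproxLimE (uaD μp μn) x) (rightApproxLimE (uaD μp μn) x) =
      |(if 0 < μp.real {x} then ∫ r, ψ r else 0) - (d + primL νp νn a x)| +
      |d + prim νp νn a x - (if 0 < μp.real {x} then ∫ r, ψ r else 0)| := by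
  have hw : IntegrableOn (uaD μp μn) (Ioo a b) := (uaD_integrable μp μn).integrableOn
  rw [Phi_eq_abs_add_abs hψ, Psi1E_leftApproxLimE hψ hx hw hv, Psi1E_rightApproxLimE hψ hx hw hv]
  simp only [jumpSign_pos_iff hx hui hu hμ]

lemma singularPart_singleton_ne_zero {μ : Measure ℝ} [IsFiniteMeasure μ] {x : ℝ}
    (hx : 0 < μ.real {x}) : μ.singularPart volume {x} ≠ 0 := by
  intro h
  have h1 : μ {x} = 0 := by
    rw [μ.haveLebesgueDecomposition_add volume, Measure.add_apply, h, zero_add]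
    exact withDensity_absolutelyContinuous _ _ (measure_singleton x)
  rw [measureReal_def, h1] at hx
  exact lt_irrefl _ hx

lemma mem_of_ae_singularPart {μ : Measure ℝ} [IsFiniteMeasure μ] {x : ℝ} {p : ℝ → Prop}
    (hx : 0 < μ.real {x}) (h : ∀ᵐ y ∂(μ.singularPart volume), p y) : p x := by
  by_contra hp
  exact singularPart_singleton_ne_zero hx
    (measure_mono_null (singleton_subset_iff.2 hp) (ae_iff.1 h))

lemma measure_add_tsum_le_FpRel [IsFiniteMeasure μp] [IsFiniteMeasure μn] [IsFiniteMeasure νp]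
    [IsFiniteMeasure νn] (hψ : PsiHyp ψ) (hui : IntegrableOn u (Ioo a b))
    (hu : IsPrim a b u μp μn c) (hv : IsPrim a b (fun x => Psi1 ψ (uaD μp μn x)) νp νn d)
    (hμ : μp ⟂ₘ μn) (hν : νp ⟂ₘ νn) (hp : μp (Ioo a b)ᶜ = 0) (hn : μn (Ioo a b)ᶜ = 0) :
    (μp + μn) (Ioo a b) + ((νp + νn) (Ioo a b \ jumpSet a b u) +
      ∑' x : jumpSet a b u, ENNReal.ofReal
        (|(if 0 < μp.real {(x : ℝ)} then ∫ r, ψ r else 0) - (d + primL νp νn a x)| +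
          |d + prim νp νn a x - (if 0 < μp.real {(x : ℝ)} then ∫ r, ψ r else 0)|)) ≤
      FpRel ψ 1 a b u := by
  refine le_of_forall_gt_imp_ge_of_dense fun B hB => ?_
  obtain ⟨G, hGI, hG, -, hGB⟩ := exists_eVariationOn_slope_le hψ hB
  refine le_trans (add_le_add ?_ ?_) (hGB μp μn c hu)
  · have h := measure_add_tsum_le_eVariationOn (S := ∅) (s := {x ∈ G | u x = c + prim μp μn a x})
      hμ (sep_subset G _) (Ioo_subset_closure_of_ae (hG.and hu)) (fun x hx => hx.2)
      countable_empty (empty_subset G) (empty_subset _)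
    simpa using h
  · have hmem : ∀ x ∈ jumpSet a b u, x ∈ slopeSet ψ a b μp μn ∧
        slopeVal ψ μp μn x = if 0 < μp.real {x} then ∫ r, ψ r else 0 := by
      intro x hx
      obtain ⟨-, hx⟩ := (mem_jumpSet_iff hui hu hμ).1 hx
      split_ifs with hpos
      · exact mem_of_ae_singularPart hpos (ae_singularPart_slope_pos hψ hμ hp)
      · exact mem_of_ae_singularPart (hx.resolve_left hpos) (ae_singularPart_slope_neg hψ hμ hn)
    have hd : ∀ᵐ x ∂(volume.restrict (Ioo a b)), x ∈ slopeSet ψ a b μp μn ∧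
        slopeVal ψ μp μn x = d + prim νp νn a x := by
      filter_upwards [ae_slope (ψ := ψ) (a := a) (b := b) (μp := μp) (μn := μn) hψ, hv] with x h1 h2
      exact ⟨h1.1, h1.2.trans h2⟩
    have h := measure_add_tsum_le_eVariationOn (f := slopeVal ψ μp μn) hν
      (sep_subset (slopeSet ψ a b μp μn) fun x => slopeVal ψ μp μn x = d + prim νp νn a x)
      (Ioo_subset_closure_of_ae hd) (fun x hx => hx.2) (countable_jumpSet hui hu hμ)
      (fun x hx => (hmem x hx).1) (fun x hx => ((mem_jumpSet_iff hui hu hμ).1 hx).1)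
    refine le_of_eq_of_le ?_ h
    congr 1
    exact tsum_congr fun x => by rw [(hmem x x.2).2]

lemma FpRel_le_measure_add_tsum [IsFiniteMeasure μp] [IsFiniteMeasure μn] [IsFiniteMeasure νp]
    [IsFiniteMeasure νn] (hψ : PsiHyp ψ) (hab : a < b) (hui : IntegrableOn u (Ioo a b))
    (hu : IsPrim a b u μp μn c) (hv : IsPrim a b (fun x => Psi1 ψ (uaD μp μn x)) νp νn d)
    (hμ : μp ⟂ₘ μn) (hν : νp ⟂ₘ νn) (hp : μp (Ioo a b)ᶜ = 0) (hn : μn (Ioo a b)ᶜ = 0)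
    (hZp : cantorPos a b u μp (ZPlus a b (uaD μp μn))ᶜ = 0)
    (hZn : cantorNeg a b u μn (ZMinus a b (uaD μp μn))ᶜ = 0) :
    FpRel ψ 1 a b u ≤ (μp + μn) (Ioo a b) + ((νp + νn) (Ioo a b \ jumpSet a b u) +
      ∑' x : jumpSet a b u, ENNReal.ofReal
        (|(if 0 < μp.real {(x : ℝ)} then ∫ r, ψ r else 0) - (d + primL νp νn a x)| +
          |d + prim νp νn a x - (if 0 < μp.real {(x : ℝ)} then ∫ r, ψ r else 0)|)) := by
  classical
  have hS := countable_jumpSet hui hu hμ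
  have hmem : ∀ {x}, x ∈ jumpSet a b u ↔ x ∈ Ioo a b ∧ (0 < μp.real {x} ∨ 0 < μn.real {x}) :=
    mem_jumpSet_iff hui hu hμ
  have hw : IntegrableOn (uaD μp μn) (Ioo a b) := (uaD_integrable μp μn).integrableOn
  set e : ℝ → ℝ := fun x => if x ∈ jumpSet a b u then
    (if 0 < μp.real {x} then ∫ r, ψ r else 0) else d + prim νp νn a x with he
  have heS : ∀ x ∈ jumpSet a b u, e x = if 0 < μp.real {x} then ∫ r, ψ r else 0 :=
    fun x hx => if_pos hx
  have heS' : ∀ x ∉ jumpSet a b u, e x = d + prim νp νn a x := fun x hx => if_neg hx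
  have hvar := eVariationOn_le_measure_add_tsum (f := e) (c := d) hν subset_rfl
    (fun x _ hx => heS' x hx) hS (fun x hx => (hmem.1 hx).1)
  have hatom : ∀ {κ ρ : Measure ℝ} [IsFiniteMeasure κ] [IsFiniteMeasure ρ],
      (∀ {x}, x ∈ Ioo a b → 0 < κ.real {x} → x ∈ jumpSet a b u) →
      κ (Ioo a b)ᶜ = 0 → ∀ᵐ x ∂(κ.singularPart volume), x ∉ jumpSet a b u → ρ.real {x} = 0 := by
    intro κ ρ _ _ hκ hκI
    have h := ae_notMem_of_countable (μ := κ.singularPart volume)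
      (C := {x | 0 < ρ.real {x}} \ jumpSet a b u) ((countable_atoms ρ).mono sdiff_subset) ?_
    · filter_upwards [h] with x hx hxS
      by_contra hne
      exact hx ⟨lt_of_le_of_ne measureReal_nonneg (Ne.symm hne), hxS⟩
    · intro x hx
      refine measure_atom_singularPart_eq_zero fun hpos => hx.2 (hκ ?_ hpos)
      by_contra hxI
      rw [measureReal_def, measure_mono_null (singleton_subset_iff.2 hxI) hκI] at hpos
      exact lt_irrefl _ hpos
  have hIn : ∀ {κ : Measure ℝ} [IsFiniteMeasure κ], κ (Ioo a b)ᶜ = 0 →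
      ∀ᵐ x ∂(κ.singularPart volume), x ∈ Ioo a b := fun {κ} _ h =>
    ae_iff.2 (le_antisymm ((Measure.singularPart_le κ volume _).trans h.le) zero_le)
  refine (FpRel_le_add_eVariationOn (D := Ioo a b) (e := e) hψ hab hui ?_ ?_ ?_ hu hp hn).trans
    (add_le_add_right (hvar.trans_eq ?_) _)
  · filter_upwards [ae_restrict_mem measurableSet_Ioo, hv,
      ae_notMem_of_countable hS fun x _ => (measure_singleton x)] with x h1 h2 h3
    exact ⟨h1, (heS' x h3).trans h2.symm⟩
  · have h4 := ae_notMem_of_countable (μ := μp.singularPart volume)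
      (C := {x ∈ jumpSet a b u | ¬ 0 < μp.real {x}}) (hS.mono (sep_subset _ _))
      fun x hx => measure_atom_singularPart_eq_zero hx.2
    have h5 : ∀ᵐ x ∂(μp.singularPart volume), x ∉ jumpSet a b u → x ∈ ZPlus a b (uaD μp μn) := by
      exact ae_imp_of_ae_restrict (ae_iff.2 hZp)
    filter_upwards [hIn hp, h4, h5, hatom (ρ := νp) (fun hx h => hmem.2 ⟨hx, .inl h⟩) hp,
      hatom (ρ := νn) (fun hx h => hmem.2 ⟨hx, .inl h⟩) hp] with x hx h4 h5 h6 h7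
    refine ⟨hx, ?_⟩
    by_cases hxS : x ∈ jumpSet a b u
    · rw [heS x hxS, if_pos (not_not.1 fun h => h4 ⟨hxS, h⟩)]
    · rw [heS' x hxS]
      exact prim_eq_of_mem_ZPlus hψ (h5 hxS) hw hv (h6 hxS) (h7 hxS)
  · have h4 := ae_notMem_of_countable (μ := μn.singularPart volume)
      (C := {x ∈ jumpSet a b u | ¬ 0 < μn.real {x}}) (hS.mono (sep_subset _ _))
      fun x hx => measure_atom_singularPart_eq_zero hx.2
    have h5 : ∀ᵐ x ∂(μn.singularPart volume), x ∉ jumpSet a b u → x ∈ ZMinus a b (uaD μp μn) := by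
      exact ae_imp_of_ae_restrict (ae_iff.2 hZn)
    filter_upwards [hIn hn, h4, h5, hatom (ρ := νp) (fun hx h => hmem.2 ⟨hx, .inr h⟩) hn,
      hatom (ρ := νn) (fun hx h => hmem.2 ⟨hx, .inr h⟩) hn] with x hx h4 h5 h6 h7
    refine ⟨hx, ?_⟩
    by_cases hxS : x ∈ jumpSet a b u
    · have hpos : 0 < μn.real {x} := not_not.1 fun h => h4 ⟨hxS, h⟩
      rw [heS x hxS, if_neg]
      rcases hμ.measureReal_singleton x with h | h
      · rw [h]; exact lt_irrefl _
      · exact absurd h hpos.ne'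
    · rw [heS' x hxS]
      exact prim_eq_of_mem_ZMinus hψ (h5 hxS) hw hv (h6 hxS) (h7 hxS)
  · congr 1
    exact tsum_congr fun x => by rw [heS x x.2]

end Relaxation

/-- the relaxation of `F₁` with respect to strong `L¹` convergence. -/
theorem statement_2 (a b : ℝ) (hab : a < b) (ψ : ℝ → ℝ) (hψ : PsiHyp ψ)
    (u : ℝ → ℝ) (hu : MeasureTheory.IntegrableOn u (Set.Ioo a b)) :
    (∀ μp μn νp νn : Measure ℝ, MemX1 ψ a b u μp μn →
      IsDerivMeasures a b (fun x => Psi1 ψ (uaD μp μn x)) νp νn →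
      FpRel ψ 1 a b u =
        (μp + μn) (Set.Ioo a b) +
        (νp + νn) (Set.Ioo a b \ jumpSet a b u) +
        ∑' x : ↥(jumpSet a b u), ENNReal.ofReal
          (Phi ψ (jumpSign u x)
            (leftApproxLimE (uaD μp μn) x) (rightApproxLimE (uaD μp μn) x))) ∧
    ((¬ ∃ μp μn : Measure ℝ, MemX1 ψ a b u μp μn) → FpRel ψ 1 a b u = ⊤) := by
  refine ⟨fun μp μn νp νn hX hν => ?_, fun h => ?_⟩
  · obtain ⟨hμ, -, hZp, hZn⟩ := hX
    obtain ⟨c, hc⟩ := hμ.exists_isPrim hab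
    obtain ⟨d, hd⟩ := hν.exists_isPrim hab
    obtain ⟨-, _, _, hμs, hp, hn, -⟩ := hμ
    obtain ⟨-, _, _, hνs, -⟩ := hν
    have hPhi : ∀ x : jumpSet a b u, Phi ψ (jumpSign u x) (leftApproxLimE (uaD μp μn) x)
        (rightApproxLimE (uaD μp μn) x) =
        |(if 0 < μp.real {(x : ℝ)} then ∫ r, ψ r else 0) - (d + primL νp νn a x)| +
          |d + prim νp νn a x - (if 0 < μp.real {(x : ℝ)} then ∫ r, ψ r else 0)| :=
      fun x => Phi_approxLimE_eq hψ hu hc hd hμs ((mem_jumpSet_iff hu hc hμs).1 x.2).1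
    simp only [hPhi, add_assoc]
    exact le_antisymm (FpRel_le_measure_add_tsum hψ hab hu hc hd hμs hνs hp hn hZp hZn)
      (measure_add_tsum_le_FpRel hψ hu hc hd hμs hνs hp hn)
  · by_contra hne
    exact h (exists_memX1_of_FpRel_ne_top hψ hab hu hne)
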